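/- Fix an integer t ≥ 2 and let n ≥ 2263 satisfy exp(2/p_m) · f(m) < ζ(t) for all m ≥ n, where f(m) := 1 + 1.1253/(log p_m · log log N_m). Then for every integer N ≥ N_n one has R_t(N) < e^γ, where R_t(x) := Ψ_t(x)/(x log log x). -/

import Mathlib

open Finset Filter

/-- Generalized Dedekind psi function `Ψ_t(n) = n ∏_{p ∣ n} (1 + 1/p + ⋯ + 1/p^(t-1))`. -/
noncomputable def Psi (t n : ℕ) : ℝ :=
  (n : ℝ) * ∏ p ∈ n.primeFactors, ∑ i ∈ Finset.range t, (1 : ℝ) / (p : ℝ) ^ i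

/-- The primorial `N_n = ∏_{k=1}^n p_k`, the product of the first `n` primes. -/
noncomputable def primorialAt (n : ℕ) : ℕ := ∏ k ∈ Finset.range n, Nat.nth Nat.Prime k

/-- The `n`-th prime `p_n` (so `nthPrime 1 = 2`). -/
noncomputable def nthPrime (n : ℕ) : ℕ := Nat.nth Nat.Prime (n - 1)

/-- The ratio `R_t(x) = Ψ_t(x) / (x log log x)`. -/
noncomputable def Rt (t n : ℕ) : ℝ := Psi t n / ((n : ℝ) * Real.log (Real.log n))

/-- The Riemann zeta value `ζ(t) = ∑_{n ≥ 1} n^{-t}` at an integer argument. -/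
noncomputable def zetaNat (t : ℕ) : ℝ := ∑' k : ℕ, 1 / ((k : ℝ) + 1) ^ t

section EntireFunctions

open Metric Topology Complex

/-- If a holomorphic function without zeros on a disc satisfies `‖g z‖ ≤ ‖g 0‖ exp M`, then its
logarithmic derivative is Lipschitz on a smaller disc with an explicit constant. -/
lemma norm_logDeriv_sub_le_of_norm_le_exp {g : ℂ → ℂ} (hg : Differentiable ℂ g) {R M : ℝ}
    (hR : 0 < R) (hM : 0 < M) (hnz : ∀ z ∈ ball (0 : ℂ) R, g z ≠ 0)
    (hbd : ∀ z ∈ ball (0 : ℂ) R, ‖g z‖ ≤ ‖g 0‖ * Real.exp M) {s w : ℂ}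
    (hs : s ∈ ball (0 : ℂ) (R / 8)) (hw : w ∈ ball (0 : ℂ) (R / 8)) :
    ‖logDeriv g s - logDeriv g w‖ ≤ 64 * M / R ^ 2 * ‖s - w‖ := by
  have h0 : (0 : ℂ) ∈ ball (0 : ℂ) R := by simpa using hR
  have hd : DifferentiableOn ℂ (logDeriv g) (ball 0 R) := by
    intro z hz
    have h1 : DifferentiableAt ℂ (deriv g) z := (hg.analyticAt z).deriv.differentiableAt
    exact (h1.div (hg z) (hnz z hz)).differentiableWithinAt
  obtain ⟨h, h00, hh⟩ := hd.isExactOn_ball.with_val_at 0 0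
  have hconst : ∀ z ∈ ball (0 : ℂ) R, g z = g 0 * Complex.exp (h z) := by
    have hder : ∀ z ∈ ball (0 : ℂ) R,
        HasDerivAt (fun z => g z * Complex.exp (-h z)) 0 z := by
      intro z hz
      have := (hg z).hasDerivAt.mul ((hh z hz).neg.cexp)
      refine this.congr_deriv ?_
      have h2 : logDeriv g z * g z = deriv g z := div_mul_cancel₀ _ (hnz z hz)
      change deriv g z * Complex.exp (-h z) + g z * (Complex.exp (-h z) * -logDeriv g z) = 0
      linear_combination -Complex.exp (-h z) * h2
    intro z hz
    have := (convex_ball (0 : ℂ) R).norm_image_sub_le_of_norm_hasDerivWithin_le (𝕜 := ℂ) (C := 0)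
      (f := fun z => g z * Complex.exp (-h z)) (f' := fun _ => 0)
      (fun x hx => (hder x hx).hasDerivWithinAt) (by simp) h0 hz
    simp only [zero_mul, norm_le_zero_iff, h00, neg_zero, Complex.exp_zero, mul_one,
      sub_eq_zero] at this
    rw [← this, mul_assoc, ← Complex.exp_add]
    simp
  have hre : Set.MapsTo h (ball 0 R) {z | z.re ≤ M} := by
    intro z hz
    have h1 := hbd z hz
    rw [hconst z hz, norm_mul, Complex.norm_exp] at h1
    have h2 : 0 < ‖g 0‖ := norm_pos_iff.2 (hnz 0 h0)
    exact Real.exp_le_exp.1 (le_of_mul_le_mul_left h1 h2)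
  have hhd : DifferentiableOn ℂ h (ball 0 R) := fun z hz =>
    (hh z hz).differentiableAt.differentiableWithinAt
  have hb0 : ∀ z ∈ closedBall (0 : ℂ) (R / 2), ‖h z‖ ≤ 2 * M := by
    intro z hz
    have hz' : ‖z‖ ≤ R / 2 := by simpa using hz
    have := Complex.borelCaratheodory_zero hM hhd hre hR
      (by simp; linarith) h00
    refine this.trans ?_
    rw [div_le_iff₀ (by linarith)]
    nlinarith
  have hb1 : ∀ z ∈ closedBall (0 : ℂ) (R / 4), ‖logDeriv g z‖ ≤ 8 * M / R := by
    intro z hz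
    have hz' : ‖z‖ ≤ R / 4 := by simpa using hz
    have hsub : closedBall z (R / 4) ⊆ closedBall 0 (R / 2) := by
      intro y hy
      have h1 : ‖y - z‖ ≤ R / 4 := by simpa [dist_eq_norm] using hy
      have h2 := norm_add_le (y - z) z
      simp only [sub_add_cancel] at h2
      simp; linarith
    have hsub2 : closedBall (0 : ℂ) (R / 2) ⊆ ball 0 R := closedBall_subset_ball (by linarith)
    have h3 := Complex.norm_deriv_le_of_forall_mem_sphere_norm_le (c := z) (R := R / 4) (f := h)
      (C := 2 * M) (by positivity)
      ((hhd.mono (hsub.trans hsub2)).diffContOnCl_ball subset_rfl)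
      (fun y hy => hb0 y (hsub (sphere_subset_closedBall hy)))
    rw [(hh z (hsub2 (hsub (mem_closedBall_self (by positivity))))).deriv] at h3
    refine h3.trans (le_of_eq ?_)
    field_simp; norm_num
  have hb2 : ∀ z ∈ ball (0 : ℂ) (R / 8), ‖deriv (logDeriv g) z‖ ≤ 64 * M / R ^ 2 := by
    intro z hz
    have hz' : ‖z‖ < R / 8 := by simpa using hz
    have hsub : closedBall z (R / 8) ⊆ closedBall 0 (R / 4) := by
      intro y hy
      have h1 : ‖y - z‖ ≤ R / 8 := by simpa [dist_eq_norm] using hy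
      have h2 := norm_add_le (y - z) z
      simp only [sub_add_cancel] at h2
      simp; linarith
    have hsub2 : closedBall (0 : ℂ) (R / 4) ⊆ ball 0 R := closedBall_subset_ball (by linarith)
    have h3 := Complex.norm_deriv_le_of_forall_mem_sphere_norm_le (c := z) (R := R / 8)
      (f := logDeriv g) (C := 8 * M / R) (by positivity)
      ((hd.mono (hsub.trans hsub2)).diffContOnCl_ball subset_rfl)
      (fun y hy => hb1 y (hsub (sphere_subset_closedBall hy)))
    refine h3.trans (le_of_eq ?_)
    field_simp; norm_num
  have hsub8 : ball (0 : ℂ) (R / 8) ⊆ ball 0 R := ball_subset_ball (by linarith)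
  exact (convex_ball (0 : ℂ) (R / 8)).norm_image_sub_le_of_norm_deriv_le (𝕜 := ℂ)
    (fun x hx => (hd.differentiableAt (isOpen_ball.mem_nhds (hsub8 hx)))) hb2 hw hs

lemma exists_eq_one_sub_div_pow_mul {f : ℂ → ℂ} (hf : Differentiable ℂ f) {a : ℂ} (ha : a ≠ 0)
    (hord : analyticOrderAt f a ≠ ⊤) :
    ∃ g : ℂ → ℂ, Differentiable ℂ g ∧ g a ≠ 0 ∧
      ∀ z, f z = (1 - z / a) ^ analyticOrderNatAt f a * g z := by
  set n := analyticOrderNatAt f a with hn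
  have h1 : analyticOrderAt f a = n := (Nat.cast_analyticOrderNatAt hord).symm
  obtain ⟨g₀, hg₀, hg₀a, hev⟩ := (hf.analyticAt a).analyticOrderAt_eq_natCast.1 h1
  classical
  let g : ℂ → ℂ := fun z => if z = a then (-a) ^ n * g₀ a else f z / (1 - z / a) ^ n
  have hne : ∀ z, z ≠ a → (1 - z / a) ≠ 0 := by
    intro z hz h
    apply hz
    field_simp at h
    linear_combination -h
  have hga : g =ᶠ[𝓝 a] fun z => (-a) ^ n * g₀ z := by
    filter_upwards [hev] with z hz
    by_cases hza : z = a
    · simp [g, hza]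
    · simp only [g, hza, if_false, hz, smul_eq_mul]
      rw [div_eq_iff (pow_ne_zero _ (hne z hza))]
      have : z - a = (-a) * (1 - z / a) := by field_simp; ring
      rw [this, mul_pow]; ring
  refine ⟨g, ?_, ?_, ?_⟩
  · intro z
    by_cases hza : z = a
    · subst hza
      exact ((hg₀.differentiableAt.const_mul _).congr_of_eventuallyEq hga)
    · have : g =ᶠ[𝓝 z] fun z => f z / (1 - z / a) ^ n := by
        filter_upwards [isOpen_ne.mem_nhds hza] with w hw
        simp [g, show w ≠ a from hw]
      refine DifferentiableAt.congr_of_eventuallyEq ?_ this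
      exact (hf z).div (by fun_prop) (pow_ne_zero _ (hne z hza))
  · simp [g, ha, hg₀a]
  · intro z
    by_cases hza : z = a
    · subst hza
      have := hev.self_of_nhds
      rw [this]
      rcases Nat.eq_zero_or_pos n with h | h
      · simp [g, h]
      · simp [h.ne', ha]
    · simp only [g, hza, if_false]
      rw [mul_div_cancel₀ _ (pow_ne_zero _ (hne z hza))]

lemma exists_eq_prod_one_sub_div_pow_mul {f : ℂ → ℂ} (hf : Differentiable ℂ f)
    (hord : ∀ a, analyticOrderAt f a ≠ ⊤) (S : Finset ℂ) (hS : (0 : ℂ) ∉ S) :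
    ∃ g : ℂ → ℂ, Differentiable ℂ g ∧ (∀ a ∈ S, g a ≠ 0) ∧
      ∀ z, f z = (∏ a ∈ S, (1 - z / a) ^ analyticOrderNatAt f a) * g z := by
  classical
  induction S using Finset.induction_on with
  | empty => exact ⟨f, hf, by simp, by simp⟩
  | insert a S haS ih =>
    obtain ⟨g, hg, hgS, hfg⟩ := ih (fun h => hS (Finset.mem_insert_of_mem h))
    have ha : a ≠ 0 := fun h => hS (by simp [h])
    have hP : Differentiable ℂ fun z => ∏ b ∈ S, (1 - z / b) ^ analyticOrderNatAt f b := by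
      fun_prop
    have hPa : (∏ b ∈ S, (1 - a / b) ^ analyticOrderNatAt f b) ≠ 0 := by
      refine Finset.prod_ne_zero_iff.2 fun b hb => pow_ne_zero _ ?_
      have hb0 : b ≠ 0 := fun h => hS (by simp [← h, hb])
      intro h
      apply haS
      field_simp at h
      rwa [show a = b by linear_combination -h]
    have hfun : f = (fun z => ∏ b ∈ S, (1 - z / b) ^ analyticOrderNatAt f b) * g := by
      ext z; exact hfg z
    have hoP : analyticOrderAt (fun z => ∏ b ∈ S, (1 - z / b) ^ analyticOrderNatAt f b) a = 0 :=
      (hP.analyticAt a).analyticOrderAt_eq_zero.2 hPa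
    have hog : analyticOrderAt f a = analyticOrderAt g a := by
      conv_lhs => rw [hfun]
      rw [analyticOrderAt_mul (hP.analyticAt a) (hg.analyticAt a), hoP, zero_add]
    obtain ⟨k, hk, hka, hgk⟩ := exists_eq_one_sub_div_pow_mul hg ha (by rw [← hog]; exact hord a)
    have hnat : analyticOrderNatAt g a = analyticOrderNatAt f a := by
      simp [analyticOrderNatAt, hog]
    refine ⟨k, hk, ?_, ?_⟩
    · intro b hb
      rcases Finset.mem_insert.1 hb with rfl | hb
      · exact hka
      · intro h
        exact hgS b hb (by rw [hgk, h, mul_zero])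
    · intro z
      rw [Finset.prod_insert haS, hfg z, hgk z, hnat]
      ring

lemma finite_setOf_norm_le_eq_zero {f : ℂ → ℂ} (hf : Differentiable ℂ f) (h0 : f 0 ≠ 0) (R : ℝ) :
    {z : ℂ | ‖z‖ ≤ R ∧ f z = 0}.Finite := by
  have h1 : AnalyticOnNhd ℂ f Set.univ := fun z _ => hf.analyticAt z
  have h2 := h1.preimage_zero_mem_codiscrete h0
  have h3 := (isCompact_closedBall (0 : ℂ) R).finite_sdiff_of_mem_codiscreteWithin
    (Filter.codiscreteWithin_mono (Set.subset_univ _) h2)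
  refine h3.subset ?_
  rintro z ⟨hz, hfz⟩
  simp [hz, hfz]

/-- The finite set of zeros of an entire function in a closed disc. -/
noncomputable def zerosIn (f : ℂ → ℂ) (R : ℝ) : Finset ℂ :=
  open scoped Classical in
  if h : {z : ℂ | ‖z‖ ≤ R ∧ f z = 0}.Finite then h.toFinset else ∅

lemma mem_zerosIn {f : ℂ → ℂ} (hf : Differentiable ℂ f) (h0 : f 0 ≠ 0) {R : ℝ} {z : ℂ} :
    z ∈ zerosIn f R ↔ ‖z‖ ≤ R ∧ f z = 0 := by
  simp [zerosIn, finite_setOf_norm_le_eq_zero hf h0 R]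

lemma analyticOrderAt_ne_top_of_entire {f : ℂ → ℂ} (hf : Differentiable ℂ f) (h0 : f 0 ≠ 0)
    (a : ℂ) : analyticOrderAt f a ≠ ⊤ := by
  intro h
  rw [AnalyticOnNhd.analyticOrderAt_eq_top_iff_eq_zero a (fun z => hf.analyticAt z)] at h
  exact h0 (by simp [h])

/-- The logarithmic derivative of an entire function of subquadratic exponential growth, minus
the contribution of its zeros in a large disc, has small variation. -/
lemma norm_logDeriv_sub_sum_zerosIn_le {f : ℂ → ℂ} (hf : Differentiable ℂ f) (h0 : f 0 = 1)
    {R M : ℝ} (hR : 0 < R) (hM : 0 < M) (hb : ∀ z : ℂ, ‖z‖ = 2 * R → ‖f z‖ ≤ Real.exp M)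
    {s w : ℂ} (hs : ‖s‖ < R / 8) (hw : ‖w‖ < R / 8) (hfs : f s ≠ 0) (hfw : f w ≠ 0) :
    ‖(logDeriv f s - ∑ ρ ∈ zerosIn f R, (analyticOrderNatAt f ρ : ℂ) / (s - ρ)) -
      (logDeriv f w - ∑ ρ ∈ zerosIn f R, (analyticOrderNatAt f ρ : ℂ) / (w - ρ))‖ ≤
      64 * M / R ^ 2 * ‖s - w‖ := by
  have h0' : f 0 ≠ 0 := by simp [h0]
  have hS0 : (0 : ℂ) ∉ zerosIn f R := by simp [mem_zerosIn hf h0', h0]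
  obtain ⟨g, hg, hgS, hfg⟩ := exists_eq_prod_one_sub_div_pow_mul hf
    (analyticOrderAt_ne_top_of_entire hf h0') (zerosIn f R) hS0
  have hne : ∀ ρ ∈ zerosIn f R, ρ ≠ 0 := fun ρ hρ h => hS0 (h ▸ hρ)
  have hg0 : g 0 = 1 := by have := hfg 0; simpa [h0] using this.symm
  have hnz : ∀ z ∈ ball (0 : ℂ) R, g z ≠ 0 := by
    intro z hz
    by_cases hzS : z ∈ zerosIn f R
    · exact hgS z hzS
    · intro h
      apply hzS
      rw [mem_zerosIn hf h0']
      refine ⟨by have := mem_ball_zero_iff.1 hz; exact this.le, by rw [hfg, h, mul_zero]⟩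
  have hsph : ∀ z : ℂ, ‖z‖ = 2 * R → ‖g z‖ ≤ Real.exp M := by
    intro z hz
    refine le_trans ?_ (hb z hz)
    rw [hfg z, norm_mul, norm_prod]
    refine le_mul_of_one_le_left (norm_nonneg _) ?_
    rw [← Finset.prod_const_one (s := zerosIn f R)]
    refine Finset.prod_le_prod (fun _ _ => zero_le_one) fun ρ hρ => ?_
    rw [norm_pow]
    refine one_le_pow₀ ?_
    have h1 : ‖ρ‖ ≤ R := ((mem_zerosIn hf h0').1 hρ).1
    have h2 : 0 < ‖ρ‖ := norm_pos_iff.2 (hne ρ hρ)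
    have h3 : 2 ≤ ‖z / ρ‖ := by
      rw [norm_div, hz, le_div_iff₀ h2]; linarith
    have h4 := norm_sub_norm_le (z / ρ) 1
    rw [norm_sub_rev] at h4
    simp at h4
    rw [norm_div] at h3
    linarith
  have hbd : ∀ z ∈ ball (0 : ℂ) R, ‖g z‖ ≤ ‖g 0‖ * Real.exp M := by
    intro z hz
    rw [hg0, norm_one, one_mul]
    refine Complex.norm_le_of_forall_mem_frontier_norm_le (U := ball (0 : ℂ) (2 * R))
      isBounded_ball hg.diffContOnCl ?_ (subset_closure (ball_subset_ball (by linarith) hz))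
    intro y hy
    rw [frontier_ball _ (by linarith)] at hy
    exact hsph y (by simpa using hy)
  have key : ∀ u : ℂ, ‖u‖ < R / 8 → f u ≠ 0 →
      logDeriv f u - ∑ ρ ∈ zerosIn f R, (analyticOrderNatAt f ρ : ℂ) / (u - ρ) =
        logDeriv g u := by
    intro u hu hfu
    have hfun : f = fun z => (∏ a ∈ zerosIn f R, (1 - z / a) ^ analyticOrderNatAt f a) * g z := by
      ext z; exact hfg z
    have hPu : ∀ a ∈ zerosIn f R, (1 - u / a) ≠ 0 := by
      intro a ha h
      have := hne a ha
      field_simp at h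
      apply hfu
      rw [show u = a by linear_combination -h]
      exact ((mem_zerosIn hf h0').1 ha).2
    have h1 : logDeriv f u = logDeriv (fun z => ∏ a ∈ zerosIn f R,
        (1 - z / a) ^ analyticOrderNatAt f a) u + logDeriv g u := by
      conv_lhs => rw [hfun]
      refine logDeriv_mul u ?_ (hnz u (by simp; linarith)) (by fun_prop) (hg u)
      exact Finset.prod_ne_zero_iff.2 fun a ha => pow_ne_zero _ (hPu a ha)
    have h2 : logDeriv (fun z => ∏ a ∈ zerosIn f R, (1 - z / a) ^ analyticOrderNatAt f a) u =
        ∑ ρ ∈ zerosIn f R, (analyticOrderNatAt f ρ : ℂ) / (u - ρ) := by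
      rw [logDeriv_prod (f := fun a z => (1 - z / a) ^ analyticOrderNatAt f a)
        (fun i hi => pow_ne_zero _ (hPu i hi)) (fun i _ => by fun_prop)]
      refine Finset.sum_congr rfl fun a ha => ?_
      rw [logDeriv_fun_pow (by fun_prop)]
      have h3 : HasDerivAt (fun z : ℂ => 1 - z / a) (-(1 / a)) u :=
        ((hasDerivAt_id u).div_const a).const_sub 1
      rw [logDeriv_apply, h3.deriv]
      have h4 := hPu a ha
      have h5 := hne a ha
      have h6 : u - a ≠ 0 := by
        intro h; apply h4; rw [sub_eq_zero.1 h]; field_simp; ring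
      have h7 : a - u ≠ 0 := by rw [← neg_sub]; exact neg_ne_zero.2 h6
      have h8 : 1 - u / a = (a - u) / a := by field_simp
      rw [h8]
      field_simp
      ring
    rw [h1, h2]; ring
  rw [key s hs hfs, key w hw hfw]
  exact norm_logDeriv_sub_le_of_norm_le_exp hg hR hM hnz hbd (by simpa using hs) (by simpa using hw)

/-- Partial fractions for an entire function with `f (1 - s) = f s` and growth exponent `< 2`,
as a limit of sums over the zeros in discs. -/
theorem tendsto_sum_zerosIn_symm {f : ℂ → ℂ} (hf : Differentiable ℂ f) (h0 : f 0 = 1)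
    (hsymm : ∀ z, f (1 - z) = f z) {C : ℝ}
    (hb : ∀ z : ℂ, 1 ≤ ‖z‖ → ‖f z‖ ≤ Real.exp (C * ‖z‖ ^ (3 / 2 : ℝ))) {s : ℂ} (hfs : f s ≠ 0) :
    Tendsto (fun R : ℝ => ∑ ρ ∈ zerosIn f R,
      (analyticOrderNatAt f ρ : ℂ) * (1 / (s - ρ) + 1 / (s - 1 + ρ))) atTop
      (𝓝 (2 * logDeriv f s)) := by
  have hfs' : f (1 - s) ≠ 0 := by rwa [hsymm]
  have hld : logDeriv f (1 - s) = - logDeriv f s := by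
    have h1 : (fun z => f (1 - z)) = f := funext hsymm
    have h2 : deriv f s = - deriv f (1 - s) := by
      conv_lhs => rw [← h1]
      have := ((hf (1 - s)).hasDerivAt.comp s ((hasDerivAt_id s).const_sub 1)).deriv
      simpa [Function.comp_def] using this
    rw [logDeriv_apply, logDeriv_apply, h2, hsymm]; ring
  set C' := max C 1
  have hlim : Tendsto (fun R : ℝ => 64 * (C' * (2 * R) ^ (3 / 2 : ℝ)) / R ^ 2 * ‖s - (1 - s)‖)
      atTop (𝓝 0) := by
    have h1 : Tendsto (fun R : ℝ => 64 * C' * 2 ^ (3 / 2 : ℝ) * ‖s - (1 - s)‖ *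
        R ^ (-(1 / 2) : ℝ)) atTop (𝓝 0) := by
      simpa using (tendsto_rpow_neg_atTop (y := 1 / 2) (by norm_num)).const_mul
        (64 * C' * 2 ^ (3 / 2 : ℝ) * ‖s - (1 - s)‖)
    refine h1.congr' ?_
    filter_upwards [eventually_gt_atTop 0] with R hR
    rw [Real.mul_rpow (by norm_num) hR.le]
    have : R ^ (-(1 / 2) : ℝ) = R ^ (3 / 2 : ℝ) / R ^ 2 := by
      rw [← Real.rpow_natCast, ← Real.rpow_sub hR]; norm_num
    rw [this]; ring
  rw [tendsto_iff_norm_sub_tendsto_zero]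
  refine squeeze_zero' (Eventually.of_forall fun _ => norm_nonneg _) ?_ hlim
  filter_upwards [eventually_gt_atTop (8 * ‖s‖), eventually_gt_atTop (8 * ‖1 - s‖),
    eventually_gt_atTop 1] with R h1 h2 h3
  have hC' : 0 < C' := lt_of_lt_of_le one_pos (le_max_right _ _)
  have h4 := norm_logDeriv_sub_sum_zerosIn_le hf h0 (R := R) (M := C' * (2 * R) ^ (3 / 2 : ℝ))
    (by linarith) (by positivity) (fun z hz => by
      refine (hb z (by linarith)).trans (Real.exp_le_exp.2 ?_)
      rw [hz]
      gcongr
      exact le_max_left _ _) (s := s) (w := 1 - s) (by linarith) (by linarith) hfs hfs'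
  rw [hld] at h4
  refine le_trans (le_of_eq ?_) h4
  rw [← norm_neg]
  congr 1
  have h5 : ∀ ρ : ℂ, (analyticOrderNatAt f ρ : ℂ) * (1 / (s - ρ) + 1 / (s - 1 + ρ)) =
      (analyticOrderNatAt f ρ : ℂ) / (s - ρ) - (analyticOrderNatAt f ρ : ℂ) / (1 - s - ρ) := by
    intro ρ
    rw [show 1 - s - ρ = -(s - 1 + ρ) by ring, div_neg]; ring
  simp only [h5, Finset.sum_sub_distrib]
  ring

end EntireFunctions

section RiemannXi

open Complex Topology HurwitzZeta MeasureTheory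

lemma norm_mellin_le_norm_mellin_re {F : ℝ → ℂ} (hF : ∀ x ∈ Set.Ioi (0 : ℝ), F x = (‖F x‖ : ℝ))
    (s : ℂ) : ‖mellin F s‖ ≤ ‖mellin F s.re‖ := by
  have h1 : mellin F s.re = ((∫ t in Set.Ioi (0 : ℝ), t ^ (s.re - 1) * ‖F t‖ : ℝ) : ℂ) := by
    rw [mellin, ← integral_complex_ofReal]
    refine setIntegral_congr_fun measurableSet_Ioi fun t ht => ?_
    have ht' : (0 : ℝ) < t := ht
    simp only [smul_eq_mul]
    rw [hF t ht]
    simp only [norm_real, norm_norm]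
    push_cast [ofReal_cpow ht'.le]
    ring_nf
  rw [h1, norm_real, Real.norm_of_nonneg]
  · refine (norm_integral_le_integral_norm _).trans (le_of_eq ?_)
    refine setIntegral_congr_fun measurableSet_Ioi fun t ht => ?_
    have ht' : (0 : ℝ) < t := ht
    simp [norm_cpow_eq_rpow_re_of_pos ht']
  · refine setIntegral_nonneg measurableSet_Ioi fun t ht => ?_
    have ht' : (0 : ℝ) < t := ht
    positivity

lemma one_le_evenKernel_zero {x : ℝ} (hx : 0 < x) : 1 ≤ evenKernel 0 x := by
  have h := hasSum_int_evenKernel 0 hx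
  have h1 := h.summable.le_tsum (0 : ℤ) (fun _ _ => (Real.exp_pos _).le)
  have h2 := h.tsum_eq
  simp only [QuotientAddGroup.mk_zero] at h2
  rw [← h2]
  simpa using h1

lemma norm_completedRiemannZeta₀_le (s : ℂ) :
    ‖completedRiemannZeta₀ s‖ ≤ ‖completedRiemannZeta₀ s.re‖ := by
  have hk : ∀ s, completedRiemannZeta₀ s = mellin (hurwitzEvenFEPair 0).f_modif (s / 2) / 2 := by
    intro s; rfl
  rw [hk, hk, norm_div, norm_div]
  have := norm_mellin_le_norm_mellin_re (F := (hurwitzEvenFEPair 0).f_modif) ?_ (s / 2)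
  · have h2 : (((s / 2).re : ℝ) : ℂ) = (s.re : ℂ) / 2 := by simp
    rw [h2] at this
    gcongr
  · intro x hx
    have hx' : (0 : ℝ) < x := hx
    have key : ∃ r : ℝ, 0 ≤ r ∧ (hurwitzEvenFEPair 0).f_modif x = (r : ℂ) := by
      rcases lt_trichotomy x 1 with h | h | h
      · refine ⟨evenKernel 0 x - x ^ (-(1 / 2) : ℝ), ?_, ?_⟩
        · rw [evenKernel_functional_equation, ← evenKernel_eq_cosKernel_of_zero,
            Real.rpow_neg hx'.le, one_div (x ^ (1 / 2 : ℝ))]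
          have h1 := one_le_evenKernel_zero (one_div_pos.2 hx')
          have h2 : 0 < (x ^ (1 / 2 : ℝ))⁻¹ := by positivity
          nlinarith
        · simp [WeakFEPair.f_modif, hurwitzEvenFEPair, h, hx', h.le]
      · exact ⟨0, le_rfl, by simp [WeakFEPair.f_modif, h]⟩
      · refine ⟨evenKernel 0 x - 1, by linarith [one_le_evenKernel_zero hx'], ?_⟩
        simp [WeakFEPair.f_modif, hurwitzEvenFEPair, h, h.le]
    obtain ⟨r, hr, hrx⟩ := key
    rw [hrx, norm_real, Real.norm_of_nonneg hr]

/-- The entire function `s (s - 1) π^(-s/2) Γ(s/2) ζ(s)`. -/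
noncomputable def riemannXi (s : ℂ) : ℂ := 1 + s * (s - 1) * completedRiemannZeta₀ s

lemma differentiable_riemannXi : Differentiable ℂ riemannXi := by
  have := differentiable_completedZeta₀
  unfold riemannXi
  fun_prop

lemma riemannXi_one_sub (s : ℂ) : riemannXi (1 - s) = riemannXi s := by
  rw [riemannXi, completedRiemannZeta₀_one_sub, riemannXi]; ring

lemma riemannXi_zero : riemannXi 0 = 1 := by simp [riemannXi]

lemma riemannXi_one : riemannXi 1 = 1 := by simp [riemannXi]

lemma riemannXi_eq_completed {s : ℂ} (h0 : s ≠ 0) (h1 : s ≠ 1) :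
    riemannXi s = s * (s - 1) * completedRiemannZeta s := by
  have h2 : 1 - s ≠ 0 := sub_ne_zero.2 h1.symm
  rw [completedRiemannZeta_eq, riemannXi]
  field_simp
  ring

lemma riemannXi_eq {s : ℂ} (h0 : 0 < s.re) (h1 : s ≠ 1) :
    riemannXi s = s * (s - 1) * Gammaℝ s * riemannZeta s := by
  have hs0 : s ≠ 0 := fun h => by simp [h] at h0
  rw [riemannXi_eq_completed hs0 h1, riemannZeta_def_of_ne_zero hs0]
  have := Gammaℝ_ne_zero_of_re_pos h0
  field_simp

lemma riemannXi_ne_zero_of_one_le_re {s : ℂ} (hs : 1 ≤ s.re) : riemannXi s ≠ 0 := by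
  by_cases h1 : s = 1
  · simp [h1, riemannXi_one]
  · have h0 : 0 < s.re := by linarith
    have hs0 : s ≠ 0 := fun h => by simp [h] at h0
    rw [riemannXi_eq h0 h1]
    have := riemannZeta_ne_zero_of_one_le_re hs
    have := Gammaℝ_ne_zero_of_re_pos h0
    have := sub_ne_zero.2 h1
    positivity

lemma re_mem_Ioo_of_riemannXi_eq_zero {s : ℂ} (hs : riemannXi s = 0) : s.re ∈ Set.Ioo (0 : ℝ) 1 := by
  constructor
  · by_contra! h
    refine riemannXi_ne_zero_of_one_le_re (s := 1 - s) (by simp; linarith) ?_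
    rw [riemannXi_one_sub, hs]
  · by_contra! h
    exact riemannXi_ne_zero_of_one_le_re h hs

lemma Gamma_le_exp_rpow {x : ℝ} (hx : 1 ≤ x) :
    Real.Gamma x ≤ Real.exp (2 * (x + 2) ^ (3 / 2 : ℝ)) := by
  set n := ⌈x⌉₊
  have hn1 : x ≤ n := Nat.le_ceil x
  have hn2 : (n : ℝ) < x + 1 := Nat.ceil_lt_add_one (by linarith)
  have hn3 : 1 ≤ n := by
    have : (1 : ℝ) ≤ n := hx.trans hn1
    exact_mod_cast this
  have hle : Real.Gamma x ≤ n.factorial := by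
    rcases le_total 2 x with h | h
    · have h3 := Real.Gamma_strictMonoOn_Ici.monotoneOn (a := x) (b := n + 1) h
        (by simp; linarith) (by linarith)
      rwa [Real.Gamma_nat_eq_factorial] at h3
    · have hc := Real.convexOn_Gamma.2 (show (1 : ℝ) ∈ Set.Ioi 0 by simp)
        (show (2 : ℝ) ∈ Set.Ioi 0 by simp) (show 0 ≤ 2 - x by linarith)
        (show 0 ≤ x - 1 by linarith) (by ring)
      have h2 : Real.Gamma 2 = 1 := Real.Gamma_two
      simp only [smul_eq_mul, Real.Gamma_one, h2, mul_one] at hc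
      rw [show 2 - x + (x - 1) * 2 = x by ring, show 2 - x + (x - 1) = 1 by ring] at hc
      exact hc.trans (by exact_mod_cast Nat.one_le_iff_ne_zero.2 n.factorial_ne_zero)
  refine hle.trans ?_
  have h4 : (n.factorial : ℝ) ≤ (n : ℝ) ^ n := by exact_mod_cast Nat.factorial_le_pow n
  refine h4.trans ?_
  have hn0 : (0 : ℝ) < n := by linarith
  rw [← Real.log_le_iff_le_exp (by positivity), Real.log_pow]
  have h5 := Real.log_le_rpow_div hn0.le (ε := 1 / 2) (by norm_num)
  have h6 : (n : ℝ) ^ (3 / 2 : ℝ) = n * (n : ℝ) ^ (1 / 2 : ℝ) := by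
    rw [show (3 / 2 : ℝ) = 1 + 1 / 2 by norm_num, Real.rpow_add hn0, Real.rpow_one]
  calc (n : ℝ) * Real.log n ≤ n * ((n : ℝ) ^ (1 / 2 : ℝ) / (1 / 2)) := by gcongr
    _ = 2 * (n : ℝ) ^ (3 / 2 : ℝ) := by rw [h6]; ring
    _ ≤ _ := by gcongr; linarith

lemma exists_norm_completedRiemannZeta₀_le :
    ∃ C : ℝ, 0 ≤ C ∧ ∀ s : ℂ, ‖completedRiemannZeta₀ s‖ ≤
      C * Real.exp (2 * (‖s‖ + 3) ^ (3 / 2 : ℝ)) := by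
  have hbig : ∃ C : ℝ, ∀ σ : ℝ, 2 ≤ σ → ‖completedRiemannZeta₀ σ‖ ≤
      C * Real.exp (2 * (σ + 2) ^ (3 / 2 : ℝ)) := by
    refine ⟨(∑' n : ℕ, 1 / ((n : ℝ) + 1) ^ 2) + 2, fun σ hσ => ?_⟩
    have hσ0 : (σ : ℂ) ≠ 0 := by norm_cast; linarith
    have hσ1 : (1 : ℂ) - σ ≠ 0 := by norm_cast; linarith
    have h1 : completedRiemannZeta₀ σ = Gammaℝ σ * riemannZeta σ + 1 / σ + 1 / (1 - σ) := by
      rw [riemannZeta_def_of_ne_zero hσ0, mul_div_cancel₀ _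
        (Gammaℝ_ne_zero_of_re_pos (by simp; linarith)), completedRiemannZeta_eq]
      ring
    have hE : 1 ≤ Real.exp (2 * (σ + 2) ^ (3 / 2 : ℝ)) := Real.one_le_exp (by positivity)
    have hsum : Summable fun n : ℕ => 1 / ((n : ℝ) + 1) ^ 2 := by
      exact_mod_cast (summable_nat_add_iff 1).2 (Real.summable_one_div_nat_pow.2 one_lt_two)
    have hz : ‖riemannZeta σ‖ ≤ ∑' n : ℕ, 1 / ((n : ℝ) + 1) ^ 2 := by
      rw [zeta_eq_tsum_one_div_nat_add_one_cpow (by simp; linarith)]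
      refine tsum_of_norm_bounded hsum.hasSum fun n => ?_
      rw [norm_div, norm_one]
      have : ‖((n : ℂ) + 1) ^ (σ : ℂ)‖ = ((n : ℝ) + 1) ^ σ := by
        have h := norm_cpow_eq_rpow_re_of_pos (x := (n : ℝ) + 1) (by positivity) σ
        simpa using h
      rw [this]
      have h2 : ((n : ℝ) + 1) ^ (2 : ℕ) ≤ ((n : ℝ) + 1) ^ σ := by
        rw [← Real.rpow_natCast]
        exact Real.rpow_le_rpow_of_exponent_le (by linarith [n.cast_nonneg (α := ℝ)])
          (by exact_mod_cast hσ)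
      gcongr
    have hG : ‖Gammaℝ σ‖ ≤ Real.exp (2 * (σ + 2) ^ (3 / 2 : ℝ)) := by
      rw [Gammaℝ_def, norm_mul, norm_cpow_eq_rpow_re_of_pos Real.pi_pos]
      have h2 : Complex.Gamma ((σ : ℂ) / 2) = (Real.Gamma (σ / 2) : ℂ) := by
        rw [← Complex.Gamma_ofReal]; push_cast; rfl
      rw [h2, norm_real, Real.norm_of_nonneg (Real.Gamma_pos_of_pos (by linarith)).le]
      have h3 : Real.pi ^ ((-(σ : ℂ) / 2).re) ≤ 1 := by
        refine Real.rpow_le_one_of_one_le_of_nonpos (by linarith [Real.pi_gt_three]) ?_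
        simp; linarith
      have h4 := Gamma_le_exp_rpow (x := σ / 2) (by linarith)
      have h5 : Real.exp (2 * (σ / 2 + 2) ^ (3 / 2 : ℝ)) ≤ Real.exp (2 * (σ + 2) ^ (3 / 2 : ℝ)) := by
        gcongr; linarith
      calc _ ≤ 1 * Real.Gamma (σ / 2) := by
            gcongr
        _ ≤ _ := by linarith
    have h6 : ‖(1 : ℂ) / σ‖ ≤ 1 := by
      rw [norm_div, norm_real, Real.norm_of_nonneg (by linarith), norm_one,
        div_le_one (by linarith)]; linarith
    have h7 : ‖(1 : ℂ) / (1 - σ)‖ ≤ 1 := by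
      have : (1 : ℂ) - σ = ((1 - σ : ℝ) : ℂ) := by push_cast; rfl
      rw [this, norm_div, norm_real, Real.norm_of_nonpos (by linarith), norm_one,
        div_le_one (by linarith)]; linarith
    rw [h1]
    calc _ ≤ ‖Gammaℝ σ‖ * ‖riemannZeta σ‖ + ‖(1 : ℂ) / σ‖ + ‖(1 : ℂ) / (1 - σ)‖ := by
          refine (norm_add₃_le).trans ?_
          rw [norm_mul]
      _ ≤ Real.exp (2 * (σ + 2) ^ (3 / 2 : ℝ)) * (∑' n : ℕ, 1 / ((n : ℝ) + 1) ^ 2) +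
          Real.exp (2 * (σ + 2) ^ (3 / 2 : ℝ)) + Real.exp (2 * (σ + 2) ^ (3 / 2 : ℝ)) := by
          gcongr <;> linarith
      _ = _ := by ring
  obtain ⟨C, hC⟩ := hbig
  obtain ⟨D, hD⟩ : ∃ D : ℝ, ∀ σ ∈ Set.Icc (-1 : ℝ) 2, ‖completedRiemannZeta₀ σ‖ ≤ D :=
    isCompact_Icc.exists_bound_of_continuousOn
      (differentiable_completedZeta₀.continuous.comp continuous_ofReal).continuousOn
  refine ⟨max (max C D) 0, le_max_right _ _, fun s => (norm_completedRiemannZeta₀_le s).trans ?_⟩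
  have hs1 := abs_re_le_norm s
  have hs2 := le_abs_self s.re
  have hs3 := neg_abs_le s.re
  have hfin : ∀ K y : ℝ, K ≤ max (max C D) 0 → 0 ≤ y → y ≤ ‖s‖ + 3 →
      K * Real.exp (2 * y ^ (3 / 2 : ℝ)) ≤
        max (max C D) 0 * Real.exp (2 * (‖s‖ + 3) ^ (3 / 2 : ℝ)) := by
    intro K y hK hy0 hy
    have : Real.exp (2 * y ^ (3 / 2 : ℝ)) ≤ Real.exp (2 * (‖s‖ + 3) ^ (3 / 2 : ℝ)) := by gcongr
    exact mul_le_mul hK this (Real.exp_pos _).le (le_max_right _ _)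
  have hCm : C ≤ max (max C D) 0 := (le_max_left _ _).trans (le_max_left _ _)
  have hDm : D ≤ max (max C D) 0 := (le_max_right _ _).trans (le_max_left _ _)
  rcases le_total 2 s.re with h | h
  · exact (hC _ h).trans (hfin C _ hCm (by linarith) (by linarith))
  rcases le_total (-1) s.re with h' | h'
  · refine (hD _ ⟨h', h⟩).trans ?_
    simpa using hfin D 0 hDm le_rfl (by positivity)
  · rw [← completedRiemannZeta₀_one_sub, show (1 : ℂ) - s.re = ((1 - s.re : ℝ) : ℂ) by push_cast; rfl]
    exact (hC _ (by linarith)).trans (hfin C _ hCm (by linarith) (by linarith))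

lemma exists_norm_riemannXi_le :
    ∃ C : ℝ, ∀ s : ℂ, 1 ≤ ‖s‖ → ‖riemannXi s‖ ≤ Real.exp (C * ‖s‖ ^ (3 / 2 : ℝ)) := by
  obtain ⟨C, hC0, hC⟩ := exists_norm_completedRiemannZeta₀_le
  refine ⟨1 + 2 * C + 2 + 2 * 4 ^ (3 / 2 : ℝ), fun s hs => ?_⟩
  set r := ‖s‖
  have hr0 : 0 < r := by linarith
  have h1 : r ≤ r ^ (3 / 2 : ℝ) := by
    conv_lhs => rw [← Real.rpow_one r]
    exact Real.rpow_le_rpow_of_exponent_le hs (by norm_num)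
  have h2 : (r + 3) ^ (3 / 2 : ℝ) ≤ 4 ^ (3 / 2 : ℝ) * r ^ (3 / 2 : ℝ) := by
    rw [← Real.mul_rpow (by norm_num) hr0.le]
    gcongr; linarith
  have h3 : ‖riemannXi s‖ ≤ 1 + r * (r + 1) * (C * Real.exp (2 * (r + 3) ^ (3 / 2 : ℝ))) := by
    rw [riemannXi]
    refine (norm_add_le _ _).trans ?_
    rw [norm_one, norm_mul, norm_mul]
    gcongr
    · have := norm_sub_le s 1; rwa [norm_one] at this
    · exact hC s
  set E := Real.exp (2 * (r + 3) ^ (3 / 2 : ℝ)) with hE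
  have hE1 : 1 ≤ E := Real.one_le_exp (by positivity)
  have h4 : r + 1 ≤ Real.exp r := Real.add_one_le_exp r
  have h5 : 1 + 2 * C ≤ Real.exp (2 * C) := by linarith [Real.add_one_le_exp (2 * C)]
  calc ‖riemannXi s‖ ≤ 1 + r * (r + 1) * (C * E) := h3
    _ ≤ Real.exp r * Real.exp r * (1 + 2 * C) * E := by
        have h6 : r * (r + 1) ≤ Real.exp r * Real.exp r := by
          apply mul_le_mul (by linarith) h4 (by linarith) (Real.exp_pos _).le
        have h7 : 1 ≤ Real.exp r * Real.exp r := by nlinarith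
        have h8 : r * (r + 1) * (C * E) ≤ Real.exp r * Real.exp r * (C * E) := by gcongr
        have h9 : 1 ≤ Real.exp r * Real.exp r * E := by nlinarith
        have h10 : 0 ≤ Real.exp r * Real.exp r * (C * E) := by positivity
        nlinarith
    _ ≤ Real.exp r * Real.exp r * Real.exp (2 * C) * E := by gcongr
    _ = Real.exp (r + r + 2 * C + 2 * (r + 3) ^ (3 / 2 : ℝ)) := by
        rw [hE, ← Real.exp_add, ← Real.exp_add, ← Real.exp_add]
    _ ≤ _ := by
        apply Real.exp_le_exp.2
        have h11 : 2 * C ≤ 2 * C * r ^ (3 / 2 : ℝ) := by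
          refine le_mul_of_one_le_right (by positivity) (hs.trans h1)
        have h12 : 0 ≤ r ^ (3 / 2 : ℝ) := by positivity
        nlinarith

end RiemannXi

section XiPartialFractions

open Complex Topology

lemma mem_zerosIn_riemannXi {R : ℝ} {z : ℂ} :
    z ∈ zerosIn riemannXi R ↔ ‖z‖ ≤ R ∧ riemannXi z = 0 :=
  mem_zerosIn differentiable_riemannXi (by simp [riemannXi_zero])

/-- The multiplicity of `ρ` as a zero of `riemannXi`. -/
noncomputable def xiMult (ρ : ℂ) : ℝ := (analyticOrderNatAt riemannXi ρ : ℝ)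

lemma xiMult_nonneg (ρ : ℂ) : 0 ≤ xiMult ρ := Nat.cast_nonneg _

lemma analyticOrderNatAt_riemannXi_ne_zero_iff {ρ : ℂ} :
    analyticOrderNatAt riemannXi ρ ≠ 0 ↔ riemannXi ρ = 0 := by
  have h1 := analyticOrderAt_ne_top_of_entire differentiable_riemannXi
    (by simp [riemannXi_zero]) ρ
  have h2 : ((analyticOrderNatAt riemannXi ρ : ℕ) : ℕ∞) = analyticOrderAt riemannXi ρ :=
    Nat.cast_analyticOrderNatAt h1
  have h3 : analyticOrderAt riemannXi ρ ≠ 0 ↔ riemannXi ρ = 0 := by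
    rw [analyticOrderAt_ne_zero]
    exact and_iff_right (differentiable_riemannXi.analyticAt ρ)
  rw [← h3, ← h2]
  norm_cast

lemma xiMult_ne_zero_iff {ρ : ℂ} : xiMult ρ ≠ 0 ↔ riemannXi ρ = 0 := by
  rw [← analyticOrderNatAt_riemannXi_ne_zero_iff, xiMult]
  norm_cast

lemma xiMult_eq_zero {ρ : ℂ} (h : riemannXi ρ ≠ 0) : xiMult ρ = 0 := by
  by_contra h'
  exact h (xiMult_ne_zero_iff.1 h')

lemma one_le_xiMult {ρ : ℂ} (h : riemannXi ρ = 0) : 1 ≤ xiMult ρ := by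
  have := analyticOrderNatAt_riemannXi_ne_zero_iff.2 h
  rw [xiMult]
  exact_mod_cast Nat.one_le_iff_ne_zero.2 this

lemma tendsto_zerosIn_subtype :
    Tendsto (fun R : ℝ => open scoped Classical in
      (zerosIn riemannXi R).subtype (fun z => riemannXi z = 0)) atTop atTop := by
  classical
  refine Filter.tendsto_atTop_finset_of_monotone ?_ ?_
  · intro R R' h z hz
    rw [Finset.mem_subtype, mem_zerosIn_riemannXi] at hz ⊢
    exact ⟨hz.1.trans h, hz.2⟩
  · intro z
    exact ⟨‖(z : ℂ)‖, by rw [Finset.mem_subtype, mem_zerosIn_riemannXi]; exact ⟨le_rfl, z.2⟩⟩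

lemma tendsto_sum_zerosIn {g : ℂ → ℂ} (hg : Summable g) (h0 : ∀ ρ, riemannXi ρ ≠ 0 → g ρ = 0) :
    Tendsto (fun R : ℝ => ∑ ρ ∈ zerosIn riemannXi R, g ρ) atTop (𝓝 (∑' ρ, g ρ)) := by
  classical
  have h1 : HasSum (g ∘ ((↑) : {z : ℂ // riemannXi z = 0} → ℂ)) (∑' ρ, g ρ) := by
    refine (hasSum_subtype_iff_of_support_subset (s := {z : ℂ | riemannXi z = 0}) ?_).2 hg.hasSum
    intro ρ hρ
    by_contra h
    exact hρ (h0 ρ h)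
  have h2 := Tendsto.comp h1 tendsto_zerosIn_subtype
  refine h2.congr fun R => ?_
  simp only [Function.comp_apply]
  convert Finset.sum_subtype_of_mem g (s := zerosIn riemannXi R) (p := fun z => riemannXi z = 0)
    (fun x hx => (mem_zerosIn_riemannXi.1 hx).2)

lemma tendsto_sum_zerosIn_xi {s : ℂ} (hs : riemannXi s ≠ 0) :
    Tendsto (fun R : ℝ => ∑ ρ ∈ zerosIn riemannXi R,
      (xiMult ρ : ℂ) * (1 / (s - ρ) + 1 / (s - 1 + ρ))) atTop (𝓝 (2 * logDeriv riemannXi s)) := by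
  obtain ⟨C, hC⟩ := exists_norm_riemannXi_le
  exact_mod_cast tendsto_sum_zerosIn_symm differentiable_riemannXi riemannXi_zero
    riemannXi_one_sub hC hs

lemma re_one_div (z : ℂ) : (1 / z).re = z.re / (z.re ^ 2 + z.im ^ 2) := by
  rw [one_div, Complex.inv_re, normSq_apply, sq, sq]

lemma summable_xiMult_div : Summable fun ρ : ℂ => xiMult ρ / (1 + ‖ρ‖ ^ 2) := by
  have h2 : riemannXi 2 ≠ 0 := riemannXi_ne_zero_of_one_le_re (by simp)
  have hlim := (Complex.continuous_re.tendsto _).comp (tendsto_sum_zerosIn_xi h2)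
  set L := (2 * logDeriv riemannXi 2).re
  have hterm : ∀ ρ : ℂ, riemannXi ρ = 0 → xiMult ρ / (1 + ‖ρ‖ ^ 2) ≤
      5 * ((xiMult ρ : ℂ) * (1 / (2 - ρ) + 1 / (2 - 1 + ρ))).re := by
    intro ρ hρ
    have hre := re_mem_Ioo_of_riemannXi_eq_zero hρ
    rw [re_ofReal_mul, add_re, re_one_div, re_one_div]
    have hn : ‖ρ‖ ^ 2 = ρ.re ^ 2 + ρ.im ^ 2 := by rw [Complex.sq_norm, normSq_apply]; ring
    simp only [sub_re, sub_im, add_re, add_im, re_ofNat, im_ofNat, one_re, one_im]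
    rw [hn, div_eq_mul_inv]
    have hm := xiMult_nonneg ρ
    have h1 : (1 + (ρ.re ^ 2 + ρ.im ^ 2))⁻¹ ≤
        5 * ((2 - ρ.re) / ((2 - ρ.re) ^ 2 + (0 - ρ.im) ^ 2)) := by
      rw [← one_div, mul_div_assoc', div_le_div_iff₀ (by positivity)
        (by have := hre.2; have : 0 < 2 - ρ.re := by linarith
            positivity)]
      nlinarith [hre.1, hre.2, sq_nonneg ρ.im]
    have h3 : 0 ≤ (2 - 1 + ρ.re) / ((2 - 1 + ρ.re) ^ 2 + (0 - 0 + ρ.im) ^ 2) := by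
      have := hre.1
      have : 0 < 2 - 1 + ρ.re := by linarith
      positivity
    nlinarith [mul_le_mul_of_nonneg_left h1 hm]
  have hnn : ∀ ρ : ℂ, 0 ≤ xiMult ρ / (1 + ‖ρ‖ ^ 2) := fun ρ =>
    div_nonneg (xiMult_nonneg ρ) (by positivity)
  have hball : ∀ R : ℝ, ∑ ρ ∈ zerosIn riemannXi R, xiMult ρ / (1 + ‖ρ‖ ^ 2) ≤ 5 * L := by
    intro R
    have hl2 := hlim.const_mul 5
    refine ge_of_tendsto hl2 ?_
    filter_upwards [eventually_ge_atTop R] with R' hR'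
    simp only [Function.comp_apply, re_sum]
    rw [Finset.mul_sum]
    refine (Finset.sum_le_sum_of_subset_of_nonneg ?_ (fun ρ _ _ => hnn ρ)).trans
      (Finset.sum_le_sum fun ρ hρ => hterm ρ (mem_zerosIn_riemannXi.1 hρ).2)
    intro z hz
    rw [mem_zerosIn_riemannXi] at hz ⊢
    exact ⟨hz.1.trans hR', hz.2⟩
  refine summable_of_sum_le hnn (c := 5 * L) fun u => ?_
  classical
  obtain ⟨R, hR⟩ : ∃ R : ℝ, ∀ ρ ∈ u, ‖ρ‖ ≤ R := by
    refine ⟨∑ ρ ∈ u, ‖ρ‖, fun ρ hρ => Finset.single_le_sum (f := fun ρ : ℂ => ‖ρ‖)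
      (fun _ _ => norm_nonneg _) hρ⟩
  refine le_trans ?_ (hball R)
  rw [← Finset.sum_filter_add_sum_filter_not u (fun ρ => riemannXi ρ = 0)]
  have h3 : ∑ x ∈ u with ¬riemannXi x = 0, xiMult x / (1 + ‖x‖ ^ 2) = 0 := by
    refine Finset.sum_eq_zero fun x hx => ?_
    rw [xiMult_eq_zero (Finset.mem_filter.1 hx).2, zero_div]
  rw [h3, add_zero]
  refine Finset.sum_le_sum_of_subset_of_nonneg ?_ (fun ρ _ _ => hnn ρ)
  intro ρ hρ
  rw [Finset.mem_filter] at hρ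
  exact mem_zerosIn_riemannXi.2 ⟨hR ρ hρ.1, hρ.2⟩

lemma finite_xiMult_ne_zero (R : ℝ) : {ρ : ℂ | ‖ρ‖ ≤ R ∧ xiMult ρ ≠ 0}.Finite := by
  simp only [xiMult_ne_zero_iff]
  exact finite_setOf_norm_le_eq_zero differentiable_riemannXi (by simp [riemannXi_zero]) R

lemma summable_xiMult_mul {F : ℂ → ℂ} {C R : ℝ}
    (hF : ∀ ρ, riemannXi ρ = 0 → R < ‖ρ‖ → ‖F ρ‖ ≤ C / (1 + ‖ρ‖ ^ 2)) :
    Summable fun ρ : ℂ => (xiMult ρ : ℂ) * F ρ := by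
  refine Summable.of_norm_bounded_eventually (summable_xiMult_div.mul_left C) ?_
  have := (finite_xiMult_ne_zero R).compl_mem_cofinite
  filter_upwards [this] with ρ hρ
  by_cases h : riemannXi ρ = 0
  · have hR : R < ‖ρ‖ := by
      by_contra! h'
      exact hρ ⟨h', xiMult_ne_zero_iff.2 h⟩
    rw [norm_mul, norm_real, Real.norm_of_nonneg (xiMult_nonneg ρ)]
    calc xiMult ρ * ‖F ρ‖ ≤ xiMult ρ * (C / (1 + ‖ρ‖ ^ 2)) :=
          mul_le_mul_of_nonneg_left (hF ρ h hR) (xiMult_nonneg ρ)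
      _ = _ := by ring
  · simp [xiMult_eq_zero h]

lemma norm_add_one_div_le {s ρ : ℂ} (hR : 2 * ‖s‖ + 3 < ‖ρ‖) :
    ‖1 / (s - ρ) + 1 / (s - 1 + ρ)‖ ≤ (8 * (2 * ‖s‖ + 1)) / (1 + ‖ρ‖ ^ 2) := by
  have hs := norm_nonneg s
  have h1 : ‖ρ‖ / 2 ≤ ‖s - ρ‖ := by
    have := norm_sub_norm_le ρ s
    rw [norm_sub_rev] at this; linarith
  have h2 : ‖ρ‖ / 2 ≤ ‖s - 1 + ρ‖ := by
    have h3 := norm_sub_norm_le ρ (1 - s)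
    have h4 := norm_sub_le 1 s
    rw [norm_one] at h4
    rw [show ρ - (1 - s) = s - 1 + ρ by ring] at h3
    linarith
  have h5 : s - ρ ≠ 0 := fun h => by rw [h, norm_zero] at h1; linarith
  have h6 : s - 1 + ρ ≠ 0 := fun h => by rw [h, norm_zero] at h2; linarith
  have h7 : 1 / (s - ρ) + 1 / (s - 1 + ρ) = (2 * s - 1) / ((s - ρ) * (s - 1 + ρ)) := by
    field_simp; ring
  rw [h7, norm_div, norm_mul]
  have h8 : ‖2 * s - 1‖ ≤ 2 * ‖s‖ + 1 := by
    refine (norm_sub_le _ _).trans ?_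
    simp
  have h9 : (1 + ‖ρ‖ ^ 2) / 8 ≤ ‖s - ρ‖ * ‖s - 1 + ρ‖ := by
    calc (1 + ‖ρ‖ ^ 2) / 8 ≤ (‖ρ‖ / 2) * (‖ρ‖ / 2) := by nlinarith
      _ ≤ _ := by gcongr
  calc _ ≤ (2 * ‖s‖ + 1) / ((1 + ‖ρ‖ ^ 2) / 8) := by gcongr
    _ = _ := by field_simp

/-- The partial fraction expansion of the logarithmic derivative of `riemannXi`. -/
theorem hasSum_logDeriv_riemannXi {s : ℂ} (hs : riemannXi s ≠ 0) :
    HasSum (fun ρ : ℂ => (xiMult ρ : ℂ) * (1 / (s - ρ) + 1 / (s - 1 + ρ)))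
      (2 * logDeriv riemannXi s) := by
  have hsum : Summable fun ρ : ℂ => (xiMult ρ : ℂ) * (1 / (s - ρ) + 1 / (s - 1 + ρ)) :=
    summable_xiMult_mul (fun ρ _ h => norm_add_one_div_le h)
  have h1 := tendsto_sum_zerosIn hsum (fun ρ hρ => by simp [xiMult_eq_zero hρ])
  rw [← tendsto_nhds_unique h1 (tendsto_sum_zerosIn_xi hs)]
  exact hsum.hasSum

lemma riemannXi_conj_eq_zero {ρ : ℂ} (h : riemannXi ρ = 0) :
    riemannXi ((starRingEnd ℂ) ρ) = 0 := by
  have hre := re_mem_Ioo_of_riemannXi_eq_zero h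
  have h1 : ρ ≠ 1 := fun h1 => by simp [h1] at hre
  have h0 : ρ ≠ 0 := fun h0 => by simp [h0] at hre
  rw [riemannXi_eq hre.1 h1] at h
  have h2 : riemannZeta ρ = 0 := by
    have := Gammaℝ_ne_zero_of_re_pos hre.1
    have := sub_ne_zero.2 h1
    simp_all
  rw [riemannXi_eq (by simpa using hre.1)
    (fun h' => h1 (by simpa using congrArg (starRingEnd ℂ) h')), riemannZeta_conj, h2]
  simp

/-- The value of `∑ 1 / (ρ (1 - ρ))` over the nontrivial zeros. -/
noncomputable def xiSum : ℝ := Real.eulerMascheroniConstant - Real.log (4 * Real.pi) + 2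

lemma logDeriv_riemannXi_one : 2 * logDeriv riemannXi 1 = xiSum := by
  have h1 : HasDerivAt riemannXi (completedRiemannZeta₀ 1) 1 := by
    have h2 := (differentiable_completedZeta₀ 1).hasDerivAt
    have h3 : HasDerivAt (fun s : ℂ => s * (s - 1)) 1 1 := by
      have := (hasDerivAt_id (1 : ℂ)).mul ((hasDerivAt_id (1 : ℂ)).sub_const 1)
      refine this.congr_deriv ?_
      simp
    have := (h3.mul h2).const_add 1
    refine this.congr_deriv ?_
    simp
  rw [logDeriv_apply, h1.deriv, riemannXi_one, completedRiemannZeta₀_one, xiSum]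
  have h4 : Complex.log (4 * Real.pi) = (Real.log (4 * Real.pi) : ℝ) := by
    rw [ofReal_log (by positivity)]; push_cast; rfl
  rw [h4]
  push_cast
  ring

lemma hasSum_xiSum : HasSum (fun ρ : ℂ => xiMult ρ * (ρ.re / (ρ.re ^ 2 + ρ.im ^ 2) +
    (1 - ρ.re) / ((1 - ρ.re) ^ 2 + ρ.im ^ 2))) xiSum := by
  have h := hasSum_logDeriv_riemannXi (s := 1) (by simp [riemannXi_one])
  rw [logDeriv_riemannXi_one] at h
  have h2 := hasSum_re h
  rw [ofReal_re] at h2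
  convert h2 using 2 with ρ
  rw [re_ofReal_mul, add_re, re_one_div, re_one_div]
  congr 1
  simp only [sub_re, sub_im, add_re, add_im, one_re, one_im]
  ring

/-- For a zero, the summand of `hasSum_xiSum` lies between `1 / (1 + γ²)` and `1 / γ²`. -/
lemma one_div_le_re_div_add {β γ : ℝ} (h0 : 0 < β) (h1 : β < 1) :
    1 / (1 + γ ^ 2) ≤ β / (β ^ 2 + γ ^ 2) + (1 - β) / ((1 - β) ^ 2 + γ ^ 2) := by
  have h2 : β / (1 + γ ^ 2) ≤ β / (β ^ 2 + γ ^ 2) := by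
    apply div_le_div_of_nonneg_left h0.le (by positivity); nlinarith
  have h3 : (1 - β) / (1 + γ ^ 2) ≤ (1 - β) / ((1 - β) ^ 2 + γ ^ 2) := by
    have : 0 < 1 - β := by linarith
    apply div_le_div_of_nonneg_left this.le (by positivity); nlinarith
  calc 1 / (1 + γ ^ 2) = β / (1 + γ ^ 2) + (1 - β) / (1 + γ ^ 2) := by ring
    _ ≤ _ := add_le_add h2 h3

lemma re_div_add_le_one_div {β γ : ℝ} (h0 : 0 < β) (h1 : β < 1) (hγ : γ ≠ 0) :
    β / (β ^ 2 + γ ^ 2) + (1 - β) / ((1 - β) ^ 2 + γ ^ 2) ≤ 1 / γ ^ 2 := by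
  have hγ2 : 0 < γ ^ 2 := by positivity
  have h2 : β / (β ^ 2 + γ ^ 2) ≤ β / γ ^ 2 := by
    apply div_le_div_of_nonneg_left h0.le hγ2; nlinarith
  have h3 : (1 - β) / ((1 - β) ^ 2 + γ ^ 2) ≤ (1 - β) / γ ^ 2 := by
    apply div_le_div_of_nonneg_left (by linarith) hγ2; nlinarith
  calc _ ≤ β / γ ^ 2 + (1 - β) / γ ^ 2 := add_le_add h2 h3
    _ = _ := by ring

lemma tendsto_harmonic_sub_log_add_half :
    Tendsto (fun n : ℕ => (harmonic n : ℝ) - Real.log (n + 1 / 2)) atTop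
      (𝓝 Real.eulerMascheroniConstant) := by
  have h1 := Real.tendsto_eulerMascheroniSeq'
  have h2 : Tendsto (fun n : ℕ => Real.log (1 + 1 / (2 * n))) atTop (𝓝 0) := by
    have h3 : Tendsto (fun n : ℕ => 1 + (1 / 2) * (1 / (n : ℝ))) atTop (𝓝 (1 + 1 / 2 * 0)) :=
      (tendsto_one_div_atTop_nhds_zero_nat.const_mul (1 / 2)).const_add 1
    have h4 := (Real.continuousAt_log (x := 1 + 1 / 2 * 0) (by norm_num)).tendsto.comp h3
    simp only [mul_zero, add_zero, Real.log_one] at h4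
    refine h4.congr fun n => ?_
    simp only [Function.comp_apply]
    congr 2
    rw [one_div_mul_one_div]
  have h5 := h1.sub h2
  rw [sub_zero] at h5
  refine h5.congr' ?_
  filter_upwards [eventually_ge_atTop 1] with n hn
  have hn0 : (0 : ℝ) < n := by exact_mod_cast hn
  rw [Real.eulerMascheroniSeq', if_neg (by omega), sub_sub, ← Real.log_mul (by positivity)
    (by positivity)]
  congr 2
  field_simp

lemma eulerMascheroniConstant_le (n : ℕ) :
    Real.eulerMascheroniConstant ≤ harmonic n - Real.log (n + 1 / 2) := by
  refine Antitone.le_of_tendsto (antitone_nat_of_succ_le fun k => ?_)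
    tendsto_harmonic_sub_log_add_half n
  have hk : (0 : ℝ) ≤ k := k.cast_nonneg
  have h1 := Real.le_log_one_add_of_nonneg (x := 1 / ((k : ℝ) + 1 / 2)) (by positivity)
  have h2 : Real.log (1 + 1 / ((k : ℝ) + 1 / 2)) = Real.log (k + 1 + 1 / 2) -
      Real.log (k + 1 / 2) := by
    rw [← Real.log_div (by positivity) (by positivity)]
    congr 1; field_simp; ring
  have h3 : 2 * (1 / ((k : ℝ) + 1 / 2)) / (1 / ((k : ℝ) + 1 / 2) + 2) = 1 / (k + 1) := by
    field_simp; ring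
  rw [h2, h3] at h1
  rw [harmonic_succ]
  push_cast
  rw [← one_div]
  linarith

lemma log_le_half_sub_inv {y : ℝ} (hy : 1 ≤ y) : Real.log y ≤ (y - 1 / y) / 2 := by
  have h1 := Real.self_le_sinh_iff.2 (Real.log_nonneg hy)
  rw [Real.sinh_eq, Real.exp_log (by linarith), Real.exp_neg, Real.exp_log (by linarith)] at h1
  rwa [one_div]

lemma le_eulerMascheroniConstant {n : ℕ} (hn : 1 ≤ n) :
    harmonic n - Real.log n - 1 / (2 * n) ≤ Real.eulerMascheroniConstant := by
  have hmono : Monotone fun k : ℕ => (harmonic (k + 1) : ℝ) - Real.log (k + 1) -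
      1 / (2 * (k + 1)) := by
    refine monotone_nat_of_le_succ fun k => ?_
    have hk : (0 : ℝ) ≤ k := k.cast_nonneg
    have h1 := log_le_half_sub_inv (y := ((k : ℝ) + 1 + 1) / (k + 1))
      (by rw [le_div_iff₀ (by positivity)]; linarith)
    rw [Real.log_div (by positivity) (by positivity)] at h1
    rw [harmonic_succ (k + 1)]
    push_cast
    have h2 : (((k : ℝ) + 1 + 1) / (k + 1) - 1 / (((k : ℝ) + 1 + 1) / (k + 1))) / 2 =
      ((k : ℝ) + 1 + 1)⁻¹ + 1 / (2 * (k + 1)) - 1 / (2 * (k + 1 + 1)) := by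
      field_simp; ring
    linarith
  have hlim : Tendsto (fun k : ℕ => (harmonic (k + 1) : ℝ) - Real.log (k + 1) -
      1 / (2 * (k + 1))) atTop (𝓝 Real.eulerMascheroniConstant) := by
    have h1 := Real.tendsto_eulerMascheroniSeq'.comp (tendsto_add_atTop_nat 1)
    have h2 := (tendsto_one_div_add_atTop_nhds_zero_nat (𝕜 := ℝ)).const_mul (1 / 2)
    have h3 := h1.sub h2
    rw [mul_zero, sub_zero] at h3
    refine h3.congr fun k => ?_
    simp only [Function.comp_apply, Real.eulerMascheroniSeq', if_neg (Nat.succ_ne_zero k)]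
    push_cast
    rw [one_div_mul_one_div]
  obtain ⟨k, rfl⟩ : ∃ k, n = k + 1 := ⟨n - 1, by omega⟩
  have := hmono.ge_of_tendsto hlim k
  push_cast
  exact this

lemma xiSum_le : xiSum ≤ 0.0464 := by
  have h1 := eulerMascheroniConstant_le 20
  have hpi := Real.pi_gt_d6
  have h2 : Real.log (256 * (1 + 0.00628)) ≤
      Real.log (4 * Real.pi) + Real.log ((20 : ℕ) + 1 / 2) := by
    rw [← Real.log_mul (by positivity) (by positivity)]
    apply Real.log_le_log (by norm_num)
    push_cast
    linarith
  have h3 := Real.le_log_one_add_of_nonneg (x := 0.00628) (by norm_num)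
  have h4 : Real.log 256 = 8 * Real.log 2 := by
    rw [show (256 : ℝ) = 2 ^ 8 by norm_num, Real.log_pow]; norm_num
  rw [Real.log_mul (by norm_num) (by norm_num), h4] at h2
  have h5 : (harmonic 20 : ℝ) = 55835135 / 15519504 := by
    have : harmonic 20 = 55835135 / 15519504 := by
      simp only [harmonic, Finset.sum_range_succ, Finset.sum_range_zero]; norm_num
    rw [this]; norm_num
  rw [h5] at h1
  have := Real.log_two_gt_d9
  rw [xiSum]
  norm_num at h1 h2 h3 ⊢
  linarith

lemma le_xiSum : 0.0458 ≤ xiSum := by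
  have h1 := le_eulerMascheroniConstant (n := 20) (by norm_num)
  have hpi := Real.pi_lt_d6
  have h2 : Real.log (4 * Real.pi) + Real.log ((20 : ℕ)) ≤ Real.log (256 * 0.98176) := by
    rw [← Real.log_mul (by positivity) (by positivity)]
    apply Real.log_le_log (by positivity)
    push_cast
    linarith
  have h3 := Real.log_le_sub_one_of_pos (x := 0.98176) (by norm_num)
  have h4 : Real.log 256 = 8 * Real.log 2 := by
    rw [show (256 : ℝ) = 2 ^ 8 by norm_num, Real.log_pow]; norm_num
  rw [Real.log_mul (x := 256) (by norm_num) (by norm_num), h4] at h2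
  have h5 : (harmonic 20 : ℝ) = 55835135 / 15519504 := by
    have : harmonic 20 = 55835135 / 15519504 := by
      simp only [harmonic, Finset.sum_range_succ, Finset.sum_range_zero]; norm_num
    rw [this]; norm_num
  rw [h5] at h1
  have := Real.log_two_lt_d9
  rw [xiSum]
  norm_num at h1 h2 h3 ⊢
  linarith

lemma le_im_sq_of_riemannXi_eq_zero {ρ : ℂ} (h : riemannXi ρ = 0) : 42 ≤ ρ.im ^ 2 := by
  have hre := re_mem_Ioo_of_riemannXi_eq_zero h
  have hlow := one_div_le_re_div_add (γ := ρ.im) hre.1 hre.2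
  set F : ℂ → ℝ := fun ρ => xiMult ρ * (ρ.re / (ρ.re ^ 2 + ρ.im ^ 2) +
    (1 - ρ.re) / ((1 - ρ.re) ^ 2 + ρ.im ^ 2)) with hF
  have hFnn : ∀ z, 0 ≤ F z := by
    intro z
    by_cases hz : riemannXi z = 0
    · have hz' := re_mem_Ioo_of_riemannXi_eq_zero hz
      have := one_div_le_re_div_add (γ := z.im) hz'.1 hz'.2
      have h2 : 0 ≤ 1 / (1 + z.im ^ 2) := by positivity
      exact mul_nonneg (xiMult_nonneg z) (h2.trans this)
    · simp [hF, xiMult_eq_zero hz]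
  have hFρ : ∀ z : ℂ, riemannXi z = 0 → 1 / (1 + z.im ^ 2) ≤ F z := by
    intro z hz
    have hz' := re_mem_Ioo_of_riemannXi_eq_zero hz
    have h1 := one_div_le_re_div_add (γ := z.im) hz'.1 hz'.2
    have h2 : 0 ≤ 1 / (1 + z.im ^ 2) := by positivity
    have h3 := one_le_xiMult hz
    exact h1.trans (le_mul_of_one_le_left (h2.trans h1) h3)
  have hconj := riemannXi_conj_eq_zero h
  have hS := xiSum_le
  by_cases hne : ρ = (starRingEnd ℂ) ρ
  · have him : ρ.im = 0 := by
      have := congrArg Complex.im hne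
      simp at this; linarith
    have h1 := hFρ ρ h
    have h2 := le_hasSum hasSum_xiSum ρ (fun z _ => hFnn z)
    rw [him] at h1
    norm_num at h1
    exfalso
    have h3 : F ρ ≤ xiSum := h2
    norm_num at hS
    linarith
  · have h1 := sum_le_hasSum {ρ, (starRingEnd ℂ) ρ} (fun z _ => hFnn z) hasSum_xiSum
    rw [Finset.sum_pair hne] at h1
    have h2 := hFρ ρ h
    have h3 := hFρ _ hconj
    rw [conj_im, neg_sq] at h3
    have h4 : 2 * (1 / (1 + ρ.im ^ 2)) ≤ 0.0464 := by
      calc _ ≤ F ρ + F ((starRingEnd ℂ) ρ) := by linarith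
        _ ≤ _ := h1.trans hS
    rw [mul_one_div, div_le_iff₀ (by positivity)] at h4
    norm_num at h4
    linarith

lemma im_ne_zero_of_riemannXi_eq_zero {ρ : ℂ} (h : riemannXi ρ = 0) : ρ.im ≠ 0 := by
  intro h'
  have := le_im_sq_of_riemannXi_eq_zero h
  rw [h'] at this
  norm_num at this

lemma one_div_im_sq_le {ρ : ℂ} (h : riemannXi ρ = 0) :
    1 / ρ.im ^ 2 ≤ 43 / 42 * (ρ.re / (ρ.re ^ 2 + ρ.im ^ 2) +
    (1 - ρ.re) / ((1 - ρ.re) ^ 2 + ρ.im ^ 2)) := by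
  have hre := re_mem_Ioo_of_riemannXi_eq_zero h
  have h1 := one_div_le_re_div_add (γ := ρ.im) hre.1 hre.2
  have h2 := le_im_sq_of_riemannXi_eq_zero h
  have h3 : 1 / ρ.im ^ 2 ≤ 43 / 42 * (1 / (1 + ρ.im ^ 2)) := by
    rw [mul_one_div, div_le_div_iff₀ (by linarith) (by linarith)]
    linarith
  linarith

lemma summable_xiMult_div_im_sq : Summable fun ρ : ℂ => xiMult ρ / ρ.im ^ 2 := by
  refine Summable.of_nonneg_of_le (fun ρ => div_nonneg (xiMult_nonneg ρ) (sq_nonneg _)) ?_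
    (hasSum_xiSum.summable.mul_left (43 / 42))
  intro ρ
  by_cases h : riemannXi ρ = 0
  · have := mul_le_mul_of_nonneg_left (one_div_im_sq_le h) (xiMult_nonneg ρ)
    calc _ = xiMult ρ * (1 / ρ.im ^ 2) := by ring
      _ ≤ _ := this
      _ = _ := by ring
  · simp [xiMult_eq_zero h]

lemma tsum_xiMult_div_im_sq_le : ∑' ρ : ℂ, xiMult ρ / ρ.im ^ 2 ≤ 0.0476 := by
  have h1 : ∑' ρ : ℂ, xiMult ρ / ρ.im ^ 2 ≤ 43 / 42 * xiSum := by
    refine hasSum_le ?_ summable_xiMult_div_im_sq.hasSum (hasSum_xiSum.mul_left (43 / 42))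
    intro ρ
    by_cases h : riemannXi ρ = 0
    · have := mul_le_mul_of_nonneg_left (one_div_im_sq_le h) (xiMult_nonneg ρ)
      calc _ = xiMult ρ * (1 / ρ.im ^ 2) := by ring
        _ ≤ _ := this
        _ = _ := by ring
    · simp [xiMult_eq_zero h]
  have := xiSum_le
  norm_num at this ⊢
  linarith

lemma le_tsum_xiMult_div_im_sq : 0.0458 ≤ ∑' ρ : ℂ, xiMult ρ / ρ.im ^ 2 := by
  refine le_xiSum.trans (hasSum_le ?_ hasSum_xiSum summable_xiMult_div_im_sq.hasSum)
  intro ρ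
  by_cases h : riemannXi ρ = 0
  · have hre := re_mem_Ioo_of_riemannXi_eq_zero h
    have := mul_le_mul_of_nonneg_left (re_div_add_le_one_div hre.1 hre.2
      (im_ne_zero_of_riemannXi_eq_zero h)) (xiMult_nonneg ρ)
    calc _ ≤ _ := this
      _ = _ := by ring
  · simp [xiMult_eq_zero h]

end XiPartialFractions

section Digamma

open Complex Topology

lemma hasDerivAt_log_Gamma {x : ℝ} (hx : 0 < x) :
    HasDerivAt (Real.log ∘ Real.Gamma) (digamma x).re x := by
  have h1 : DifferentiableAt ℝ Real.Gamma x :=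
    Real.differentiableAt_Gamma fun m h => by
      have : (0 : ℝ) ≤ m := m.cast_nonneg
      linarith
  have h2 := h1.hasDerivAt.log (Real.Gamma_pos_of_pos hx).ne'
  have h3 : HasDerivAt Complex.Gamma (deriv Complex.Gamma x) (x : ℂ) :=
    (Complex.differentiableAt_Gamma _ fun m h => by
      have : (0 : ℝ) ≤ m := m.cast_nonneg
      have h' := congrArg re h
      simp at h'
      linarith).hasDerivAt
  have h4 : deriv Complex.Gamma x = ((deriv Real.Gamma x : ℝ) : ℂ) := by
    have h5 := h3.comp_ofReal
    have h6 := h1.hasDerivAt.ofReal_comp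
    refine h5.unique (h6.congr_of_eventuallyEq ?_)
    exact Eventually.of_forall fun y => Complex.Gamma_ofReal y
  have h5 : digamma x = ((deriv Real.Gamma x / Real.Gamma x : ℝ) : ℂ) := by
    rw [digamma_def, logDeriv_apply, h4, Complex.Gamma_ofReal, ofReal_div]
  rw [h5, ofReal_re]
  exact h2

lemma digamma_ofReal_im {x : ℝ} (hx : 0 < x) : (digamma x).im = 0 := by
  have h1 : DifferentiableAt ℝ Real.Gamma x :=
    Real.differentiableAt_Gamma fun m h => by
      have : (0 : ℝ) ≤ m := m.cast_nonneg
      linarith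
  have h3 : HasDerivAt Complex.Gamma (deriv Complex.Gamma x) (x : ℂ) :=
    (Complex.differentiableAt_Gamma _ fun m h => by
      have : (0 : ℝ) ≤ m := m.cast_nonneg
      have h' := congrArg re h
      simp at h'
      linarith).hasDerivAt
  have h4 : deriv Complex.Gamma x = ((deriv Real.Gamma x : ℝ) : ℂ) := by
    have h5 := h3.comp_ofReal
    have h6 := h1.hasDerivAt.ofReal_comp
    refine h5.unique (h6.congr_of_eventuallyEq ?_)
    exact Eventually.of_forall fun y => Complex.Gamma_ofReal y
  rw [digamma_def, logDeriv_apply, h4, Complex.Gamma_ofReal, ← ofReal_div, ofReal_im]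

lemma log_Gamma_add_one_sub {x : ℝ} (hx : 0 < x) :
    (Real.log ∘ Real.Gamma) (x + 1) - (Real.log ∘ Real.Gamma) x = Real.log x := by
  simp only [Function.comp_apply]
  rw [Real.Gamma_add_one hx.ne', Real.log_mul hx.ne' (Real.Gamma_pos_of_pos hx).ne']
  ring

lemma re_digamma_le_log {x : ℝ} (hx : 0 < x) : (digamma x).re ≤ Real.log x := by
  have := Real.convexOn_log_Gamma.le_slope_of_hasDerivAt (x := x) (y := x + 1) hx
    (by simp only [Set.mem_Ioi]; linarith) (by linarith) (hasDerivAt_log_Gamma hx)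
  rwa [slope_def_field, log_Gamma_add_one_sub hx, add_sub_cancel_left, div_one] at this

lemma log_le_re_digamma_add_one {x : ℝ} (hx : 0 < x) :
    Real.log x ≤ (digamma ((x + 1 : ℝ) : ℂ)).re := by
  have := Real.convexOn_log_Gamma.slope_le_of_hasDerivAt (x := x) (y := x + 1) hx
    (by simp only [Set.mem_Ioi]; linarith) (by linarith) (hasDerivAt_log_Gamma (by linarith))
  rwa [slope_def_field, log_Gamma_add_one_sub hx, add_sub_cancel_left, div_one] at this

lemma digamma_add_natCast {s : ℂ} (hs : 0 < s.re) (N : ℕ) :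
    digamma (s + N) = digamma s + ∑ n ∈ range N, 1 / ((n : ℂ) + s) := by
  induction N with
  | zero => simp
  | succ N ih =>
    rw [Finset.sum_range_succ, ← add_assoc, ← ih, Nat.cast_succ, ← add_assoc,
      digamma_apply_add_one, one_div, add_comm s]
    intro m h
    have h' := congrArg re h
    have h1 : (0 : ℝ) ≤ m := m.cast_nonneg
    have h2 : (0 : ℝ) ≤ N := N.cast_nonneg
    simp at h'
    linarith

lemma digamma_term_eq {s : ℂ} (hs : 0 < s.re) (n : ℕ) :
    1 / ((n : ℂ) + 1) - 1 / ((n : ℂ) + s) = (s - 1) / ((n + 1) * (n + s)) := by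
  have h1 : (n : ℂ) + 1 ≠ 0 := by exact_mod_cast n.succ_ne_zero
  have h2 : (n : ℂ) + s ≠ 0 := fun h => by
    have h' := congrArg re h
    have h1 : (0 : ℝ) ≤ n := n.cast_nonneg
    simp at h'
    linarith
  rw [div_sub_div _ _ h1 h2]
  congr 1
  ring

lemma norm_digamma_term_le {s : ℂ} {ε R : ℝ} (hε : 0 < ε) (hε1 : ε ≤ 1) (hs : ε < s.re)
    (hR : ‖s‖ ≤ R) (n : ℕ) :
    ‖1 / ((n : ℂ) + 1) - 1 / ((n : ℂ) + s)‖ ≤ (R + 1) / ε * (1 / ((n : ℝ) + 1) ^ 2) := by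
  have hn : (0 : ℝ) ≤ n := n.cast_nonneg
  rw [digamma_term_eq (by linarith), norm_div, norm_mul]
  have h1 : ‖(n : ℂ) + 1‖ = n + 1 := by
    have : (n : ℂ) + 1 = ((n + 1 : ℝ) : ℂ) := by push_cast; rfl
    rw [this, norm_real, Real.norm_of_nonneg (by positivity)]
  have h2 : ε * (n + 1) ≤ ‖(n : ℂ) + s‖ := by
    refine le_trans ?_ ((le_abs_self _).trans (abs_re_le_norm _))
    simp
    nlinarith
  have h3 : ‖s - 1‖ ≤ R + 1 := (norm_sub_le _ _).trans (by simpa using hR)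
  have hR0 : 0 ≤ R := (norm_nonneg s).trans hR
  rw [h1]
  calc _ ≤ (R + 1) / ((n + 1) * (ε * (n + 1))) := by gcongr
    _ = _ := by field_simp

lemma summable_digamma_bound (C : ℝ) : Summable fun n : ℕ => C * (1 / ((n : ℝ) + 1) ^ 2) := by
  refine Summable.mul_left _ ?_
  have := (summable_nat_add_iff 1).2 (Real.summable_one_div_nat_pow.2 one_lt_two)
  exact_mod_cast this

lemma summable_digamma {s : ℂ} (hs : 0 < s.re) :
    Summable fun n : ℕ => 1 / ((n : ℂ) + 1) - 1 / ((n : ℂ) + s) := by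
  refine Summable.of_norm_bounded (summable_digamma_bound ((‖s‖ + 1) / (min s.re 1 / 2)))
    fun n => norm_digamma_term_le ?_ ?_ ?_ le_rfl n
  · positivity
  · linarith [min_le_right s.re 1]
  · have := min_le_left s.re 1
    linarith

lemma tendsto_re_digamma_sub_log {x : ℝ} (hx : 0 < x) :
    Tendsto (fun N : ℕ => (digamma ((x : ℂ) + N)).re - Real.log N) atTop (𝓝 0) := by
  have h1 : Tendsto (fun N : ℕ => (1 + x) * (1 / (N : ℝ))) atTop (𝓝 0) := by
    have := tendsto_one_div_atTop_nhds_zero_nat (𝕜 := ℝ)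
    simpa using this.const_mul (1 + x)
  have h0 : Tendsto (fun N : ℕ => -(2 * (1 / (N : ℝ)))) atTop (𝓝 0) := by
    have := tendsto_one_div_atTop_nhds_zero_nat (𝕜 := ℝ)
    simpa using (this.const_mul 2).neg
  refine tendsto_of_tendsto_of_tendsto_of_le_of_le' h0 h1 ?_ ?_
  · filter_upwards [eventually_ge_atTop 2] with N hN
    have hN0 : (2 : ℝ) ≤ N := by exact_mod_cast hN
    have h2 := log_le_re_digamma_add_one (x := x + N - 1) (by linarith)
    have h3 : Real.log (N - 1) ≤ Real.log (x + N - 1) :=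
      Real.log_le_log (by linarith) (by linarith)
    have h4 : (((x + N - 1 + 1 : ℝ)) : ℂ) = x + N := by push_cast; ring
    rw [h4] at h2
    have h5 : Real.log N - Real.log (N - 1) ≤ 2 * (1 / (N : ℝ)) := by
      rw [← Real.log_div (by linarith) (by linarith)]
      refine (Real.log_le_sub_one_of_pos (div_pos (by linarith) (by linarith))).trans ?_
      rw [div_sub_one (by linarith), mul_one_div, div_le_div_iff₀ (by linarith) (by linarith)]
      nlinarith
    linarith
  · filter_upwards [eventually_ge_atTop 2] with N hN
    have hN0 : (2 : ℝ) ≤ N := by exact_mod_cast hN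
    have h2 := re_digamma_le_log (x := x + N) (by linarith)
    have h5 : Real.log (x + N) - Real.log N ≤ (1 + x) * (1 / (N : ℝ)) := by
      rw [← Real.log_div (by linarith) (by linarith)]
      refine (Real.log_le_sub_one_of_pos (div_pos (by linarith) (by linarith))).trans ?_
      rw [div_sub_one (by linarith), mul_one_div, div_le_div_iff₀ (by linarith) (by linarith)]
      nlinarith
    push_cast at h2
    linarith

lemma hasSum_digamma_ofReal {x : ℝ} (hx : 0 < x) :
    HasSum (fun n : ℕ => 1 / ((n : ℂ) + 1) - 1 / ((n : ℂ) + x))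
      (digamma x + Real.eulerMascheroniConstant) := by
  have hs := summable_digamma (s := x) (by simpa using hx)
  have h1 := hs.hasSum.tendsto_sum_nat
  have h2 := tendsto_re_digamma_sub_log hx
  have h3 := Real.tendsto_harmonic_sub_log
  have h4 := h3.sub h2
  have h5 : ∀ N : ℕ, (harmonic N : ℝ) - Real.log N - ((digamma ((x : ℂ) + N)).re - Real.log N) =
      (∑ n ∈ range N, (1 / ((n : ℂ) + 1) - 1 / ((n : ℂ) + x)) - digamma x).re := by
    intro N
    rw [digamma_add_natCast (by simpa using hx), Finset.sum_sub_distrib]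
    have : ((harmonic N : ℝ) : ℂ) = ∑ n ∈ range N, 1 / ((n : ℂ) + 1) := by
      simp [harmonic]
    rw [← this]
    simp only [add_re, sub_re, ofReal_re]
    ring
  simp_rw [h5] at h4
  have h6 := ((continuous_re.tendsto _).comp (h1.sub_const (digamma x)))
  have h7 := tendsto_nhds_unique h4 h6
  have h8 : (∑' n : ℕ, (1 / ((n : ℂ) + 1) - 1 / ((n : ℂ) + x))) =
      digamma x + Real.eulerMascheroniConstant := by
    apply Complex.ext
    · rw [sub_re] at h7
      rw [add_re, ofReal_re]
      linarith
    · rw [add_im, ofReal_im, digamma_ofReal_im hx, im_tsum hs]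
      simp only [add_zero]
      rw [← tsum_zero (β := ℕ)]
      congr 1
      ext n
      have : 1 / ((n : ℂ) + 1) - 1 / ((n : ℂ) + x) =
        ((1 / ((n : ℝ) + 1) - 1 / ((n : ℝ) + x) : ℝ) : ℂ) := by push_cast; rfl
      rw [this, ofReal_im]
  rw [← h8]
  exact hs.hasSum

lemma differentiableAt_digamma {s : ℂ} (hs : 0 < s.re) : DifferentiableAt ℂ digamma s := by
  have hne : ∀ z : ℂ, 0 < z.re → ∀ m : ℕ, z ≠ -m := by
    intro z hz m h
    have h' := congrArg re h
    have : (0 : ℝ) ≤ m := m.cast_nonneg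
    simp at h'
    linarith
  have hopen : IsOpen {z : ℂ | 0 < z.re} := isOpen_lt continuous_const continuous_re
  have h1 : DifferentiableOn ℂ Complex.Gamma {z : ℂ | 0 < z.re} := fun z hz =>
    (Complex.differentiableAt_Gamma z (hne z hz)).differentiableWithinAt
  have h2 := (h1.deriv hopen).differentiableAt (hopen.mem_nhds hs)
  exact h2.div (Complex.differentiableAt_Gamma s (hne s hs))
    (Complex.Gamma_ne_zero_of_re_pos hs)

theorem hasSum_digamma {s : ℂ} (hs : 0 < s.re) :
    HasSum (fun n : ℕ => 1 / ((n : ℂ) + 1) - 1 / ((n : ℂ) + s))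
      (digamma s + Real.eulerMascheroniConstant) := by
  set ε : ℝ := min s.re 1 / 2 with hε
  have hε0 : 0 < ε := by positivity
  have hε1 : ε ≤ 1 / 2 := by
    have := min_le_right s.re 1
    rw [hε]; linarith
  have hεs : ε < s.re := by
    have := min_le_left s.re 1
    rw [hε]; linarith
  set U : Set ℂ := {z : ℂ | ε < z.re} ∩ Metric.ball 0 (‖s‖ + 2) with hU
  have hUo : IsOpen U := (isOpen_lt continuous_const continuous_re).inter Metric.isOpen_ball
  have hUc : Convex ℝ U := (convex_halfSpace_re_gt ε).inter (convex_ball _ _)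
  have hf : DifferentiableOn ℂ (fun z => ∑' n : ℕ, (1 / ((n : ℂ) + 1) - 1 / ((n : ℂ) + z))) U := by
    refine differentiableOn_tsum_of_summable_norm (summable_digamma_bound ((‖s‖ + 2 + 1) / ε))
      (fun n z hz => ?_) hUo fun n z hz => ?_
    · have hne : (n : ℂ) + z ≠ 0 := fun h => by
        have h' := congrArg re h
        have h1 : (0 : ℝ) ≤ n := n.cast_nonneg
        have h2 : ε < z.re := hz.1
        simp at h'
        linarith
      have : DifferentiableAt ℂ (fun z : ℂ => 1 / ((n : ℂ) + 1) - 1 / ((n : ℂ) + z)) z := by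
        fun_prop (disch := exact hne)
      exact this.differentiableWithinAt
    · exact norm_digamma_term_le hε0 (by linarith) hz.1 (mem_ball_zero_iff.1 hz.2).le n
  have hg : DifferentiableOn ℂ (fun z => digamma z + Real.eulerMascheroniConstant) U :=
    fun z hz => ((differentiableAt_digamma (hε0.trans hz.1)).add_const _).differentiableWithinAt
  have h1U : (1 : ℂ) ∈ U := ⟨by simp; linarith, by simp; linarith [norm_nonneg s]⟩
  have heq := (hf.analyticOnNhd hUo).eqOn_of_preconnected_of_frequently_eq
    (hg.analyticOnNhd hUo) hUc.isPreconnected h1U ?_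
  · have := heq (⟨hεs, by simp⟩ : s ∈ U)
    simp only at this
    rw [← this]
    exact (summable_digamma hs).hasSum
  · have ht : Tendsto (fun n : ℕ => ((1 + 1 / ((n : ℝ) + 1) : ℝ) : ℂ)) atTop (𝓝[≠] 1) := by
      rw [tendsto_nhdsWithin_iff]
      constructor
      · have := (tendsto_one_div_add_atTop_nhds_zero_nat (𝕜 := ℝ)).const_add 1
        rw [add_zero] at this
        exact_mod_cast (continuous_ofReal.tendsto 1).comp this
      · refine Eventually.of_forall fun n => ?_
        have : (0 : ℝ) < 1 / ((n : ℝ) + 1) := by positivity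
        simp only [Set.mem_compl_iff, Set.mem_singleton_iff]
        intro h
        have h' : (1 + 1 / ((n : ℝ) + 1)) = 1 := by exact_mod_cast h
        linarith
    refine ht.frequently (Eventually.of_forall fun n => ?_).frequently
    exact (hasSum_digamma_ofReal (by positivity)).tsum_eq

lemma half_log_le {u y : ℝ} (hu : 1 / 2 < u) (hy : 9 ≤ y ^ 2) :
    (Real.log ((u + 1 / 2) ^ 2 + y ^ 2) - Real.log ((u - 1 / 2) ^ 2 + y ^ 2)) / 2 ≤
      u / (u ^ 2 + y ^ 2) +
      2 / 5 * (1 / ((u - 1 / 2) ^ 2 + y ^ 2) - 1 / ((u + 1 / 2) ^ 2 + y ^ 2)) := by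
  have h1 : 0 < (u + 1 / 2) ^ 2 + y ^ 2 := by positivity
  have h2 : 0 < (u - 1 / 2) ^ 2 + y ^ 2 := by nlinarith
  have h3 := log_le_half_sub_inv (y := ((u + 1 / 2) ^ 2 + y ^ 2) / ((u - 1 / 2) ^ 2 + y ^ 2))
    (by rw [le_div_iff₀ h2]; nlinarith)
  rw [Real.log_div h1.ne' h2.ne', one_div_div] at h3
  have h4 : (((u + 1 / 2) ^ 2 + y ^ 2) / ((u - 1 / 2) ^ 2 + y ^ 2) -
    ((u - 1 / 2) ^ 2 + y ^ 2) / ((u + 1 / 2) ^ 2 + y ^ 2)) / 2 / 2 ≤ u / (u ^ 2 + y ^ 2) +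
      2 / 5 * (1 / ((u - 1 / 2) ^ 2 + y ^ 2) - 1 / ((u + 1 / 2) ^ 2 + y ^ 2)) := by
    have hB : 0 < u ^ 2 + y ^ 2 := by positivity
    set a := (u + 1 / 2) ^ 2 + y ^ 2 with ha
    set b := (u - 1 / 2) ^ 2 + y ^ 2 with hb
    set B := u ^ 2 + y ^ 2 with hBd
    have e1 : a = B + u + 1 / 4 := by rw [ha, hBd]; ring
    have e2 : b = B - u + 1 / 4 := by rw [hb, hBd]; ring
    have e3 : (a / b - b / a) / 2 / 2 = u * (B + 1 / 4) / (a * b) := by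
      have e6 : a * a - b * b = 4 * (u * (B + 1 / 4)) := by rw [e1, e2]; ring
      rw [div_sub_div _ _ h2.ne' h1.ne', e6, mul_comm b a]
      ring
    have e4 : 2 / 5 * (1 / b - 1 / a) = 4 / 5 * u / (a * b) := by
      have e6 : a - b = 2 * u := by rw [e1, e2]; ring
      rw [div_sub_div _ _ h2.ne' h1.ne', one_mul, mul_one, e6, mul_comm b a]
      ring
    rw [e3, e4, ← sub_le_iff_le_add, ← sub_div, div_le_div_iff₀ (by positivity) hB]
    have e5 : a * b = (B + 1 / 4) ^ 2 - u ^ 2 := by rw [e1, e2]; ring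
    rw [e5]
    have e6 : (B + 1 / 4 - 4 / 5) * B ≤ (B + 1 / 4) ^ 2 - u ^ 2 := by
      nlinarith
    have := mul_le_mul_of_nonneg_left e6 (show 0 ≤ u by linarith)
    linarith
  linarith

theorem re_digamma_le {z : ℂ} (hre : 1 < z.re) (him : 9 ≤ z.im ^ 2) :
    (digamma z).re ≤ Real.log ((z.re - 1 / 2) ^ 2 + z.im ^ 2) / 2 +
      2 / 5 * (1 / ((z.re - 1 / 2) ^ 2 + z.im ^ 2)) := by
  have hlim := (hasSum_re (hasSum_digamma (s := z) (by linarith))).tendsto_sum_nat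
  have hγ := Real.tendsto_harmonic_sub_log
  set x := z.re
  set y := z.im
  set G : ℕ → ℝ := fun N => Real.log (((N : ℝ) + x - 1 / 2) ^ 2 + y ^ 2) / 2 +
    2 / 5 * (1 / (((N : ℝ) + x - 1 / 2) ^ 2 + y ^ 2)) with hG
  have hsum : ∀ N : ℕ, G N - G 0 ≤ ∑ n ∈ range N, ((n : ℝ) + x) / ((n + x) ^ 2 + y ^ 2) := by
    intro N
    rw [← Finset.sum_range_sub]
    refine Finset.sum_le_sum fun n _ => ?_
    have hn : (0 : ℝ) ≤ n := n.cast_nonneg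
    have := half_log_le (u := n + x) (by linarith) him
    simp only [hG]
    push_cast
    rw [show (n : ℝ) + 1 + x - 1 / 2 = n + x + 1 / 2 by ring]
    linarith
  have hre : ∀ N : ℕ, ∑ n ∈ range N, (1 / ((n : ℂ) + 1) - 1 / ((n : ℂ) + z)).re =
      harmonic N - ∑ n ∈ range N, ((n : ℝ) + x) / ((n + x) ^ 2 + y ^ 2) := by
    intro N
    simp only [sub_re, Finset.sum_sub_distrib]
    congr 1
    · simp only [harmonic]
      push_cast
      refine Finset.sum_congr rfl fun n _ => ?_
      rw [← one_div]
      have : 1 / ((n : ℂ) + 1) = ((1 / ((n : ℝ) + 1) : ℝ) : ℂ) := by push_cast; rfl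
      rw [this, ofReal_re]
    · refine Finset.sum_congr rfl fun n _ => ?_
      rw [re_one_div]
      simp [x, y]
  have hle : ∀ N : ℕ, 1 ≤ N → ∑ n ∈ range N, (1 / ((n : ℂ) + 1) - 1 / ((n : ℂ) + z)).re ≤
      (harmonic N - Real.log N) + G 0 := by
    intro N hN
    have hN0 : (1 : ℝ) ≤ N := by exact_mod_cast hN
    rw [hre]
    have h1 := hsum N
    have h2 : Real.log N ≤ Real.log (((N : ℝ) + x - 1 / 2) ^ 2 + y ^ 2) / 2 := by
      rw [le_div_iff₀ (by norm_num), mul_comm, ← Real.log_rpow (by linarith)]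
      apply Real.log_le_log (by positivity)
      norm_cast
      push_cast
      nlinarith
    have h3 : 0 ≤ 1 / (((N : ℝ) + x - 1 / 2) ^ 2 + y ^ 2) := by positivity
    simp only [hG] at h1 ⊢
    linarith
  have := le_of_tendsto_of_tendsto hlim (hγ.add_const (G 0))
    ((eventually_ge_atTop 1).mono fun N hN => hle N hN)
  simp only [hG, add_re, ofReal_re, Nat.cast_zero, zero_add] at this
  linarith

theorem logDeriv_riemannXi_eq {s : ℂ} (hs : 1 < s.re) :
    logDeriv riemannXi s = 1 / (s - 1) - Real.log Real.pi / 2 + digamma (s / 2 + 1) / 2 +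
      logDeriv riemannZeta s := by
  have hs0 : s ≠ 0 := fun h => by rw [h] at hs; simp at hs; linarith
  have hs1 : s ≠ 1 := fun h => by rw [h] at hs; simp at hs
  have hopen : IsOpen {z : ℂ | 1 < z.re} := isOpen_lt continuous_const continuous_re
  have hev : riemannXi =ᶠ[𝓝 s] fun z => (2 * (z - 1)) * ((Real.pi : ℂ) ^ (-z / 2) *
      Complex.Gamma (z / 2 + 1) * riemannZeta z) := by
    filter_upwards [hopen.mem_nhds hs] with z hz
    have hz' : 1 < z.re := hz
    have hz0 : z ≠ 0 := fun h => by rw [h] at hz'; simp at hz'; linarith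
    rw [riemannXi_eq (by linarith) (fun h => by rw [h] at hz'; simp at hz'), Gammaℝ_def,
      Complex.Gamma_add_one _ (div_ne_zero hz0 two_ne_zero)]
    ring
  have hpi : (Real.pi : ℂ) ≠ 0 := by exact_mod_cast Real.pi_ne_zero
  have hG0 : 0 < (s / 2 + 1).re := by
    simp; linarith
  have d1 : DifferentiableAt ℂ (fun z : ℂ => 2 * (z - 1)) s := by fun_prop
  have d2 : HasDerivAt (fun z : ℂ => (Real.pi : ℂ) ^ (-z / 2))
      ((Real.pi : ℂ) ^ (-s / 2) * Complex.log Real.pi * (-1 / 2)) s := by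
    have : HasDerivAt (fun z : ℂ => -z / 2) (-1 / 2) s := ((hasDerivAt_id s).neg.div_const 2)
    exact this.const_cpow (Or.inl hpi)
  have d3' : HasDerivAt (fun z : ℂ => z / 2 + 1) (1 / 2) s :=
    ((hasDerivAt_id s).div_const 2).add_const 1
  have d3'' : HasDerivAt Complex.Gamma (deriv Complex.Gamma (s / 2 + 1)) (s / 2 + 1) :=
    (Complex.differentiableAt_Gamma _ (fun m h => by
      rw [h] at hG0
      have : (0 : ℝ) ≤ m := m.cast_nonneg
      simp at hG0
      linarith)).hasDerivAt
  have d3 : HasDerivAt (fun z : ℂ => Complex.Gamma (z / 2 + 1))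
    (deriv Complex.Gamma (s / 2 + 1) * (1 / 2)) s := d3''.comp s d3'
  have d4 := differentiableAt_riemannZeta hs1
  have hGne := Complex.Gamma_ne_zero_of_re_pos hG0
  have hpne : (Real.pi : ℂ) ^ (-s / 2) ≠ 0 := by simp [cpow_eq_zero_iff, hpi]
  have hζ := riemannZeta_ne_zero_of_one_le_re hs.le
  have hs1' : 2 * (s - 1) ≠ 0 := mul_ne_zero two_ne_zero (sub_ne_zero.2 hs1)
  have e0 : logDeriv riemannXi s = logDeriv (fun z => (2 * (z - 1)) * ((Real.pi : ℂ) ^ (-z / 2) *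
      Complex.Gamma (z / 2 + 1) * riemannZeta z)) s := by
    rw [logDeriv_apply, logDeriv_apply, hev.deriv_eq, hev.eq_of_nhds]
  rw [e0, logDeriv_mul (f := fun z : ℂ => 2 * (z - 1)) (g := fun z : ℂ => (Real.pi : ℂ) ^ (-z / 2) *
      Complex.Gamma (z / 2 + 1) * riemannZeta z) s hs1' (mul_ne_zero (mul_ne_zero hpne hGne) hζ) d1
      ((d2.differentiableAt.mul d3.differentiableAt).mul d4),
    logDeriv_mul (f := fun z : ℂ => (Real.pi : ℂ) ^ (-z / 2) * Complex.Gamma (z / 2 + 1))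
      (g := riemannZeta) s (mul_ne_zero hpne hGne) hζ (d2.differentiableAt.mul d3.differentiableAt) d4,
    logDeriv_mul (f := fun z : ℂ => (Real.pi : ℂ) ^ (-z / 2))
      (g := fun z : ℂ => Complex.Gamma (z / 2 + 1)) s hpne hGne d2.differentiableAt d3.differentiableAt]
  have f1 : logDeriv (fun z : ℂ => 2 * (z - 1)) s = 1 / (s - 1) := by
    have : HasDerivAt (fun z : ℂ => 2 * (z - 1)) (2 * 1) s :=
      ((hasDerivAt_id s).sub_const 1).const_mul 2
    rw [logDeriv_apply, this.deriv]
    have := sub_ne_zero.2 hs1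
    field_simp
  have f2 : logDeriv (fun z : ℂ => (Real.pi : ℂ) ^ (-z / 2)) s = -(Real.log Real.pi / 2) := by
    rw [logDeriv_apply, d2.deriv, ← ofReal_log Real.pi_pos.le]
    field_simp
  have f3 : logDeriv (fun z : ℂ => Complex.Gamma (z / 2 + 1)) s = digamma (s / 2 + 1) / 2 := by
    rw [logDeriv_apply, d3.deriv, digamma_def, logDeriv_apply]
    field_simp
  rw [f1, f2, f3]
  ring

end Digamma

section ZeroFreeRegion

open Complex ArithmeticFunction Topology

lemma neg_logDeriv_riemannZeta_eq {s : ℂ} (hs : 1 < s.re) :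
    -logDeriv riemannZeta s = 1 / (s - 1) - Real.log Real.pi / 2 + digamma (s / 2 + 1) / 2 -
      logDeriv riemannXi s := by
  rw [logDeriv_riemannXi_eq hs]; ring

lemma hasSum_vonMangoldt {s : ℂ} (hs : 1 < s.re) :
    HasSum (LSeries.term (fun n => (vonMangoldt n : ℂ)) s) (-logDeriv riemannZeta s) := by
  have h := (LSeriesSummable_vonMangoldt hs).LSeriesHasSum
  rw [LSeries_vonMangoldt_eq_deriv_riemannZeta_div hs] at h
  rw [logDeriv_apply, ← neg_div]
  exact h

lemma re_term_vonMangoldt (σ t : ℝ) {n : ℕ} (hn : n ≠ 0) :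
    (LSeries.term (fun n => (vonMangoldt n : ℂ)) (σ + t * I) n).re =
      vonMangoldt n * Real.exp (-(σ * Real.log n)) * Real.cos (t * Real.log n) := by
  have h0 : (n : ℂ) ≠ 0 := by exact_mod_cast hn
  rw [LSeries.term_def, if_neg hn, cpow_def_of_ne_zero h0, ← natCast_log, div_eq_mul_inv,
    ← Complex.exp_neg, mul_assoc, re_ofReal_mul]
  congr 1
  rw [exp_re]
  have e1 : (-((Real.log n : ℂ) * (σ + t * I))).re = -(σ * Real.log n) := by
    rw [neg_re, re_ofReal_mul]; simp; ring
  have e2 : (-((Real.log n : ℂ) * (σ + t * I))).im = -(t * Real.log n) := by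
    rw [neg_im, im_ofReal_mul]; simp; ring
  rw [e1, e2, Real.cos_neg]

lemma three_four_one {σ : ℝ} (hσ : 1 < σ) (t : ℝ) :
    0 ≤ 3 * (-logDeriv riemannZeta (σ : ℂ)).re + 4 * (-logDeriv riemannZeta (σ + t * I)).re +
      (-logDeriv riemannZeta (σ + (2 * t : ℝ) * I)).re := by
  have h0 := hasSum_re (hasSum_vonMangoldt (s := σ + (0 : ℝ) * I) (by simpa using hσ))
  have h1 := hasSum_re (hasSum_vonMangoldt (s := σ + t * I) (by simpa using hσ))
  have h2 := hasSum_re (hasSum_vonMangoldt (s := σ + (2 * t : ℝ) * I) (by simpa using hσ))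
  have h3 := ((h0.mul_left 3).add (h1.mul_left 4)).add h2
  rw [ofReal_zero, zero_mul, add_zero] at h3
  refine h3.nonneg fun n => ?_
  rcases eq_or_ne n 0 with rfl | hn
  · simp [LSeries.term_def]
  have e0 := re_term_vonMangoldt σ 0 hn
  rw [ofReal_zero, zero_mul, add_zero] at e0
  rw [e0, re_term_vonMangoldt σ t hn, re_term_vonMangoldt σ (2 * t) hn, zero_mul, Real.cos_zero,
    mul_assoc 2 t, Real.cos_two_mul]
  have hΛ : 0 ≤ vonMangoldt n := vonMangoldt_nonneg
  have hE := Real.exp_nonneg (-(σ * Real.log n))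
  have h5 : 0 ≤ vonMangoldt n * Real.exp (-(σ * Real.log n)) *
      (2 * (1 + Real.cos (t * Real.log n)) ^ 2) := by positivity
  linarith

lemma re_term_riemannXi_nonneg {s : ℂ} (hs : 1 < s.re) (ρ : ℂ) :
    0 ≤ ((xiMult ρ : ℂ) * (1 / (s - ρ) + 1 / (s - 1 + ρ))).re := by
  by_cases h : riemannXi ρ = 0
  · have hre := re_mem_Ioo_of_riemannXi_eq_zero h
    rw [re_ofReal_mul, add_re, re_one_div, re_one_div]
    have h1 : 0 ≤ (s - ρ).re := by rw [sub_re]; linarith [hre.2]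
    have h2 : 0 ≤ (s - 1 + ρ).re := by rw [add_re, sub_re, one_re]; linarith [hre.1]
    have := xiMult_nonneg ρ
    positivity
  · simp [xiMult_eq_zero h]

lemma re_logDeriv_riemannXi_nonneg {s : ℂ} (hs : 1 < s.re) : 0 ≤ (logDeriv riemannXi s).re := by
  have h := hasSum_re (hasSum_logDeriv_riemannXi (riemannXi_ne_zero_of_one_le_re hs.le))
  have h2 := h.nonneg fun ρ => re_term_riemannXi_nonneg hs ρ
  simp at h2
  exact h2

lemma one_div_le_re_logDeriv_riemannXi {σ : ℝ} (hσ : 1 < σ) {ρ : ℂ} (h : riemannXi ρ = 0) :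
    1 / (σ - ρ.re) ≤ (logDeriv riemannXi (σ + ρ.im * I)).re := by
  set s : ℂ := σ + ρ.im * I with hs
  have hsre : s.re = σ := by simp [hs]
  have hsim : s.im = ρ.im := by simp [hs]
  have hs1 : 1 < s.re := by rw [hsre]; exact hσ
  have h1 := hasSum_re (hasSum_logDeriv_riemannXi (riemannXi_ne_zero_of_one_le_re hs1.le))
  have him := im_ne_zero_of_riemannXi_eq_zero h
  have hre := re_mem_Ioo_of_riemannXi_eq_zero h
  have hne : ρ ≠ 1 - ρ := fun h' => by
    have := congrArg im h'
    simp at this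
    exact him (by linarith)
  have h2 := sum_le_hasSum {ρ, 1 - ρ} (fun z _ => re_term_riemannXi_nonneg hs1 z) h1
  rw [Finset.sum_pair hne] at h2
  have key : ∀ z : ℂ, riemannXi z = 0 →
      (1 / (s - z)).re = 1 / (σ - ρ.re) ∨ (1 / (s - 1 + z)).re = 1 / (σ - ρ.re) →
      1 / (σ - ρ.re) ≤ ((xiMult z : ℂ) * (1 / (s - z) + 1 / (s - 1 + z))).re := by
    intro z hz hor
    have hz' := re_mem_Ioo_of_riemannXi_eq_zero hz
    have hm := one_le_xiMult hz
    have h5 : 0 ≤ (s - z).re := by rw [sub_re]; linarith [hz'.2]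
    have h6 : 0 ≤ (s - 1 + z).re := by rw [add_re, sub_re, one_re]; linarith [hz'.1]
    have h3 : 0 ≤ (1 / (s - z)).re := by rw [re_one_div]; positivity
    have h4 : 0 ≤ (1 / (s - 1 + z)).re := by rw [re_one_div]; positivity
    rw [re_ofReal_mul, add_re]
    refine le_trans ?_ (le_mul_of_one_le_left (by positivity) hm)
    rcases hor with h' | h' <;> linarith
  have hval : (1 / (s - ρ)).re = 1 / (σ - ρ.re) := by
    have : s - ρ = ((σ - ρ.re : ℝ) : ℂ) := by
      apply Complex.ext <;> simp [hsre, hsim]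
    rw [this, ← ofReal_one, ← ofReal_div, ofReal_re]
  have k1 := key ρ h (Or.inl hval)
  have k2 := key (1 - ρ) (by rw [riemannXi_one_sub, h]) (Or.inr (by
    rw [show s - 1 + (1 - ρ) = s - ρ by ring]; exact hval))
  have h3 : (2 * logDeriv riemannXi s).re = 2 * (logDeriv riemannXi s).re := by simp
  rw [h3] at h2
  linarith

lemma le_log_abs_of_le_sq {y : ℝ} (hy : 42 ≤ y ^ 2) : 1.867 ≤ Real.log |y| := by
  have h1 : Real.log (y ^ 2) = 2 * Real.log |y| := by
    rw [← sq_abs, Real.log_pow]; norm_num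
  have h2 : Real.log (32 * (1 + 5 / 16)) ≤ Real.log (y ^ 2) :=
    Real.log_le_log (by norm_num) (by linarith)
  rw [Real.log_mul (x := 32) (by norm_num) (by norm_num), show (32 : ℝ) = 2 ^ 5 by norm_num,
    Real.log_pow] at h2
  have h3 := Real.le_log_one_add_of_nonneg (x := 5 / 16) (by norm_num)
  have := Real.log_two_gt_d9
  norm_num at h2 h3 ⊢
  linarith

lemma re_neg_logDeriv_riemannZeta_add {σ y : ℝ} (hσ : 1 < σ) (hσ2 : σ ≤ 1.6) (hy : 42 ≤ y ^ 2) :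
    (-logDeriv riemannZeta (σ + y * I)).re + (logDeriv riemannXi (σ + y * I)).re ≤
      Real.log |y| / 2 - Real.log 2 / 2 - Real.log 3 / 2 + 3.1 / y ^ 2 := by
  set s : ℂ := σ + y * I with hs
  have hsre : s.re = σ := by simp [hs]
  have hsim : s.im = y := by simp [hs]
  have hzre : (s / 2 + 1).re = σ / 2 + 1 := by simp [hsre]
  have hzim : (s / 2 + 1).im = y / 2 := by simp [hsim]
  have hψ := re_digamma_le (z := s / 2 + 1) (by rw [hzre]; linarith) (by rw [hzim]; nlinarith)
  rw [hzre, hzim] at hψ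
  have hy0 : 0 < y ^ 2 := by linarith
  rw [neg_logDeriv_riemannZeta_eq (by rw [hsre]; exact hσ)]
  have h1 : (1 / (s - 1)).re ≤ 0.6 * (1 / y ^ 2) := by
    rw [re_one_div, sub_re, sub_im, one_re, one_im, hsre, hsim, sub_zero, mul_one_div,
      div_le_div_iff₀ (by positivity) hy0]
    nlinarith [mul_le_mul_of_nonneg_right (show σ - 1 ≤ 0.6 by linarith) hy0.le,
      sq_nonneg (σ - 1)]
  have e1 : (σ / 2 + 1 - 1 / 2) ^ 2 + (y / 2) ^ 2 = y ^ 2 / 4 * (1 + (σ + 1) ^ 2 / y ^ 2) := by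
    have hyne : y ≠ 0 := fun h => by rw [h] at hy0; norm_num at hy0
    field_simp
    ring
  have hq : 0 < (σ + 1) ^ 2 / y ^ 2 := div_pos (by positivity) hy0
  have h2 : Real.log ((σ / 2 + 1 - 1 / 2) ^ 2 + (y / 2) ^ 2) ≤
      2 * Real.log |y| - 2 * Real.log 2 + 6.76 * (1 / y ^ 2) := by
    rw [e1, Real.log_mul (by positivity) (by positivity), Real.log_div hy0.ne' (by norm_num),
      ← sq_abs y, Real.log_pow, show (4 : ℝ) = 2 ^ 2 by norm_num, Real.log_pow, sq_abs]
    have h3 : Real.log (1 + (σ + 1) ^ 2 / y ^ 2) ≤ (σ + 1) ^ 2 / y ^ 2 := by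
      have := Real.log_le_sub_one_of_pos (x := 1 + (σ + 1) ^ 2 / y ^ 2) (by positivity)
      linarith
    have h4 : (σ + 1) ^ 2 / y ^ 2 ≤ 6.76 * (1 / y ^ 2) := by
      rw [mul_one_div]
      apply div_le_div_of_nonneg_right _ hy0.le
      nlinarith
    push_cast
    linarith
  have h3 : 1 / ((σ / 2 + 1 - 1 / 2) ^ 2 + (y / 2) ^ 2) ≤ 4 * (1 / y ^ 2) := by
    rw [mul_one_div, div_le_div_iff₀ (by nlinarith) hy0]
    nlinarith [sq_nonneg (σ / 2 + 1 - 1 / 2)]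
  have h4 : Real.log 3 ≤ Real.log Real.pi :=
    Real.log_le_log (by norm_num) (by linarith [Real.pi_gt_three])
  simp only [sub_re, add_re]
  have e2 : ((Real.log Real.pi : ℂ) / 2).re = Real.log Real.pi / 2 := by
    rw [div_ofNat_re, ofReal_re]
  have e3 : (digamma (s / 2 + 1) / 2).re = (digamma (s / 2 + 1)).re / 2 := by
    rw [div_ofNat_re]
  rw [e2, e3]
  have hq0 : 0 < 1 / y ^ 2 := by positivity
  rw [div_eq_mul_one_div 3.1]
  set Q := 1 / y ^ 2
  set R := 1 / ((σ / 2 + 1 - 1 / 2) ^ 2 + (y / 2) ^ 2)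
  linarith

lemma re_neg_logDeriv_riemannZeta_ofReal_le {σ : ℝ} (hσ : 1 < σ) (hσ2 : σ ≤ 2) :
    (-logDeriv riemannZeta (σ : ℂ)).re ≤ 1 / (σ - 1) := by
  have h0 : 1 < (σ : ℂ).re := by simpa using hσ
  have hψ := re_digamma_le_log (x := σ / 2 + 1) (by linarith)
  have h1 : Real.log (σ / 2 + 1) ≤ Real.log Real.pi :=
    Real.log_le_log (by linarith) (by linarith [Real.pi_gt_three])
  have h2 := re_logDeriv_riemannXi_nonneg h0
  rw [neg_logDeriv_riemannZeta_eq h0]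
  have e1 : (1 / ((σ : ℂ) - 1)) = ((1 / (σ - 1) : ℝ) : ℂ) := by push_cast; rfl
  have e2 : ((σ : ℂ) / 2 + 1) = ((σ / 2 + 1 : ℝ) : ℂ) := by push_cast; rfl
  rw [e1, e2]
  simp only [sub_re, add_re, ofReal_re, div_ofNat_re]
  linarith

/-- An explicit zero-free region of de la Vallée Poussin type. -/
theorem one_div_one_sub_re_le {ρ : ℂ} (h : riemannXi ρ = 0) :
    1 / (1 - ρ.re) ≤ 14 * (5 / 2 * Real.log |ρ.im| - 15 / 4) := by
  have hre := re_mem_Ioo_of_riemannXi_eq_zero h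
  have him := le_im_sq_of_riemannXi_eq_zero h
  have hlog := le_log_abs_of_le_sq him
  set y := ρ.im
  set L := 5 / 2 * Real.log |y| - 15 / 4 with hL
  have hL0 : 0.917 ≤ L := by rw [hL]; norm_num at hlog ⊢; linarith
  have hLpos : 0 < L := by norm_num at hL0; linarith
  set a := 6 / 13 / L with ha
  have ha0 : 0 < a := by positivity
  have ha1 : a ≤ 0.6 := by
    rw [ha, div_le_iff₀ hLpos]; norm_num at hL0 ⊢; linarith
  have hy0 : 0 < y ^ 2 := by linarith
  have h1 := three_four_one (σ := 1 + a) (by linarith) y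
  have h2 := re_neg_logDeriv_riemannZeta_ofReal_le (σ := 1 + a) (by linarith) (by linarith)
  have h3 := re_neg_logDeriv_riemannZeta_add (σ := 1 + a) (y := y) (by linarith) (by linarith) him
  have h4 := re_neg_logDeriv_riemannZeta_add (σ := 1 + a) (y := 2 * y) (by linarith) (by linarith)
    (by nlinarith)
  have h5 := one_div_le_re_logDeriv_riemannXi (σ := 1 + a) (by linarith) h
  have h6 := re_logDeriv_riemannXi_nonneg (s := (1 + a : ℝ) + (2 * y : ℝ) * I)
    (by simp; exact ha0)
  have hyne : |y| ≠ 0 := fun h' => by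
    rw [abs_eq_zero] at h'; rw [h'] at hy0; norm_num at hy0
  have h7 : Real.log |2 * y| = Real.log 2 + Real.log |y| := by
    rw [abs_mul, Real.log_mul (by norm_num) hyne]; norm_num
  rw [h7] at h4
  have h8 : 3.1 / y ^ 2 ≤ 3.1 / 42 := by
    apply div_le_div_of_nonneg_left (by norm_num) (by norm_num) him
  have h9 : 3.1 / (2 * y) ^ 2 ≤ 3.1 / 168 := by
    apply div_le_div_of_nonneg_left (by norm_num) (by norm_num); nlinarith
  have hl2 := Real.log_two_gt_d9
  have hl3 := Real.log_three_gt_d9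
  have h10 : 4 * (1 / (1 + a - ρ.re)) ≤ 3 * (1 / a) + L := by
    rw [add_sub_cancel_left] at h2
    rw [hL]
    norm_num at *
    linarith
  have hδ : 0 < 1 - ρ.re := by linarith [hre.2]
  set δ := 1 - ρ.re with hδd
  rw [show 1 + a - ρ.re = a + δ by rw [hδd]; ring] at h10
  have h11 : 3 * (1 / a) + L = 15 / 2 * L := by
    rw [ha]; field_simp; ring
  rw [h11, mul_one_div, div_le_iff₀ (by positivity)] at h10
  have h12 : L * a = 6 / 13 := by rw [ha]; field_simp
  rw [div_le_iff₀ hδ]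
  nlinarith

end ZeroFreeRegion

section SumLogOverZeros

open Complex ArithmeticFunction Topology

lemma re_neg_logDeriv_riemannZeta_nonneg {σ : ℝ} (hσ : 1 < σ) :
    0 ≤ (-logDeriv riemannZeta (σ : ℂ)).re := by
  have h0 := hasSum_re (hasSum_vonMangoldt (s := σ + (0 : ℝ) * I) (by simpa using hσ))
  rw [ofReal_zero, zero_mul, add_zero] at h0
  refine h0.nonneg fun n => ?_
  rcases eq_or_ne n 0 with rfl | hn
  · simp [LSeries.term_def]
  have e0 := re_term_vonMangoldt σ 0 hn
  rw [ofReal_zero, zero_mul, add_zero] at e0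
  rw [e0, zero_mul, Real.cos_zero, mul_one]
  exact mul_nonneg vonMangoldt_nonneg (Real.exp_nonneg _)

lemma re_logDeriv_riemannXi_le {σ : ℝ} (hσ : 16 ≤ σ) :
    (logDeriv riemannXi ((σ + 1 / 2 : ℝ) : ℂ)).re ≤
      Real.log σ / 2 - (Real.log 2 + Real.log 3) / 2 + 2.3 / σ := by
  have h0 := re_neg_logDeriv_riemannZeta_nonneg (σ := σ + 1 / 2) (by linarith)
  have hψ := re_digamma_le_log (x := (σ + 1 / 2) / 2 + 1) (by linarith)
  rw [logDeriv_riemannXi_eq (by rw [ofReal_re]; linarith)]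
  have e1 : (1 / (((σ + 1 / 2 : ℝ) : ℂ) - 1)) = ((1 / (σ - 1 / 2) : ℝ) : ℂ) := by
    push_cast; congr 1; ring
  have e2 : (((σ + 1 / 2 : ℝ) : ℂ) / 2 + 1) = (((σ + 1 / 2) / 2 + 1 : ℝ) : ℂ) := by
    push_cast; rfl
  rw [e1, e2]
  simp only [sub_re, add_re, ofReal_re, div_ofNat_re]
  rw [neg_re] at h0
  have h1 : 1 / (σ - 1 / 2) ≤ 1.05 * (1 / σ) := by
    rw [mul_one_div, div_le_div_iff₀ (by linarith) (by linarith)]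
    linarith
  have h2 : Real.log ((σ + 1 / 2) / 2 + 1) ≤ Real.log σ - Real.log 2 + 2.5 * (1 / σ) := by
    rw [show (σ + 1 / 2) / 2 + 1 = σ / 2 * (1 + 2.5 * (1 / σ)) by field_simp; ring,
      Real.log_mul (by positivity) (by positivity), Real.log_div (by positivity) (by norm_num)]
    have := Real.log_le_sub_one_of_pos (x := 1 + 2.5 * (1 / σ)) (by positivity)
    linarith
  have h3 : Real.log 3 ≤ Real.log Real.pi :=
    Real.log_le_log (by norm_num) (by linarith [Real.pi_gt_three])
  rw [div_eq_mul_one_div 2.3]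
  set Q := 1 / σ
  linarith

lemma div_add_sq_le {σ b y : ℝ} (hσ : 1 ≤ σ) (hb : b ^ 2 ≤ 1 / 4) (hy : 42 ≤ y ^ 2) :
    σ / (σ ^ 2 + y ^ 2) ≤ 1.02 * (((σ - b) / ((σ - b) ^ 2 + y ^ 2) +
      (σ + b) / ((σ + b) ^ 2 + y ^ 2)) / 2) := by
  have h1 : 0 < (σ - b) ^ 2 + y ^ 2 := by nlinarith [sq_nonneg (σ - b)]
  have h2 : 0 < (σ + b) ^ 2 + y ^ 2 := by nlinarith [sq_nonneg (σ + b)]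
  have hA : 43 ≤ σ ^ 2 + y ^ 2 := by nlinarith
  set A := σ ^ 2 + y ^ 2 with hAd
  have e1 : ((σ - b) / ((σ - b) ^ 2 + y ^ 2) + (σ + b) / ((σ + b) ^ 2 + y ^ 2)) / 2 =
      σ * (A - b ^ 2) / (((σ - b) ^ 2 + y ^ 2) * ((σ + b) ^ 2 + y ^ 2)) := by
    rw [div_add_div _ _ h1.ne' h2.ne', div_div, mul_comm _ (2 : ℝ), ← mul_div_mul_left (σ * (A - b ^ 2)) _
      (two_ne_zero' ℝ)]
    congr 1
    rw [hAd]; ring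
  have e2 : ((σ - b) ^ 2 + y ^ 2) * ((σ + b) ^ 2 + y ^ 2) = (A + b ^ 2) ^ 2 - 4 * σ ^ 2 * b ^ 2 := by
    rw [hAd]; ring
  rw [e1, ← mul_div_assoc, div_le_div_iff₀ (by linarith) (by positivity), e2]
  have h3 : (A + b ^ 2) ^ 2 - 4 * σ ^ 2 * b ^ 2 ≤ 1.02 * ((A - b ^ 2) * A) := by
    have : 0 ≤ 4 * σ ^ 2 * b ^ 2 := by positivity
    have hb0 : 0 ≤ b ^ 2 := sq_nonneg b
    nlinarith
  nlinarith

lemma sum_div_add_sq_le (u : Finset ℂ) {σ : ℝ} (hσ : 16 ≤ σ) :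
    ∑ ρ ∈ u, xiMult ρ * (σ / (σ ^ 2 + ρ.im ^ 2)) ≤
      1.02 * (Real.log σ / 2 - (Real.log 2 + Real.log 3) / 2 + 2.3 / σ) := by
  refine le_trans ?_ (mul_le_mul_of_nonneg_left (re_logDeriv_riemannXi_le hσ) (by norm_num))
  have hs : 1 < (((σ + 1 / 2 : ℝ) : ℂ)).re := by rw [ofReal_re]; linarith
  have h1 := hasSum_re (hasSum_logDeriv_riemannXi (riemannXi_ne_zero_of_one_le_re hs.le))
  have h2 := sum_le_hasSum u (fun z _ => re_term_riemannXi_nonneg hs z) h1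
  have h3 : ∑ ρ ∈ u, xiMult ρ * (σ / (σ ^ 2 + ρ.im ^ 2)) ≤ 1.02 / 2 * ∑ ρ ∈ u,
      ((xiMult ρ : ℂ) * (1 / (((σ + 1 / 2 : ℝ) : ℂ) - ρ) + 1 /
        (((σ + 1 / 2 : ℝ) : ℂ) - 1 + ρ))).re := by
    rw [Finset.mul_sum]
    refine Finset.sum_le_sum fun ρ _ => ?_
    by_cases h : riemannXi ρ = 0
    · have hre := re_mem_Ioo_of_riemannXi_eq_zero h
      have h5 := div_add_sq_le (σ := σ) (b := ρ.re - 1 / 2) (by linarith)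
        (by nlinarith [hre.1, hre.2]) (le_im_sq_of_riemannXi_eq_zero h)
      rw [re_ofReal_mul, add_re, re_one_div, re_one_div]
      simp only [sub_re, add_re, sub_im, add_im, ofReal_re, ofReal_im, one_re, one_im]
      have h6 := mul_le_mul_of_nonneg_left h5 (xiMult_nonneg ρ)
      refine h6.trans_eq ?_
      rw [show σ + 1 / 2 - ρ.re = σ - (ρ.re - 1 / 2) by ring,
        show σ + 1 / 2 - 1 + ρ.re = σ + (ρ.re - 1 / 2) by ring]
      ring
    · simp [xiMult_eq_zero h]
  have h4 : (2 * logDeriv riemannXi ((σ + 1 / 2 : ℝ) : ℂ)).re =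
      2 * (logDeriv riemannXi ((σ + 1 / 2 : ℝ) : ℂ)).re := by simp
  rw [h4] at h2
  linarith

lemma sum_log_one_add_div_le (u : Finset ℂ) (hu : ∀ ρ ∈ u, ρ.im ≠ 0) :
    ∑ ρ ∈ u, xiMult ρ * (Real.log (1 + ρ.im ^ 2 / 16 ^ 2) / 2 / ρ.im ^ 2) ≤
      1.02 * ((Real.log 16 / 2 + 1 / 2 - (Real.log 2 + Real.log 3) / 2) / 16 + 1.15 / 16 ^ 2) := by
  set c := (Real.log 2 + Real.log 3) / 2
  set V : ℝ → ℝ := fun σ => (Real.log σ / 2 + 1 / 2 - c) / σ + 1.15 / σ ^ 2 with hV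
  set Φ : ℝ → ℝ := fun σ => ∑ ρ ∈ u, xiMult ρ * (Real.log (1 + ρ.im ^ 2 / σ ^ 2) / 2 / ρ.im ^ 2) -
    1.02 * V σ with hΦ
  have hd : ∀ σ : ℝ, 16 ≤ σ → HasDerivAt Φ (-∑ ρ ∈ u, xiMult ρ * (σ / (σ ^ 2 + ρ.im ^ 2)) / σ ^ 2 +
      1.02 * (Real.log σ / 2 - c + 2.3 / σ) / σ ^ 2) σ := by
    intro σ hσ
    have hσ0 : 0 < σ := by linarith
    have hσne := hσ0.ne'
    have d1 : HasDerivAt (fun σ => ∑ ρ ∈ u, xiMult ρ * (Real.log (1 + ρ.im ^ 2 / σ ^ 2) / 2 /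
        ρ.im ^ 2)) (∑ ρ ∈ u, -(xiMult ρ * (σ / (σ ^ 2 + ρ.im ^ 2)) / σ ^ 2)) σ := by
      refine HasDerivAt.fun_sum fun ρ hρ => ?_
      have him := hu ρ hρ
      have a1 : HasDerivAt (fun σ : ℝ => 1 + ρ.im ^ 2 / σ ^ 2) (-(2 * ρ.im ^ 2 / σ ^ 3)) σ := by
        have := (((hasDerivAt_pow 2 σ).inv (by positivity)).const_mul (ρ.im ^ 2)).const_add 1
        refine this.congr_deriv ?_
        field_simp
        norm_num
        ring
      have a2 := ((a1.log (by positivity)).div_const 2).div_const (ρ.im ^ 2)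
      refine (a2.const_mul (xiMult ρ)).congr_deriv ?_
      field_simp
    have d2 : HasDerivAt V (-(Real.log σ / 2 - c + 2.3 / σ) / σ ^ 2) σ := by
      have a1 := ((((Real.hasDerivAt_log hσne).div_const 2).add_const (1 / 2)).sub_const c).div
        (hasDerivAt_id σ) hσne
      have a2 := ((hasDerivAt_pow 2 σ).inv (by positivity)).const_mul 1.15
      refine (a1.add a2).congr_deriv ?_
      simp only [id]
      field_simp
      ring
    refine (d1.sub (d2.const_mul 1.02)).congr_deriv ?_
    rw [Finset.sum_neg_distrib]
    ring
  have hmono : MonotoneOn Φ (Set.Ici 16) := by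
    refine monotoneOn_of_deriv_nonneg (convex_Ici 16)
      (fun σ hσ => (hd σ hσ).continuousAt.continuousWithinAt) ?_ ?_
    · intro σ hσ
      rw [interior_Ici] at hσ
      exact (hd σ (le_of_lt hσ)).differentiableAt.differentiableWithinAt
    · intro σ hσ
      rw [interior_Ici] at hσ
      have hσ' : 16 ≤ σ := le_of_lt hσ
      rw [(hd σ hσ').deriv, ← Finset.sum_div, ← neg_div, ← add_div]
      have := sum_div_add_sq_le u hσ'
      change _ ≤ 1.02 * (Real.log σ / 2 - c + 2.3 / σ) at this
      apply div_nonneg _ (sq_nonneg σ)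
      linarith
  have hlim : Tendsto Φ atTop (𝓝 0) := by
    have hinv : Tendsto (fun σ : ℝ => (σ ^ 2)⁻¹) atTop (𝓝 0) :=
      (tendsto_pow_atTop two_ne_zero).inv_tendsto_atTop
    have hinv1 : Tendsto (fun σ : ℝ => σ⁻¹) atTop (𝓝 0) := tendsto_inv_atTop_zero
    have hlog : Tendsto (fun σ : ℝ => Real.log σ / σ) atTop (𝓝 0) := by
      have := Real.isLittleO_log_id_atTop.tendsto_div_nhds_zero
      simpa using this
    have t1 : Tendsto (fun σ : ℝ => ∑ ρ ∈ u, xiMult ρ * (Real.log (1 + ρ.im ^ 2 / σ ^ 2) / 2 /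
        ρ.im ^ 2)) atTop (𝓝 (∑ ρ ∈ u, xiMult ρ * (Real.log (1 + ρ.im ^ 2 * 0) / 2 /
        ρ.im ^ 2))) := by
      refine tendsto_finsetSum _ fun ρ _ => ?_
      have : Tendsto (fun σ : ℝ => 1 + ρ.im ^ 2 * (σ ^ 2)⁻¹) atTop (𝓝 (1 + ρ.im ^ 2 * 0)) :=
        (hinv.const_mul _).const_add 1
      have h2 := (Real.continuousAt_log (x := 1 + ρ.im ^ 2 * 0) (by norm_num)).tendsto.comp this
      exact ((h2.div_const 2).div_const _).const_mul _
    have t2 : Tendsto V atTop (𝓝 (0 / 2 + (1 / 2 - c) * 0 + 1.15 * 0)) := by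
      have := (((hlog.div_const 2).add (hinv1.const_mul (1 / 2 - c))).add (hinv.const_mul 1.15))
      refine this.congr' (Eventually.of_forall fun σ => ?_)
      simp only [hV]
      ring
    have := t1.sub (t2.const_mul 1.02)
    simpa using this
  have h16 : Φ 16 ≤ 0 := by
    refine ge_of_tendsto hlim ?_
    filter_upwards [eventually_ge_atTop 16] with σ hσ
    exact hmono (by simp) hσ hσ
  simp only [hΦ, hV] at h16
  linarith

lemma log_abs_le {y : ℝ} (hy : y ≠ 0) :
    Real.log |y| ≤ Real.log 16 + Real.log (1 + y ^ 2 / 16 ^ 2) / 2 := by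
  have h1 : Real.log (y ^ 2) = 2 * Real.log |y| := by
    rw [← sq_abs, Real.log_pow]; norm_num
  have h2 : Real.log (y ^ 2) ≤ Real.log (16 ^ 2 * (1 + y ^ 2 / 16 ^ 2)) := by
    apply Real.log_le_log (by positivity)
    have : 16 ^ 2 * (1 + y ^ 2 / 16 ^ 2) = 16 ^ 2 + y ^ 2 := by field_simp
    rw [this]; linarith
  rw [h1, Real.log_mul (by norm_num) (by positivity), Real.log_pow] at h2
  push_cast at h2
  linarith

lemma sum_xiMult_log_le (u : Finset ℂ) :
    ∑ ρ ∈ u, xiMult ρ * (Real.log |ρ.im| / ρ.im ^ 2) ≤ 0.2 := by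
  classical
  have h1 := sum_log_one_add_div_le (u.filter fun ρ => ρ.im ≠ 0)
    (fun ρ hρ => (Finset.mem_filter.1 hρ).2)
  have h2 : ∑ ρ ∈ u, xiMult ρ * (Real.log |ρ.im| / ρ.im ^ 2) =
      ∑ ρ ∈ u with ρ.im ≠ 0, xiMult ρ * (Real.log |ρ.im| / ρ.im ^ 2) := by
    rw [Finset.sum_filter]
    refine Finset.sum_congr rfl fun ρ _ => ?_
    by_cases h : ρ.im = 0 <;> simp [h]
  have h3 : ∑ ρ ∈ u with ρ.im ≠ 0, xiMult ρ * (Real.log |ρ.im| / ρ.im ^ 2) ≤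
      Real.log 16 * (∑ ρ ∈ u with ρ.im ≠ 0, xiMult ρ / ρ.im ^ 2) + ∑ ρ ∈ u with ρ.im ≠ 0,
        xiMult ρ * (Real.log (1 + ρ.im ^ 2 / 16 ^ 2) / 2 / ρ.im ^ 2) := by
    rw [Finset.mul_sum, ← Finset.sum_add_distrib]
    refine Finset.sum_le_sum fun ρ hρ => ?_
    have h4 := log_abs_le (Finset.mem_filter.1 hρ).2
    have h5 := mul_le_mul_of_nonneg_left (div_le_div_of_nonneg_right h4 (sq_nonneg ρ.im))
      (xiMult_nonneg ρ)
    refine h5.trans_eq ?_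
    ring
  have h4 : ∑ ρ ∈ u with ρ.im ≠ 0, xiMult ρ / ρ.im ^ 2 ≤ 0.0476 :=
    (summable_xiMult_div_im_sq.sum_le_tsum _ fun ρ _ =>
      div_nonneg (xiMult_nonneg ρ) (sq_nonneg _)).trans tsum_xiMult_div_im_sq_le
  have h5 : Real.log 16 = 4 * Real.log 2 := by
    rw [show (16 : ℝ) = 2 ^ 4 by norm_num, Real.log_pow]; norm_num
  have hl2 := Real.log_two_lt_d9
  have hl2' := Real.log_two_gt_d9
  have hl3 := Real.log_three_gt_d9
  have h6 : Real.log 16 * (∑ ρ ∈ u with ρ.im ≠ 0, xiMult ρ / ρ.im ^ 2) ≤ 2.7726 * 0.0476 := by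
    apply mul_le_mul _ h4 (Finset.sum_nonneg fun ρ _ =>
      div_nonneg (xiMult_nonneg ρ) (sq_nonneg _)) (by norm_num)
    rw [h5]; norm_num at *; linarith
  rw [h5] at h1
  rw [h2]
  refine h3.trans ?_
  norm_num at *
  linarith

lemma xiMult_mul_log_nonneg (ρ : ℂ) : 0 ≤ xiMult ρ * (Real.log |ρ.im| / ρ.im ^ 2) := by
  by_cases h : riemannXi ρ = 0
  · have := le_log_abs_of_le_sq (le_im_sq_of_riemannXi_eq_zero h)
    have h1 : 0 ≤ Real.log |ρ.im| := by linarith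
    have := xiMult_nonneg ρ
    positivity
  · simp [xiMult_eq_zero h]

lemma summable_xiMult_mul_log : Summable fun ρ : ℂ => xiMult ρ * (Real.log |ρ.im| / ρ.im ^ 2) :=
  summable_of_sum_le xiMult_mul_log_nonneg sum_xiMult_log_le

theorem tsum_xiMult_mul_log_le : ∑' ρ : ℂ, xiMult ρ * (Real.log |ρ.im| / ρ.im ^ 2) ≤ 0.2 :=
  summable_xiMult_mul_log.tsum_le_of_sum_le sum_xiMult_log_le

end SumLogOverZeros

/-- `f` is continuous on `(1, ∞)` and `∫₁^∞ f(x) x^{-w} dx` converges absolutely to `τ`. -/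
structure HasPowIntegral (f : ℝ → ℂ) (w τ : ℂ) : Prop where
  continuousOn : ContinuousOn f (Set.Ioi 1)
  integrableOn : MeasureTheory.IntegrableOn (fun x : ℝ => f x * (x : ℂ) ^ (-w)) (Set.Ioi 1)
  integral_eq : ∫ x in Set.Ioi (1 : ℝ), f x * (x : ℂ) ^ (-w) = τ

namespace HasPowIntegral

variable {f g : ℝ → ℂ} {w τ τ' : ℂ}

lemma add (hf : HasPowIntegral f w τ) (hg : HasPowIntegral g w τ') :
    HasPowIntegral (fun x => f x + g x) w (τ + τ') := by
  refine ⟨hf.1.add hg.1, ?_, ?_⟩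
  · simp only [add_mul]; exact hf.2.add hg.2
  · simp only [add_mul]
    rw [MeasureTheory.integral_add hf.2 hg.2, hf.3, hg.3]

lemma const_mul (c : ℂ) (hf : HasPowIntegral f w τ) :
    HasPowIntegral (fun x => c * f x) w (c * τ) := by
  refine ⟨continuousOn_const.mul hf.1, ?_, ?_⟩
  · simp only [mul_assoc]; exact hf.2.const_mul c
  · simp only [mul_assoc]
    rw [MeasureTheory.integral_const_mul, hf.3]

lemma sub (hf : HasPowIntegral f w τ) (hg : HasPowIntegral g w τ') :
    HasPowIntegral (fun x => f x - g x) w (τ - τ') := by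
  have := hf.add (hg.const_mul (-1))
  simpa [sub_eq_add_neg] using this

lemma congr (hf : HasPowIntegral f w τ) (h : ∀ x ∈ Set.Ioi (1 : ℝ), g x = f x) (h' : τ' = τ) :
    HasPowIntegral g w τ' := by
  subst h'
  have h2 : Set.EqOn (fun x : ℝ => f x * (x : ℂ) ^ (-w)) (fun x : ℝ => g x * (x : ℂ) ^ (-w))
      (Set.Ioi 1) := fun x hx => by simp only [h x hx]
  refine ⟨hf.1.congr h, hf.2.congr_fun h2 measurableSet_Ioi, ?_⟩
  rw [← hf.3]
  exact MeasureTheory.setIntegral_congr_fun measurableSet_Ioi h2.symm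

lemma cpow {a : ℂ} (h : a.re < w.re) :
    HasPowIntegral (fun x : ℝ => (x : ℂ) ^ (a - 1)) w (1 / (w - a)) := by
  have hne : w - a ≠ 0 := fun h0 => by
    have := congrArg Complex.re h0
    simp at this; linarith
  have e : Set.EqOn (fun x : ℝ => (x : ℂ) ^ (a - 1 - w))
      (fun x : ℝ => (x : ℂ) ^ (a - 1) * (x : ℂ) ^ (-w)) (Set.Ioi 1) := fun x hx => by
    have : (x : ℂ) ≠ 0 := by exact_mod_cast (zero_lt_one.trans hx).ne'
    simp only
    rw [← Complex.cpow_add _ _ this]; ring_nf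
  have hre : (a - 1 - w).re < -1 := by simp; linarith
  refine ⟨fun x hx => ?_, ?_, ?_⟩
  · refine ContinuousAt.continuousWithinAt ?_
    exact (Complex.continuous_ofReal.continuousAt).cpow continuousAt_const
      (Or.inl (by simpa using zero_lt_one.trans hx))
  · exact (integrableOn_Ioi_cpow_of_lt hre one_pos).congr_fun e measurableSet_Ioi
  · rw [← MeasureTheory.setIntegral_congr_fun measurableSet_Ioi e,
      integral_Ioi_cpow_of_lt hre one_pos]
    have : a - 1 - w + 1 ≠ 0 := by
      intro h0; apply hne; linear_combination -h0
    simp only [Complex.ofReal_one, Complex.one_cpow]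
    field_simp
    ring

lemma one (h : 1 < w.re) : HasPowIntegral (fun _ => 1) w (1 / (w - 1)) :=
  (cpow (a := 1) (w := w) (by simpa using h)).congr (fun x _ => by simp) rfl

lemma inv (h : 0 < w.re) : HasPowIntegral (fun x => 1 / (x : ℂ)) w (1 / w) :=
  (cpow (a := 0) (w := w) (by simpa using h)).congr (fun x _ => by
    rw [zero_sub, Complex.cpow_neg_one, one_div]) (by simp)

lemma norm_mul_cpow_le {x b : ℝ} {z : ℂ} (hw : w.re = 3) (hx : 1 < x) (h : ‖z‖ ≤ b * x) :
    ‖z * (x : ℂ) ^ (-w)‖ ≤ b * x ^ (-2 : ℝ) := by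
  have h0 : 0 < x := by linarith
  rw [norm_mul, Complex.norm_cpow_eq_rpow_re_of_pos h0, Complex.neg_re, hw]
  have : x ^ (-2 : ℝ) = x * x ^ (-3 : ℝ) := by
    rw [← Real.rpow_one_add' h0.le (by norm_num)]; norm_num
  rw [this, ← mul_assoc]
  gcongr

lemma aestronglyMeasurable (hf : ContinuousOn f (Set.Ioi 1)) :
    MeasureTheory.AEStronglyMeasurable (fun x : ℝ => f x * (x : ℂ) ^ (-w))
      (MeasureTheory.volume.restrict (Set.Ioi 1)) := by
  refine ContinuousOn.aestronglyMeasurable ?_ measurableSet_Ioi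
  refine hf.mul fun x hx => ContinuousAt.continuousWithinAt ?_
  exact (Complex.continuous_ofReal.continuousAt).cpow continuousAt_const
      (Or.inl (by simpa using zero_lt_one.trans hx))

lemma integrable_of_bound {b : ℝ} (hw : w.re = 3) (hf : ContinuousOn f (Set.Ioi 1))
    (hb : ∀ x ∈ Set.Ioi (1 : ℝ), ‖f x‖ ≤ b * x) :
    MeasureTheory.IntegrableOn (fun x : ℝ => f x * (x : ℂ) ^ (-w)) (Set.Ioi 1) := by
  have hi : MeasureTheory.IntegrableOn (fun x : ℝ => b * x ^ (-2 : ℝ)) (Set.Ioi 1) :=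
    (integrableOn_Ioi_rpow_of_lt (by norm_num) one_pos).const_mul b
  refine hi.mono' (aestronglyMeasurable hf) ?_
  filter_upwards [MeasureTheory.ae_restrict_mem measurableSet_Ioi] with x hx
  exact norm_mul_cpow_le hw hx (hb x hx)

lemma integral_norm_le {b : ℝ} (hw : w.re = 3) (hf : ContinuousOn f (Set.Ioi 1))
    (hb : ∀ x ∈ Set.Ioi (1 : ℝ), ‖f x‖ ≤ b * x) :
    ∫ x in Set.Ioi (1 : ℝ), ‖f x * (x : ℂ) ^ (-w)‖ ≤ b := by
  have hi : MeasureTheory.IntegrableOn (fun x : ℝ => b * x ^ (-2 : ℝ)) (Set.Ioi 1) :=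
    (integrableOn_Ioi_rpow_of_lt (by norm_num) one_pos).const_mul b
  calc _ ≤ ∫ x in Set.Ioi (1 : ℝ), b * x ^ (-2 : ℝ) := by
        refine MeasureTheory.setIntegral_mono_on (integrable_of_bound hw hf hb).norm hi
          measurableSet_Ioi fun x hx => norm_mul_cpow_le hw hx (hb x hx)
    _ = b := by
        rw [MeasureTheory.integral_const_mul, integral_Ioi_rpow_of_lt (by norm_num) one_pos]
        norm_num

lemma continuousOn_tsum_of_bound {ι : Type*} {F : ι → ℝ → ℂ} {b : ι → ℝ}
    (hF : ∀ i, ContinuousOn (F i) (Set.Ioi 1)) (hb : Summable b)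
    (hFb : ∀ i, ∀ x ∈ Set.Ioi (1 : ℝ), ‖F i x‖ ≤ b i * x) :
    ContinuousOn (fun x => ∑' i, F i x) (Set.Ioi 1) := by
  intro x hx
  have hx1 : (1 : ℝ) < x := hx
  have hb0 : ∀ i, 0 ≤ b i := fun i => by
    have := (norm_nonneg _).trans (hFb i x hx)
    exact nonneg_of_mul_nonneg_left this (by linarith)
  have h : ContinuousOn (fun x => ∑' i, F i x) (Set.Ioo 1 (x + 1)) :=
    continuousOn_tsum (fun i => (hF i).mono Set.Ioo_subset_Ioi_self) (hb.mul_right (x + 1))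
      fun i y hy => (hFb i y hy.1).trans (by gcongr; exacts [hb0 i, hy.2.le])
  exact (h.continuousAt (Ioo_mem_nhds hx1 (by linarith))).continuousWithinAt

lemma tsum_of_countable {ι : Type*} [Countable ι] {F : ι → ℝ → ℂ} {b : ι → ℝ} {T : ι → ℂ}
    (hw : w.re = 3) (hF : ∀ i, HasPowIntegral (F i) w (T i)) (hb : Summable b)
    (hFb : ∀ i, ∀ x ∈ Set.Ioi (1 : ℝ), ‖F i x‖ ≤ b i * x) :
    HasPowIntegral (fun x => ∑' i, F i x) w (∑' i, T i) := by
  have hc := continuousOn_tsum_of_bound (fun i => (hF i).1) hb hFb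
  have hn : ∀ x ∈ Set.Ioi (1 : ℝ), Summable fun i => ‖F i x‖ := fun x hx =>
    Summable.of_nonneg_of_le (fun i => norm_nonneg _) (fun i => hFb i x hx) (hb.mul_right x)
  refine ⟨hc, integrable_of_bound (b := ∑' i, b i) hw hc fun x hx => ?_, ?_⟩
  · calc _ ≤ ∑' i, ‖F i x‖ := norm_tsum_le_tsum_norm (hn x hx)
      _ ≤ ∑' i, b i * x := (hn x hx).tsum_le_tsum (fun i => hFb i x hx) (hb.mul_right x)
      _ = _ := tsum_mul_right
  · have := MeasureTheory.hasSum_integral_of_summable_integral_norm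
      (μ := MeasureTheory.volume.restrict (Set.Ioi (1 : ℝ)))
      (F := fun i (x : ℝ) => F i x * (x : ℂ) ^ (-w)) (fun i => (hF i).2)
      (hb.of_nonneg_of_le (fun i => MeasureTheory.integral_nonneg fun _ => norm_nonneg _)
        fun i => integral_norm_le hw (hF i).1 (hFb i))
    simp only [(hF _).3, tsum_mul_right] at this
    exact this.tsum_eq.symm

lemma tsum {ι : Type*} {F : ι → ℝ → ℂ} {b : ι → ℝ} {T : ι → ℂ}
    (hw : w.re = 3) (hF : ∀ i, HasPowIntegral (F i) w (T i)) (hb : Summable b)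
    (hFb : ∀ i, ∀ x ∈ Set.Ioi (1 : ℝ), ‖F i x‖ ≤ b i * x) :
    HasPowIntegral (fun x => ∑' i, F i x) w (∑' i, T i) := by
  have : Countable (Function.support b) := hb.countable_support.to_subtype
  have h0 : ∀ i, b i = 0 → ∀ x ∈ Set.Ioi (1 : ℝ), F i x = 0 := fun i hi x hx => by
    have := hFb i x hx
    rw [hi, zero_mul] at this
    exact norm_le_zero_iff.mp this
  have hT : ∀ i, b i = 0 → T i = 0 := fun i hi => by
    rw [← (hF i).3]
    exact MeasureTheory.setIntegral_eq_zero_of_forall_eq_zero fun x hx => by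
      rw [h0 i hi x hx, zero_mul]
  have key := tsum_of_countable (ι := Function.support b) hw (fun i => hF i)
    (hb.subtype _) (fun i => hFb i)
  refine key.congr (fun x hx => ?_) ?_
  · exact (tsum_subtype_eq_of_support_subset (f := fun i => F i x) fun i hi hbi =>
      hi (h0 i hbi x hx)).symm
  · exact (tsum_subtype_eq_of_support_subset (f := T) fun i hi hbi => hi (hT i hbi)).symm

lemma log (hw : w.re = 3) :
    HasPowIntegral (fun x => (Real.log x : ℂ)) w (1 / (w - 1) ^ 2) := by
  have hne : (1 - w) ≠ 0 := fun h0 => by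
    have := congrArg Complex.re h0
    simp at this; linarith
  have hc : ContinuousOn (fun x : ℝ => (Real.log x : ℂ)) (Set.Ioi 1) := fun x hx =>
    (Complex.continuous_ofReal.continuousAt.comp
      (Real.continuousAt_log (zero_lt_one.trans hx).ne')).continuousWithinAt
  have hb : ∀ x ∈ Set.Ioi (1 : ℝ), ‖(Real.log x : ℂ)‖ ≤ 1 * x := fun x hx => by
    have hx : 1 < x := hx
    rw [Complex.norm_real, Real.norm_of_nonneg (Real.log_nonneg hx.le)]
    linarith [Real.log_le_sub_one_of_pos (zero_lt_one.trans hx)]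
  have hi := integrable_of_bound hw hc hb
  refine ⟨hc, hi, ?_⟩
  have hd : ∀ x : ℝ, 0 < x → HasDerivAt (fun x : ℝ => (x : ℂ) ^ (1 - w) *
      ((Real.log x : ℂ) / (1 - w) - 1 / (1 - w) ^ 2)) ((Real.log x : ℂ) * (x : ℂ) ^ (-w)) x := by
    intro x hx
    have hx' : (x : ℂ) ≠ 0 := by exact_mod_cast hx.ne'
    have h1 : HasDerivAt (fun x : ℝ => (x : ℂ) ^ (1 - w)) ((1 - w) * (x : ℂ) ^ (1 - w - 1)) x := by
      have := (hasDerivAt_id (x : ℂ)).cpow_const (c := 1 - w) (Or.inl (by simpa using hx))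
      simpa using this.comp_ofReal
    have h2 : HasDerivAt (fun x : ℝ => ((Real.log x : ℂ) / (1 - w) - 1 / (1 - w) ^ 2))
        (((x⁻¹ : ℝ) : ℂ) / (1 - w)) x :=
      (((Real.hasDerivAt_log hx.ne').ofReal_comp).div_const _).sub_const _
    refine (h1.mul h2).congr_deriv ?_
    have e : (x : ℂ) ^ (1 - w) = x * (x : ℂ) ^ (-w) := by
      rw [sub_eq_add_neg, Complex.cpow_add _ _ hx', Complex.cpow_one]
    rw [e, show 1 - w - 1 = -w by ring]
    push_cast
    field_simp
    ring
  have ht : Tendsto (fun x : ℝ => (x : ℂ) ^ (1 - w) *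
      ((Real.log x : ℂ) / (1 - w) - 1 / (1 - w) ^ 2)) atTop (nhds 0) := by
    rw [tendsto_zero_iff_norm_tendsto_zero]
    have hb2 : Tendsto (fun x : ℝ => (‖1 / (1 - w)‖ + ‖1 / (1 - w) ^ 2‖) * x ^ (-1 : ℝ)) atTop
        (nhds ((‖1 / (1 - w)‖ + ‖1 / (1 - w) ^ 2‖) * 0)) :=
      (tendsto_rpow_neg_atTop (by norm_num)).const_mul _
    rw [mul_zero] at hb2
    refine squeeze_zero' (Eventually.of_forall fun _ => norm_nonneg _) ?_ hb2
    filter_upwards [eventually_gt_atTop 1] with x hx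
    have hx0 : 0 < x := by linarith
    rw [norm_mul, Complex.norm_cpow_eq_rpow_re_of_pos hx0]
    have e1 : (1 - w).re = -1 + -1 := by simp [hw]; norm_num
    rw [e1, Real.rpow_add hx0]
    have e2 : ‖(Real.log x : ℂ) / (1 - w) - 1 / (1 - w) ^ 2‖ ≤
        (‖1 / (1 - w)‖ + ‖1 / (1 - w) ^ 2‖) * x := by
      calc _ ≤ ‖(Real.log x : ℂ) / (1 - w)‖ + ‖1 / (1 - w) ^ 2‖ := norm_sub_le _ _
        _ = ‖(Real.log x : ℂ)‖ * ‖1 / (1 - w)‖ + ‖1 / (1 - w) ^ 2‖ * 1 := by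
            rw [← norm_mul, mul_one_div, mul_one]
        _ ≤ (1 * x) * ‖1 / (1 - w)‖ + ‖1 / (1 - w) ^ 2‖ * x := by
            gcongr; exact hb x hx
        _ = _ := by ring
    calc x ^ (-1 : ℝ) * x ^ (-1 : ℝ) * _ ≤ x ^ (-1 : ℝ) * x ^ (-1 : ℝ) *
        ((‖1 / (1 - w)‖ + ‖1 / (1 - w) ^ 2‖) * x) := by gcongr
      _ = _ := by
        rw [Real.rpow_neg_one]; field_simp
  rw [MeasureTheory.integral_Ioi_of_hasDerivAt_of_tendsto
    (hd 1 one_pos).continuousAt.continuousWithinAt (fun x hx => hd x (zero_lt_one.trans hx)) hi ht]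
  have : w - 1 ≠ 0 := fun h => hne (by linear_combination -h)
  simp
  rw [← neg_sub w 1]; ring

/-- The integral transform is injective on continuous functions. -/
lemma eq_zero (h : ∀ w : ℂ, w.re = 3 → HasPowIntegral f w 0) {x : ℝ} (hx : 1 < x) : f x = 0 := by
  set F : ℝ → ℂ := (Set.Ioi (1 : ℝ)).indicator f with hF
  have e : ∀ s : ℂ, (fun t : ℝ => (t : ℂ) ^ (s - 1) • F t) =
      (Set.Ioi (1 : ℝ)).indicator fun t => f t * (t : ℂ) ^ (-(1 - s)) := by
    intro s; ext t
    by_cases ht : t ∈ Set.Ioi (1 : ℝ)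
    · simp [hF, ht, mul_comm]
    · simp [hF, ht]
  have hm : ∀ s : ℂ, s.re = -2 → mellin F s = 0 := fun s hs => by
    have := h (1 - s) (by simp [hs]; norm_num)
    rw [mellin, e, MeasureTheory.setIntegral_indicator measurableSet_Ioi,
      Set.inter_eq_right.mpr (Set.Ioi_subset_Ioi zero_le_one), this.3]
  have hv : (fun y : ℝ => mellin F (((-2 : ℝ) : ℂ) + y * Complex.I)) = fun _ => 0 := by
    ext y; exact hm _ (by simp)
  have h1 := mellinInv_mellin_eq (-2) F (zero_lt_one.trans hx) (by
      have := h (1 - ((-2 : ℝ) : ℂ)) (by simp; norm_num)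
      rw [MellinConvergent, e]
      exact ((MeasureTheory.integrable_indicator_iff measurableSet_Ioi).mpr this.2).integrableOn)
    (by rw [Complex.VerticalIntegrable, hv]; exact MeasureTheory.integrable_zero _ _ _)
    (by
      have := (h 3 (by simp)).1.continuousAt (Ioi_mem_nhds hx)
      refine this.congr ?_
      filter_upwards [Ioi_mem_nhds hx] with t ht
      simp [hF, Set.indicator_of_mem (show t ∈ Set.Ioi (1:ℝ) from ht)])
  have h2 : mellinInv (-2) (mellin F) x = 0 := by
    rw [mellinInv]
    have : ∀ y : ℝ, mellin F (((-2 : ℝ) : ℂ) + y * Complex.I) = 0 := fun y => congrFun hv y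
    simp only [this]
    simp
  rw [h2] at h1
  rw [hF, Set.indicator_of_mem (show x ∈ Set.Ioi (1:ℝ) from hx)] at h1
  exact h1.symm

end HasPowIntegral

lemma hasPowIntegral_max_sub {w : ℂ} (hw : w.re = 3) {n : ℕ} (hn : n ≠ 0) :
    HasPowIntegral (fun x => ((max (1 / (n : ℝ) - 1 / x) 0 : ℝ) : ℂ)) w
      ((n : ℂ) ^ (-w) / (w * (w - 1))) := by
  have hn1 : (1 : ℝ) ≤ n := by exact_mod_cast Nat.one_le_iff_ne_zero.mpr hn
  have hn0 : (0 : ℝ) < n := by linarith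
  have hc : ContinuousOn (fun x : ℝ => ((max (1 / (n : ℝ) - 1 / x) 0 : ℝ) : ℂ)) (Set.Ioi 1) := by
    intro x hx
    have hx0 : x ≠ 0 := (zero_lt_one.trans hx).ne'
    refine ContinuousAt.continuousWithinAt (Complex.continuous_ofReal.continuousAt.comp ?_)
    exact (continuousAt_const.sub (continuousAt_const.div continuousAt_id hx0)).max
      continuousAt_const
  have hb : ∀ x ∈ Set.Ioi (1 : ℝ), ‖((max (1 / (n : ℝ) - 1 / x) 0 : ℝ) : ℂ)‖ ≤ 1 * x := by
    intro x hx
    have hx : 1 < x := hx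
    rw [Complex.norm_real, Real.norm_of_nonneg (le_max_right _ _)]
    have h1 : 1 / (n : ℝ) ≤ 1 := by rw [div_le_one hn0]; exact hn1
    have h2 : 0 ≤ 1 / x := by positivity
    exact max_le (by linarith) (by linarith)
  refine ⟨hc, HasPowIntegral.integrable_of_bound hw hc hb, ?_⟩
  have e : Set.EqOn (fun x : ℝ => ((max (1 / (n : ℝ) - 1 / x) 0 : ℝ) : ℂ) * (x : ℂ) ^ (-w))
      ((Set.Ioi (n : ℝ)).indicator fun x : ℝ => (1 / (n : ℂ)) * (x : ℂ) ^ (-w) - (x : ℂ) ^ (-w - 1))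
      (Set.Ioi 1) := by
    intro x hx
    have hx0 : 0 < x := zero_lt_one.trans hx
    have hxc : (x : ℂ) ≠ 0 := by exact_mod_cast hx0.ne'
    simp only
    by_cases h : x ∈ Set.Ioi (n : ℝ)
    · rw [Set.indicator_of_mem h, max_eq_left, Complex.cpow_sub _ _ hxc, Complex.cpow_one]
      · push_cast; ring
      · have := one_div_le_one_div_of_le hn0 (le_of_lt h)
        linarith
    · rw [Set.indicator_of_notMem h, max_eq_right]
      · simp
      · have := one_div_le_one_div_of_le hx0 (not_lt.mp h)
        linarith
  have hre1 : (-w).re < -1 := by simp [hw]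
  have hre2 : (-w - 1).re < -1 := by simp [hw]; norm_num
  have hw0 : w ≠ 0 := fun h => by simp [h] at hw
  have hw1 : w - 1 ≠ 0 := fun h => by
    have := congrArg Complex.re h
    simp [hw] at this; norm_num at this
  have hnc : (n : ℂ) ≠ 0 := by exact_mod_cast hn
  rw [MeasureTheory.setIntegral_congr_fun measurableSet_Ioi e,
    MeasureTheory.setIntegral_indicator measurableSet_Ioi,
    Set.inter_eq_right.mpr (Set.Ioi_subset_Ioi hn1),
    MeasureTheory.integral_sub ((integrableOn_Ioi_cpow_of_lt hre1 hn0).const_mul _)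
      (integrableOn_Ioi_cpow_of_lt hre2 hn0), MeasureTheory.integral_const_mul,
    integral_Ioi_cpow_of_lt hre1 hn0, integral_Ioi_cpow_of_lt hre2 hn0]
  have h1 : -w + 1 ≠ 0 := fun h => hw1 (by linear_combination -h)
  push_cast
  rw [Complex.cpow_add _ _ hnc, Complex.cpow_one, show -w - 1 + 1 = -w by ring]
  rw [show -w + 1 = -(w - 1) by ring]
  field_simp
  ring

lemma max_one_div_sub_le {n : ℕ} {x : ℝ} (hx : 1 < x) :
    max (1 / (n : ℝ) - 1 / x) 0 ≤ 1 / (n : ℝ) ^ 2 * x := by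
  have h0 : 0 < x := by linarith
  refine max_le ?_ (by positivity)
  rcases Nat.eq_zero_or_pos n with rfl | hn
  · simp; exact h0.le
  have hn : (0 : ℝ) < n := by exact_mod_cast hn
  rw [div_sub_div _ _ hn.ne' h0.ne', one_div_mul_eq_div, div_le_div_iff₀ (by positivity) (by positivity)]
  nlinarith [mul_pos hn h0, sq_nonneg (x - n), mul_pos (mul_pos hn h0) hn]

lemma summable_vonMangoldt_div_sq :
    Summable fun n : ℕ => ArithmeticFunction.vonMangoldt n * (1 / (n : ℝ) ^ 2) := by
  have h := (hasSum_vonMangoldt (s := 2) (by norm_num)).summable.norm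
  refine h.congr fun n => ?_
  rcases Nat.eq_zero_or_pos n with rfl | hn
  · simp
  rw [LSeries.term_of_ne_zero hn.ne', norm_div, Complex.norm_real,
    Real.norm_of_nonneg ArithmeticFunction.vonMangoldt_nonneg]
  have : (n : ℂ) ^ (2 : ℂ) = (n : ℂ) ^ 2 := by exact_mod_cast Complex.cpow_natCast (n : ℂ) 2
  rw [this]
  simp [div_eq_mul_inv]

lemma hasPowIntegral_vonMangoldt {w : ℂ} (hw : w.re = 3) :
    HasPowIntegral (fun x => ∑' n : ℕ, (ArithmeticFunction.vonMangoldt n : ℂ) *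
      ((max (1 / (n : ℝ) - 1 / x) 0 : ℝ) : ℂ)) w (-logDeriv riemannZeta w / (w * (w - 1))) := by
  have hs := hasSum_vonMangoldt (s := w) (by linarith)
  have key := HasPowIntegral.tsum (w := w)
    (F := fun (n : ℕ) x => (ArithmeticFunction.vonMangoldt n : ℂ) *
      ((max (1 / (n : ℝ) - 1 / x) 0 : ℝ) : ℂ))
    (b := fun n : ℕ => ArithmeticFunction.vonMangoldt n * (1 / (n : ℝ) ^ 2))
    (T := fun n => LSeries.term (fun n => (ArithmeticFunction.vonMangoldt n : ℂ)) w n / (w * (w - 1)))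
    hw (fun n => ?_) summable_vonMangoldt_div_sq (fun n x hx => ?_)
  · rw [tsum_div_const, hs.tsum_eq] at key
    exact key
  · rcases Nat.eq_zero_or_pos n with rfl | hn
    · refine ((HasPowIntegral.one (w := w) (by linarith)).const_mul 0).congr (fun x _ => by simp)
        (by simp)
    refine ((hasPowIntegral_max_sub hw hn.ne').const_mul _).congr (fun x _ => rfl) ?_
    rw [LSeries.term_of_ne_zero hn.ne', Complex.cpow_neg]
    ring
  · rw [norm_mul, Complex.norm_real, Complex.norm_real,
      Real.norm_of_nonneg ArithmeticFunction.vonMangoldt_nonneg,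
      Real.norm_of_nonneg (le_max_right _ _), mul_assoc]
    exact mul_le_mul_of_nonneg_left (max_one_div_sub_le hx) ArithmeticFunction.vonMangoldt_nonneg

lemma norm_cpow_le_one {x : ℝ} {a : ℂ} (hx : 1 < x) (ha : a.re ≤ 0) : ‖(x : ℂ) ^ a‖ ≤ 1 := by
  rw [Complex.norm_cpow_eq_rpow_re_of_pos (by linarith)]
  exact Real.rpow_le_one_of_one_le_of_nonpos hx.le ha

lemma norm_inv_mul_one_sub_le {ρ : ℂ} (h : riemannXi ρ = 0) :
    ‖1 / (ρ * (1 - ρ))‖ ≤ 1 / ρ.im ^ 2 := by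
  have h0 : 0 < ρ.im ^ 2 := by linarith [le_im_sq_of_riemannXi_eq_zero h]
  rw [norm_div, norm_one, norm_mul]
  refine one_div_le_one_div_of_le h0 ?_
  have h1 := Complex.abs_im_le_norm ρ
  have h2 := Complex.abs_im_le_norm (1 - ρ)
  simp only [Complex.sub_im, Complex.one_im, zero_sub, abs_neg] at h2
  rw [← sq_abs, sq]
  gcongr

lemma hasPowIntegral_xi_term {w ρ : ℂ} (hw : w.re = 3) :
    HasPowIntegral (fun x => (xiMult ρ : ℂ) * (1 / (ρ * (1 - ρ)) *
        (1 + 1 / (x : ℂ) - (x : ℂ) ^ (ρ - 1) - (x : ℂ) ^ (-ρ)))) w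
      ((xiMult ρ : ℂ) * (1 / (w - ρ) + 1 / (w - 1 + ρ)) / (w * (w - 1))) := by
  by_cases hm : riemannXi ρ = 0
  swap
  · rw [xiMult_eq_zero hm]
    exact ((HasPowIntegral.one (w := w) (by linarith)).const_mul 0).congr (fun x _ => by simp)
        (by simp)
  obtain ⟨h0, h1⟩ := re_mem_Ioo_of_riemannXi_eq_zero hm
  have hP := HasPowIntegral.cpow (a := ρ) (w := w) (by linarith)
  have hQ := HasPowIntegral.cpow (a := 1 - ρ) (w := w) (by simp; linarith)
  have hA := HasPowIntegral.one (w := w) (by linarith)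
  have hB := HasPowIntegral.inv (w := w) (by linarith)
  refine (((((hA.add hB).sub hP).sub hQ).const_mul (1 / (ρ * (1 - ρ)))).const_mul (xiMult ρ : ℂ)).congr (fun x _ => ?_) ?_
  · rw [show 1 - ρ - 1 = -ρ by ring]
  have n1 : w ≠ 0 := fun h => by simp [h] at hw
  have n2 : w - 1 ≠ 0 := fun h => by
    have := congrArg Complex.re h
    simp [hw] at this; norm_num at this
  have n3 : ρ ≠ 0 := fun h => by simp [h] at h0
  have n4 : 1 - ρ ≠ 0 := fun h => by
    have := congrArg Complex.re h
    simp at this; linarith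
  have n5 : w - ρ ≠ 0 := fun h => by
    have := congrArg Complex.re h
    simp [hw] at this; linarith
  have n6 : w - (1 - ρ) ≠ 0 := fun h => by
    have := congrArg Complex.re h
    simp [hw] at this; linarith
  rw [show w - 1 + ρ = w - (1 - ρ) by ring]
  field_simp
  ring

lemma norm_xi_term_le {x : ℝ} {ρ : ℂ} (hx : 1 < x) :
    ‖(xiMult ρ : ℂ) * (1 / (ρ * (1 - ρ)) *
        (1 + 1 / (x : ℂ) - (x : ℂ) ^ (ρ - 1) - (x : ℂ) ^ (-ρ)))‖ ≤
      4 * (xiMult ρ / ρ.im ^ 2) * x := by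
  by_cases hm : riemannXi ρ = 0
  swap
  · rw [xiMult_eq_zero hm]; simp
  obtain ⟨h0, h1⟩ := re_mem_Ioo_of_riemannXi_eq_zero hm
  have hq := norm_inv_mul_one_sub_le hm
  have hb : ‖(1 + 1 / (x : ℂ) - (x : ℂ) ^ (ρ - 1) - (x : ℂ) ^ (-ρ))‖ ≤ 4 := by
    have e1 := norm_cpow_le_one (a := ρ - 1) hx (by simp; linarith)
    have e2 := norm_cpow_le_one (a := -ρ) hx (by simp; linarith)
    have e3 : ‖1 / (x : ℂ)‖ ≤ 1 := by
      rw [norm_div, norm_one, Complex.norm_real, Real.norm_of_nonneg (by linarith),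
        div_le_one (by linarith)]
      exact hx.le
    have e4 := norm_add_le (1 : ℂ) (1 / (x : ℂ))
    have e5 := norm_sub_le (1 + 1 / (x : ℂ)) ((x : ℂ) ^ (ρ - 1))
    have e6 := norm_sub_le (1 + 1 / (x : ℂ) - (x : ℂ) ^ (ρ - 1)) ((x : ℂ) ^ (-ρ))
    rw [norm_one] at e4
    linarith
  rw [norm_mul, norm_mul, Complex.norm_real, Real.norm_of_nonneg (xiMult_nonneg ρ)]
  calc xiMult ρ * (‖1 / (ρ * (1 - ρ))‖ * _) ≤ xiMult ρ * (1 / ρ.im ^ 2 * 4) := by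
        gcongr; exact xiMult_nonneg ρ
    _ = 4 * (xiMult ρ / ρ.im ^ 2) * 1 := by ring
    _ ≤ _ := by
      gcongr
      exact mul_nonneg (by norm_num) (div_nonneg (xiMult_nonneg _) (sq_nonneg _))

lemma hasPowIntegral_xi {w : ℂ} (hw : w.re = 3) :
    HasPowIntegral (fun x => ∑' ρ : ℂ, (xiMult ρ : ℂ) * (1 / (ρ * (1 - ρ)) *
        (1 + 1 / (x : ℂ) - (x : ℂ) ^ (ρ - 1) - (x : ℂ) ^ (-ρ)))) w
      (2 * logDeriv riemannXi w / (w * (w - 1))) := by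
  have hs := hasSum_logDeriv_riemannXi (s := w) (riemannXi_ne_zero_of_one_le_re (by linarith))
  have key := HasPowIntegral.tsum (w := w) hw (fun ρ => hasPowIntegral_xi_term (ρ := ρ) hw)
    (summable_xiMult_div_im_sq.mul_left 4) (fun ρ x hx => norm_xi_term_le hx)
  rwa [tsum_div_const, hs.tsum_eq] at key

lemma summable_one_div_two_mul : Summable fun n : ℕ => 1 / ((2 * (n : ℝ) + 2) * (2 * n + 3)) := by
  refine Summable.of_nonneg_of_le (fun n => by positivity) (fun n => ?_)
    ((summable_nat_add_iff 1).mpr (Real.summable_one_div_nat_pow.mpr one_lt_two))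
  push_cast
  refine one_div_le_one_div_of_le (by positivity) ?_
  nlinarith [(Nat.cast_nonneg n : (0 : ℝ) ≤ n)]

lemma trivialZeros_partialFraction (q d m w v : ℂ) (hq : q ≠ 0) (hd : d ≠ 0) (hm : m ≠ 0)
    (hw : w ≠ 0) (hv : v ≠ 0) (h1 : d = w + 2 * q) (h2 : m = 2 * q + 1) (h3 : v = w - 1) :
    (1 / q - 1 / (d / 2)) / 2 / (w * v) = 1 / (2 * q * m) * (1 / v - 1 / d) := by
  field_simp
  subst h1 h2 h3
  ring

lemma hasPowIntegral_trivialZeros {w : ℂ} (hw : w.re = 3) :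
    HasPowIntegral (fun x => ∑' n : ℕ, ((1 / ((2 * (n : ℝ) + 2) * (2 * n + 3)) : ℝ) : ℂ) *
        (1 - (x : ℂ) ^ (-(2 * (n : ℂ) + 3)))) w
      (((w / 2 + 1).digamma + Real.eulerMascheroniConstant) / 2 / (w * (w - 1))) := by
  have hs := hasSum_digamma (s := w / 2 + 1) (by simp [hw]; norm_num)
  have n1 : w ≠ 0 := fun h => by simp [h] at hw
  have n2 : w - 1 ≠ 0 := fun h => by
    have := congrArg Complex.re h
    simp [hw] at this; norm_num at this
  have key := HasPowIntegral.tsum (w := w)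
    (F := fun (n : ℕ) x => ((1 / ((2 * (n : ℝ) + 2) * (2 * n + 3)) : ℝ) : ℂ) *
        (1 - (x : ℂ) ^ (-(2 * (n : ℂ) + 3))))
    (b := fun n : ℕ => 2 * (1 / ((2 * (n : ℝ) + 2) * (2 * n + 3))))
    (T := fun n : ℕ => (1 / ((n : ℂ) + 1) - 1 / ((n : ℂ) + (w / 2 + 1))) / 2 / (w * (w - 1)))
    hw (fun n => ?_) (summable_one_div_two_mul.mul_left 2) (fun n x hx => ?_)
  · simp_rw [tsum_div_const] at key
    rw [hs.tsum_eq] at key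
    exact key
  · have hP := HasPowIntegral.cpow (a := -(2 * (n : ℂ) + 2)) (w := w) (by
      simp [hw]; linarith [(Nat.cast_nonneg n : (0 : ℝ) ≤ n)])
    have hA := HasPowIntegral.one (w := w) (by linarith)
    refine ((hA.sub hP).const_mul ((1 / ((2 * (n : ℝ) + 2) * (2 * n + 3)) : ℝ) : ℂ)).congr (fun x _ => ?_) ?_
    · rw [show -(2 * (n : ℂ) + 2) - 1 = -(2 * (n : ℂ) + 3) by ring]
    have hpos : ∀ c : ℝ, 0 < c → ∀ d : ℂ, d.re = c → d ≠ 0 := fun c hc d hd h => by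
      rw [h] at hd; simp at hd; linarith
    have hn := (Nat.cast_nonneg n : (0 : ℝ) ≤ n)
    have m1 : (n : ℂ) + 1 ≠ 0 := hpos (n + 1) (by positivity) _ (by simp)
    have m2 : (n : ℂ) + (w / 2 + 1) ≠ 0 :=
      hpos (n + 5 / 2) (by positivity) _ (by simp [hw]; norm_num)
    have m3 : 2 * (n : ℂ) + 3 ≠ 0 := hpos (2 * n + 3) (by positivity) _ (by simp)
    have m4 : w + 2 * ((n : ℂ) + 1) ≠ 0 := hpos (2 * n + 5) (by positivity) _ (by
      simp [hw]; ring)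
    rw [show (n : ℂ) + (w / 2 + 1) = (w + 2 * ((n : ℂ) + 1)) / 2 by ring,
      show w - -(2 * (n : ℂ) + 2) = w + 2 * ((n : ℂ) + 1) by ring]
    push_cast
    rw [show 2 * (n : ℂ) + 2 = 2 * ((n : ℂ) + 1) by ring]
    exact (trivialZeros_partialFraction _ _ _ _ _ m1 m4 m3 n1 n2 rfl (by ring) rfl)
  · have hx : 1 < x := hx
    rw [norm_mul, Complex.norm_real, Real.norm_of_nonneg (by positivity)]
    have e1 := norm_cpow_le_one (a := -(2 * (n : ℂ) + 3)) hx (by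
      simp; linarith [(Nat.cast_nonneg n : (0 : ℝ) ≤ n)])
    have e2 := norm_sub_le (1 : ℂ) ((x : ℂ) ^ (-(2 * (n : ℂ) + 3)))
    rw [norm_one] at e2
    calc _ ≤ 1 / ((2 * (n : ℝ) + 2) * (2 * n + 3)) * 2 := by gcongr; linarith
      _ = 2 * (1 / ((2 * (n : ℝ) + 2) * (2 * n + 3))) * 1 := by ring
      _ ≤ _ := by gcongr

/-- The explicit formula for `∑ Λ(n) max(1/n - 1/x, 0)`. -/
theorem tsum_vonMangoldt_max_eq {x : ℝ} (hx : 1 < x) :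
    (∑' n : ℕ, (ArithmeticFunction.vonMangoldt n : ℂ) * ((max (1 / (n : ℝ) - 1 / x) 0 : ℝ) : ℂ)) =
      ((Real.log x : ℂ) - 1 + 1 / x) -
      (Real.log Real.pi / 2 + Real.eulerMascheroniConstant / 2 : ℂ) * (1 - 1 / x) +
      (∑' n : ℕ, ((1 / ((2 * (n : ℝ) + 2) * (2 * n + 3)) : ℝ) : ℂ) *
        (1 - (x : ℂ) ^ (-(2 * (n : ℂ) + 3)))) -
      1 / 2 * (∑' ρ : ℂ, (xiMult ρ : ℂ) * (1 / (ρ * (1 - ρ)) *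
        (1 + 1 / (x : ℂ) - (x : ℂ) ^ (ρ - 1) - (x : ℂ) ^ (-ρ)))) := by
  rw [← sub_eq_zero]
  refine HasPowIntegral.eq_zero (f := fun x : ℝ =>
    (∑' n : ℕ, (ArithmeticFunction.vonMangoldt n : ℂ) * ((max (1 / (n : ℝ) - 1 / x) 0 : ℝ) : ℂ)) -
      (((Real.log x : ℂ) - 1 + 1 / x) -
      (Real.log Real.pi / 2 + Real.eulerMascheroniConstant / 2 : ℂ) * (1 - 1 / x) +
      (∑' n : ℕ, ((1 / ((2 * (n : ℝ) + 2) * (2 * n + 3)) : ℝ) : ℂ) *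
        (1 - (x : ℂ) ^ (-(2 * (n : ℂ) + 3)))) -
      1 / 2 * (∑' ρ : ℂ, (xiMult ρ : ℂ) * (1 / (ρ * (1 - ρ)) *
        (1 + 1 / (x : ℂ) - (x : ℂ) ^ (ρ - 1) - (x : ℂ) ^ (-ρ)))))) (fun w hw => ?_) hx
  have hA := HasPowIntegral.one (w := w) (by linarith)
  have hB := HasPowIntegral.inv (w := w) (by linarith)
  refine ((hasPowIntegral_vonMangoldt hw).sub ((((((HasPowIntegral.log hw).sub hA).add hB).sub
    ((hA.sub hB).const_mul _)).add (hasPowIntegral_trivialZeros hw)).sub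
    ((hasPowIntegral_xi hw).const_mul _))).congr (fun x _ => rfl) ?_
  have n1 : w ≠ 0 := fun h => by simp [h] at hw
  have n2 : w - 1 ≠ 0 := fun h => by
    have := congrArg Complex.re h
    simp [hw] at this; norm_num at this
  rw [logDeriv_riemannXi_eq (by linarith : 1 < w.re)]
  field_simp
  ring

/-- The summand of the sum over zeros in the explicit formula. -/
noncomputable def xiOscTerm (ρ : ℂ) (u : ℝ) : ℝ :=
  xiMult ρ * (1 / (ρ * (1 - ρ)) * (Complex.exp ((ρ - 1) * u) + Complex.exp (-ρ * u))).re

/-- A primitive of `xiOscTerm`. -/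
noncomputable def xiOscTermInt (ρ : ℂ) (u : ℝ) : ℝ :=
  xiMult ρ * (1 / (ρ * (1 - ρ)) * (Complex.exp ((ρ - 1) * u) / (ρ - 1) -
    Complex.exp (-ρ * u) / ρ)).re

lemma norm_cexp_mul_ofReal (a : ℂ) (u : ℝ) : ‖Complex.exp (a * u)‖ = Real.exp (a.re * u) := by
  rw [Complex.norm_exp]; simp

lemma exp_add_exp_le {β u : ℝ} (h0 : 0 < β) (h1 : β < 1) (hu : 0 < u) :
    Real.exp ((β - 1) * u) + Real.exp (-β * u) ≤ 1 + Real.exp (-u) := by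
  have e : Real.exp (-u) = Real.exp ((β - 1) * u) * Real.exp (-β * u) := by
    rw [← Real.exp_add]; ring_nf
  have a1 : Real.exp ((β - 1) * u) ≤ 1 := Real.exp_le_one_iff.mpr (by nlinarith)
  have a2 : Real.exp (-β * u) ≤ 1 := Real.exp_le_one_iff.mpr (by nlinarith)
  rw [e]; nlinarith

lemma abs_xiOscTerm_le {ρ : ℂ} {u B : ℝ}
    (hB : riemannXi ρ = 0 → Real.exp ((ρ.re - 1) * u) + Real.exp (-ρ.re * u) ≤ B) :
    |xiOscTerm ρ u| ≤ xiMult ρ / ρ.im ^ 2 * B := by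
  by_cases hm : riemannXi ρ = 0
  swap
  · simp [xiOscTerm, xiMult_eq_zero hm]
  rw [xiOscTerm, abs_mul, abs_of_nonneg (xiMult_nonneg ρ),
    show xiMult ρ / ρ.im ^ 2 * B = xiMult ρ * (1 / ρ.im ^ 2 * B) by ring]
  refine mul_le_mul_of_nonneg_left ((Complex.abs_re_le_norm _).trans ?_) (xiMult_nonneg ρ)
  rw [norm_mul]
  have h2 : ‖Complex.exp ((ρ - 1) * u) + Complex.exp (-ρ * u)‖ ≤ B := by
    refine (norm_add_le _ _).trans ?_
    rw [norm_cexp_mul_ofReal, norm_cexp_mul_ofReal]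
    simpa using hB hm
  exact mul_le_mul (norm_inv_mul_one_sub_le hm) h2 (norm_nonneg _) (by positivity)

lemma abs_xiOscTerm_le_one_add {ρ : ℂ} {u : ℝ} (hu : 0 < u) :
    |xiOscTerm ρ u| ≤ xiMult ρ / ρ.im ^ 2 * (1 + Real.exp (-u)) :=
  abs_xiOscTerm_le fun hm =>
    have h := re_mem_Ioo_of_riemannXi_eq_zero hm
    exp_add_exp_le h.1 h.2 hu

lemma abs_tsum_xiOscTerm_le {u : ℝ} (hu : 0 < u) :
    |∑' ρ, xiOscTerm ρ u| ≤ 0.0476 * (1 + Real.exp (-u)) := by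
  have hs := summable_xiMult_div_im_sq.mul_right (1 + Real.exp (-u))
  rw [← Real.norm_eq_abs]
  calc _ ≤ ∑' ρ : ℂ, xiMult ρ / ρ.im ^ 2 * (1 + Real.exp (-u)) :=
        tsum_of_norm_bounded hs.hasSum fun _ => abs_xiOscTerm_le_one_add hu
    _ ≤ _ := by
        rw [tsum_mul_right]
        exact mul_le_mul_of_nonneg_right tsum_xiMult_div_im_sq_le (by positivity)

lemma mul_exp_neg_mul_le {u d D : ℝ} (hd : 0 < d) (hD : 1 / d ≤ D) :
    u * Real.exp (-d * u) ≤ D * Real.exp (-1) := by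
  have h1 : d * u * Real.exp (-(d * u)) ≤ Real.exp (-1) := by
    have h := Real.add_one_le_exp (d * u - 1)
    have e : Real.exp (-1) = Real.exp (d * u - 1) * Real.exp (-(d * u)) := by
      rw [← Real.exp_add]; ring_nf
    rw [e]
    exact mul_le_mul_of_nonneg_right (by linarith) (Real.exp_pos _).le
  calc u * Real.exp (-d * u) = 1 / d * (d * u * Real.exp (-(d * u))) := by
        field_simp
    _ ≤ 1 / d * Real.exp (-1) := by gcongr
    _ ≤ _ := by gcongr

lemma abs_xiOscTerm_mul_le {ρ : ℂ} {u : ℝ} (hu : 0 < u) :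
    |u * xiOscTerm ρ u| ≤ (35 * (xiMult ρ * (Real.log |ρ.im| / ρ.im ^ 2)) -
      52.5 * (xiMult ρ / ρ.im ^ 2)) * Real.exp (-1) + xiMult ρ / ρ.im ^ 2 * (u * Real.exp (-u / 2)) := by
  have key := abs_xiOscTerm_le (ρ := ρ) (u := u)
    (B := (14 * (5 / 2 * Real.log |ρ.im| - 15 / 4) * Real.exp (-1) + u * Real.exp (-u / 2)) / u) ?_
  · rw [abs_mul, abs_of_pos hu]
    calc u * |xiOscTerm ρ u| ≤ u * _ := mul_le_mul_of_nonneg_left key hu.le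
      _ = _ := by field_simp; ring
  · intro hm
    obtain ⟨h0, h1⟩ := re_mem_Ioo_of_riemannXi_eq_zero hm
    rw [le_div_iff₀ hu]
    have z1 := one_div_one_sub_re_le hm
    have z2 := one_div_one_sub_re_le (ρ := 1 - ρ) (by rw [riemannXi_one_sub]; exact hm)
    simp only [Complex.sub_re, Complex.one_re, sub_sub_cancel, Complex.sub_im, Complex.one_im,
      zero_sub, abs_neg] at z2
    rcases le_total ρ.re (1 / 2) with h | h
    · have := mul_exp_neg_mul_le (u := u) h0 z2
      have h3 : Real.exp ((ρ.re - 1) * u) ≤ Real.exp (-u / 2) := Real.exp_le_exp.mpr (by nlinarith)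
      nlinarith
    · have := mul_exp_neg_mul_le (u := u) (d := 1 - ρ.re) (by linarith) z1
      rw [neg_sub] at this
      have h3 : Real.exp (-ρ.re * u) ≤ Real.exp (-u / 2) := Real.exp_le_exp.mpr (by nlinarith)
      nlinarith

lemma abs_mul_tsum_xiOscTerm_le {u : ℝ} (hu : 0 < u) :
    |u * ∑' ρ, xiOscTerm ρ u| ≤ 4.5955 * Real.exp (-1) + 0.0476 * (u * Real.exp (-u / 2)) := by
  have s1 := summable_xiMult_div_im_sq
  have s2 := summable_xiMult_mul_log
  have hs := (((s2.hasSum.mul_left 35).sub (s1.hasSum.mul_left 52.5)).mul_right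
    (Real.exp (-1))).add (s1.hasSum.mul_right (u * Real.exp (-u / 2)))
  rw [← tsum_mul_left, ← Real.norm_eq_abs]
  refine (tsum_of_norm_bounded hs fun _ => abs_xiOscTerm_mul_le hu).trans ?_
  refine add_le_add (mul_le_mul_of_nonneg_right ?_ (Real.exp_pos _).le)
    (mul_le_mul_of_nonneg_right tsum_xiMult_div_im_sq_le (by positivity))
  linarith [tsum_xiMult_mul_log_le, le_tsum_xiMult_div_im_sq]

lemma abs_xiOscTermInt_le {ρ : ℂ} {u : ℝ} (hu : 0 < u) :
    |xiOscTermInt ρ u| ≤ xiMult ρ / ρ.im ^ 2 * (2 / 6.48) := by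
  by_cases hm : riemannXi ρ = 0
  swap
  · simp [xiOscTermInt, xiMult_eq_zero hm]
  obtain ⟨h0, h1⟩ := re_mem_Ioo_of_riemannXi_eq_zero hm
  have him : 6.48 ≤ |ρ.im| := by
    refine abs_le_of_sq_le_sq' ?_ (abs_nonneg _) |>.2
    rw [sq_abs]
    linarith [le_im_sq_of_riemannXi_eq_zero hm]
  have n1 : 6.48 ≤ ‖ρ‖ := him.trans (Complex.abs_im_le_norm ρ)
  have n2 : 6.48 ≤ ‖ρ - 1‖ := him.trans (by simpa using Complex.abs_im_le_norm (ρ - 1))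
  rw [xiOscTermInt, abs_mul, abs_of_nonneg (xiMult_nonneg ρ),
    show xiMult ρ / ρ.im ^ 2 * (2 / 6.48) = xiMult ρ * (1 / ρ.im ^ 2 * (2 / 6.48)) by ring]
  refine mul_le_mul_of_nonneg_left ((Complex.abs_re_le_norm _).trans ?_) (xiMult_nonneg ρ)
  rw [norm_mul]
  have e1 : ‖Complex.exp ((ρ - 1) * u) / (ρ - 1)‖ ≤ 1 / 6.48 := by
    rw [norm_div, norm_cexp_mul_ofReal]
    have : Real.exp ((ρ - 1).re * u) ≤ 1 := Real.exp_le_one_iff.mpr (by simp; nlinarith)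
    gcongr
  have e2 : ‖Complex.exp (-ρ * u) / ρ‖ ≤ 1 / 6.48 := by
    rw [norm_div, norm_cexp_mul_ofReal]
    have : Real.exp ((-ρ).re * u) ≤ 1 := Real.exp_le_one_iff.mpr (by simp; nlinarith)
    gcongr
  refine mul_le_mul (norm_inv_mul_one_sub_le hm) ?_ (norm_nonneg _) (by positivity)
  refine (norm_sub_le _ _).trans ?_
  linarith

lemma hasDerivAt_xiOscTermInt (ρ : ℂ) (u : ℝ) :
    HasDerivAt (xiOscTermInt ρ) (xiOscTerm ρ u) u := by
  by_cases hm : riemannXi ρ = 0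
  swap
  · have : xiOscTermInt ρ = fun _ => 0 := by ext; simp [xiOscTermInt, xiMult_eq_zero hm]
    rw [this, xiOscTerm, xiMult_eq_zero hm, zero_mul]
    exact hasDerivAt_const _ _
  obtain ⟨h0, h1⟩ := re_mem_Ioo_of_riemannXi_eq_zero hm
  have n3 : ρ ≠ 0 := fun h => by simp [h] at h0
  have n4 : ρ - 1 ≠ 0 := fun h => by
    have := congrArg Complex.re h
    simp at this; linarith
  have hd : ∀ a : ℂ, a ≠ 0 → HasDerivAt (fun u : ℝ => Complex.exp (a * u) / a)
      (Complex.exp (a * u)) u := fun a ha => by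
    have := (((hasDerivAt_id (u : ℂ)).const_mul a).cexp.div_const a).comp_ofReal
    refine this.congr_deriv ?_
    simp; field_simp
  have hd2 := ((hd _ n4).add (hd (-ρ) (neg_ne_zero.mpr n3))).const_mul (1 / (ρ * (1 - ρ)))
  have hd3 := (Complex.reCLM.hasFDerivAt.comp_hasDerivAt u hd2).const_mul (xiMult ρ)
  refine hd3.congr_of_eventuallyEq (Eventually.of_forall fun v => ?_)
  simp only [xiOscTermInt, Function.comp, Complex.reCLM_apply, Pi.add_apply]
  rw [div_neg, ← sub_eq_add_neg]

lemma hasDerivAt_tsum_xiOscTermInt {u : ℝ} (hu : 0 < u) :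
    HasDerivAt (fun u => ∑' ρ, xiOscTermInt ρ u) (∑' ρ, xiOscTerm ρ u) u := by
  refine hasDerivAt_tsum_of_isPreconnected (t := Set.Ioi 0)
    (u := fun ρ => xiMult ρ / ρ.im ^ 2 * 2)
    (summable_xiMult_div_im_sq.mul_right 2) isOpen_Ioi isPreconnected_Ioi
    (fun ρ y _ => hasDerivAt_xiOscTermInt ρ y) (fun ρ y hy => ?_) hu ?_ hu
  · refine (abs_xiOscTerm_le_one_add hy).trans ?_
    have : Real.exp (-y) ≤ 1 := Real.exp_le_one_iff.mpr (by linarith [Set.mem_Ioi.mp hy])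
    have h2 := div_nonneg (xiMult_nonneg ρ) (sq_nonneg ρ.im)
    gcongr
    linarith
  · exact Summable.of_norm_bounded (summable_xiMult_div_im_sq.mul_right (2 / 6.48))
      fun _ => abs_xiOscTermInt_le hu

lemma abs_tsum_xiOscTermInt_le {u : ℝ} (hu : 0 < u) :
    |∑' ρ, xiOscTermInt ρ u| ≤ 0.0147 := by
  have hs := summable_xiMult_div_im_sq.mul_right (2 / 6.48)
  rw [← Real.norm_eq_abs]
  calc _ ≤ ∑' ρ : ℂ, xiMult ρ / ρ.im ^ 2 * (2 / 6.48) :=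
        tsum_of_norm_bounded hs.hasSum fun _ => abs_xiOscTermInt_le hu
    _ ≤ _ := by
        rw [tsum_mul_right]
        linarith [tsum_xiMult_div_im_sq_le]

/-- `∑ Λ(n) max(1/n - 1/x, 0) = ∫₁ˣ ψ(y) y⁻² dy`. -/
noncomputable def psiInt (x : ℝ) : ℝ :=
  ∑' n : ℕ, ArithmeticFunction.vonMangoldt n * max (1 / (n : ℝ) - 1 / x) 0

/-- Coefficients of the trivial zeros. -/
noncomputable def trivCoeff (n : ℕ) : ℝ := 1 / ((2 * (n : ℝ) + 2) * (2 * n + 3))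

noncomputable def xiCoeffSum : ℝ := ∑' ρ : ℂ, xiMult ρ * (1 / (ρ * (1 - ρ))).re

noncomputable def psiRemCoeff : ℝ :=
  1 + Real.log Real.pi / 2 + Real.eulerMascheroniConstant / 2 - xiCoeffSum / 2

/-- The error term in the explicit formula for `psiInt (exp u)`. -/
noncomputable def psiRem (u : ℝ) : ℝ :=
  psiRemCoeff * Real.exp (-u) - ∑' n, trivCoeff n * Real.exp (-(2 * (n : ℝ) + 3) * u) +
    (∑' ρ, xiOscTerm ρ u) / 2

/-- A primitive of `psiRem`. -/
noncomputable def psiRemInt (u : ℝ) : ℝ :=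
  -psiRemCoeff * Real.exp (-u) +
    ∑' n, trivCoeff n / (2 * (n : ℝ) + 3) * Real.exp (-(2 * (n : ℝ) + 3) * u) +
    (∑' ρ, xiOscTermInt ρ u) / 2

lemma trivCoeff_nonneg (n : ℕ) : 0 ≤ trivCoeff n := by rw [trivCoeff]; positivity

lemma summable_trivCoeff : Summable trivCoeff := summable_one_div_two_mul

lemma tsum_trivCoeff_le : ∑' n, trivCoeff n ≤ 1 := by
  have h := (hasSum_nat_add_iff' 1).mpr hasSum_zeta_two
  have hle : ∀ n, trivCoeff n ≤ 1 / ((n + 1 : ℕ) : ℝ) ^ 2 * (1 / 4) := fun n => by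
    rw [trivCoeff, div_mul_div_comm, one_mul]
    push_cast
    refine one_div_le_one_div_of_le (by positivity) ?_
    nlinarith [(Nat.cast_nonneg n : (0 : ℝ) ≤ n)]
  refine (summable_one_div_two_mul.tsum_le_tsum hle (h.mul_right (1 / 4)).summable).trans ?_
  rw [(h.mul_right (1 / 4)).tsum_eq]
  simp
  nlinarith [Real.pi_lt_d2, Real.pi_gt_three]

lemma exp_triv_le {u : ℝ} (hu : 0 < u) (n : ℕ) :
    Real.exp (-(2 * (n : ℝ) + 3) * u) ≤ Real.exp (-3 * u) := by
  refine Real.exp_le_exp.mpr ?_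
  nlinarith [(Nat.cast_nonneg n : (0 : ℝ) ≤ n)]

lemma exp_triv_le_one {u : ℝ} (hu : 0 < u) (n : ℕ) :
    Real.exp (-(2 * (n : ℝ) + 3) * u) ≤ 1 :=
  (exp_triv_le hu n).trans (Real.exp_le_one_iff.mpr (by linarith))

lemma summable_trivCoeff_mul {u : ℝ} (hu : 0 < u) :
    Summable fun n : ℕ => trivCoeff n * Real.exp (-(2 * (n : ℝ) + 3) * u) :=
  Summable.of_nonneg_of_le (fun n => mul_nonneg (trivCoeff_nonneg n) (Real.exp_pos _).le)
    (fun n => mul_le_of_le_one_right (trivCoeff_nonneg n) (exp_triv_le_one hu n))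
    summable_one_div_two_mul

lemma abs_tsum_trivCoeff_mul_le {u : ℝ} (hu : 0 < u) {c : ℕ → ℝ} (h0 : ∀ n, 0 ≤ c n)
    (h1 : ∀ n, c n ≤ trivCoeff n) :
    |∑' n : ℕ, c n * Real.exp (-(2 * (n : ℝ) + 3) * u)| ≤ Real.exp (-3 * u) := by
  have hs := (summable_trivCoeff.hasSum).mul_right (Real.exp (-3 * u))
  rw [← Real.norm_eq_abs]
  refine (tsum_of_norm_bounded hs fun n => ?_).trans
    (mul_le_of_le_one_left (Real.exp_pos _).le tsum_trivCoeff_le)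
  rw [norm_mul, Real.norm_of_nonneg (h0 n), Real.norm_of_nonneg (Real.exp_pos _).le]
  exact mul_le_mul (h1 n) (exp_triv_le hu n) (Real.exp_pos _).le (trivCoeff_nonneg n)

lemma abs_xiCoeff_le (ρ : ℂ) : ‖(xiMult ρ : ℂ) * (1 / (ρ * (1 - ρ)))‖ ≤ xiMult ρ / ρ.im ^ 2 := by
  by_cases hm : riemannXi ρ = 0
  swap
  · simp [xiMult_eq_zero hm]
  rw [norm_mul, Complex.norm_real, Real.norm_of_nonneg (xiMult_nonneg ρ),
    div_eq_mul_one_div (xiMult ρ)]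
  exact mul_le_mul_of_nonneg_left (norm_inv_mul_one_sub_le hm) (xiMult_nonneg ρ)

lemma summable_xiCoeff : Summable fun ρ : ℂ => (xiMult ρ : ℂ) * (1 / (ρ * (1 - ρ))) :=
  Summable.of_norm_bounded summable_xiMult_div_im_sq abs_xiCoeff_le

lemma re_tsum_xiCoeff :
    (∑' ρ : ℂ, (xiMult ρ : ℂ) * (1 / (ρ * (1 - ρ)))).re = xiCoeffSum := by
  rw [Complex.re_tsum summable_xiCoeff, xiCoeffSum]
  simp only [Complex.re_ofReal_mul]

lemma abs_xiCoeffSum_le : |xiCoeffSum| ≤ 0.0476 := by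
  rw [← re_tsum_xiCoeff]
  exact (Complex.abs_re_le_norm _).trans
    ((tsum_of_norm_bounded summable_xiMult_div_im_sq.hasSum abs_xiCoeff_le).trans
      tsum_xiMult_div_im_sq_le)

lemma abs_psiRemCoeff_le : |psiRemCoeff| ≤ 2 := by
  have h1 := abs_le.mp abs_xiCoeffSum_le
  have h2 : Real.log Real.pi ≤ 1.2 := by
    rw [Real.log_le_iff_le_exp Real.pi_pos]
    have h3 := Real.exp_one_gt_d9
    have h4 : Real.exp 1.2 = Real.exp 1 * Real.exp 0.2 := by rw [← Real.exp_add]; norm_num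
    have h5 := Real.add_one_le_exp (0.2 : ℝ)
    have h6 := Real.pi_lt_d4
    rw [h4]
    nlinarith
  have h3 : 0 ≤ Real.log Real.pi := Real.log_nonneg (by linarith [Real.pi_gt_three])
  have h4 := Real.eulerMascheroniConstant_lt_two_thirds
  have h5 := Real.one_half_lt_eulerMascheroniConstant
  rw [psiRemCoeff, abs_le]
  constructor <;> linarith [h1.1, h1.2]

theorem psiInt_exp_eq : ∃ c : ℝ, ∀ u : ℝ, 0 < u → psiInt (Real.exp u) = u + c + psiRem u := by
  refine ⟨-1 - Real.log Real.pi / 2 - Real.eulerMascheroniConstant / 2 + ∑' n, trivCoeff n -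
    xiCoeffSum / 2, fun u hu => ?_⟩
  have h := tsum_vonMangoldt_max_eq (x := Real.exp u) (Real.one_lt_exp_iff.mpr hu)
  have e0 : (∑' n : ℕ, (ArithmeticFunction.vonMangoldt n : ℂ) *
      ((max (1 / (n : ℝ) - 1 / Real.exp u) 0 : ℝ) : ℂ)) = (psiInt (Real.exp u) : ℂ) := by
    rw [psiInt, Complex.ofReal_tsum]
    simp only [Complex.ofReal_mul]
  have ex : ∀ a : ℂ, ((Real.exp u : ℝ) : ℂ) ^ a = Complex.exp (a * u) := fun a => by
    rw [Complex.ofReal_exp, Complex.cpow_def_of_ne_zero (Complex.exp_ne_zero _),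
      ← Complex.ofReal_exp, ← Complex.ofReal_log (Real.exp_pos u).le, Real.log_exp, mul_comm]
  have e1 : (∑' n : ℕ, ((1 / ((2 * (n : ℝ) + 2) * (2 * n + 3)) : ℝ) : ℂ) *
        (1 - ((Real.exp u : ℝ) : ℂ) ^ (-(2 * (n : ℂ) + 3)))) =
      ((∑' n, trivCoeff n - ∑' n, trivCoeff n * Real.exp (-(2 * (n : ℝ) + 3) * u) : ℝ) : ℂ) := by
    rw [← summable_trivCoeff.tsum_sub (summable_trivCoeff_mul hu), Complex.ofReal_tsum]
    refine tsum_congr fun n => ?_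
    rw [ex, trivCoeff]
    push_cast
    ring
  have hosc : Summable fun ρ : ℂ => (xiMult ρ : ℂ) * (1 / (ρ * (1 - ρ)) *
      (Complex.exp ((ρ - 1) * u) + Complex.exp (-ρ * u))) := by
    refine Summable.of_norm_bounded (summable_xiMult_div_im_sq.mul_right 2) fun ρ => ?_
    by_cases hm : riemannXi ρ = 0
    swap
    · simp [xiMult_eq_zero hm]
    have hr := re_mem_Ioo_of_riemannXi_eq_zero hm
    rw [← mul_assoc, norm_mul]
    refine mul_le_mul (abs_xiCoeff_le ρ) ?_ (norm_nonneg _)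
      (div_nonneg (xiMult_nonneg _) (sq_nonneg _))
    refine (norm_add_le _ _).trans ?_
    rw [norm_cexp_mul_ofReal, norm_cexp_mul_ofReal]
    have a1 : Real.exp ((ρ - 1).re * u) ≤ 1 := Real.exp_le_one_iff.mpr (by
      simp; nlinarith [hr.1, hr.2])
    have a2 : Real.exp ((-ρ).re * u) ≤ 1 := Real.exp_le_one_iff.mpr (by
      simp; nlinarith [hr.1, hr.2])
    linarith
  have e2 : (∑' ρ : ℂ, (xiMult ρ : ℂ) * (1 / (ρ * (1 - ρ)) *
        (1 + 1 / ((Real.exp u : ℝ) : ℂ) - ((Real.exp u : ℝ) : ℂ) ^ (ρ - 1) -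
          ((Real.exp u : ℝ) : ℂ) ^ (-ρ)))).re =
      xiCoeffSum * (1 + Real.exp (-u)) - ∑' ρ, xiOscTerm ρ u := by
    have : ∀ ρ : ℂ, (xiMult ρ : ℂ) * (1 / (ρ * (1 - ρ)) *
        (1 + 1 / ((Real.exp u : ℝ) : ℂ) - ((Real.exp u : ℝ) : ℂ) ^ (ρ - 1) -
          ((Real.exp u : ℝ) : ℂ) ^ (-ρ))) =
      (xiMult ρ : ℂ) * (1 / (ρ * (1 - ρ))) * ((1 + Real.exp (-u) : ℝ) : ℂ) -
      (xiMult ρ : ℂ) * (1 / (ρ * (1 - ρ)) *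
      (Complex.exp ((ρ - 1) * u) + Complex.exp (-ρ * u))) := fun ρ => by
      rw [ex, ex, Real.exp_neg]
      push_cast
      ring
    simp_rw [this]
    rw [(summable_xiCoeff.mul_right _).tsum_sub hosc, Complex.sub_re, tsum_mul_right,
      Complex.re_mul_ofReal, re_tsum_xiCoeff, Complex.re_tsum hosc]
    simp only [Complex.re_ofReal_mul, xiOscTerm]
  rw [e0, e1] at h
  have h2 := congrArg Complex.re h
  have e3 : (1 / 2 : ℂ) = ((1 / 2 : ℝ) : ℂ) := by push_cast; rfl
  have e4 : ((Real.log (Real.exp u) : ℂ) - 1 + 1 / (Real.exp u : ℝ)) -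
      (Real.log Real.pi / 2 + Real.eulerMascheroniConstant / 2 : ℂ) * (1 - 1 / (Real.exp u : ℝ)) =
      ((u - 1 + Real.exp (-u) -
      (Real.log Real.pi / 2 + Real.eulerMascheroniConstant / 2) * (1 - Real.exp (-u)) : ℝ) : ℂ) := by
    rw [Real.log_exp, Real.exp_neg]
    push_cast
    ring
  rw [e4, e3, Complex.sub_re, Complex.re_ofReal_mul, e2, ← Complex.ofReal_add, Complex.ofReal_re,
    Complex.ofReal_re] at h2
  rw [h2, psiRem, psiRemCoeff]
  ring

lemma exp_neg_three_mul_le {u : ℝ} (hu : 0 < u) : Real.exp (-3 * u) ≤ Real.exp (-u) :=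
  Real.exp_le_exp.mpr (by linarith)

lemma abs_psiRem_sub_le {u : ℝ} (hu : 0 < u) :
    |psiRem u - (∑' ρ, xiOscTerm ρ u) / 2| ≤ 3 * Real.exp (-u) := by
  have h1 := abs_le.mp (abs_tsum_trivCoeff_mul_le hu trivCoeff_nonneg fun _ => le_rfl)
  have h2 := abs_le.mp abs_psiRemCoeff_le
  have h3 := exp_neg_three_mul_le hu
  have h4 := Real.exp_pos (-u)
  rw [psiRem, abs_le]
  constructor <;> nlinarith [h1.1, h1.2, h2.1, h2.2]

lemma psiRem_le {u : ℝ} (hu : 0 < u) : psiRem u ≤ 0.0238 + 4 * Real.exp (-u) := by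
  have h1 := (abs_le.mp (abs_psiRem_sub_le hu)).2
  have h2 := (abs_le.mp (abs_tsum_xiOscTerm_le hu)).2
  linarith [Real.exp_pos (-u)]

lemma abs_psiRem_le {u : ℝ} (hu : 0 < u) : |psiRem u| ≤ 5 := by
  have h1 := abs_le.mp (abs_psiRem_sub_le hu)
  have h2 := abs_le.mp (abs_tsum_xiOscTerm_le hu)
  have h3 : Real.exp (-u) ≤ 1 := Real.exp_le_one_iff.mpr (by linarith)
  rw [abs_le]
  constructor <;> linarith [Real.exp_pos (-u), h1.1, h1.2, h2.1, h2.2]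

lemma mul_psiRem_le {u : ℝ} (hu : 0 < u) :
    u * psiRem u ≤ 2.29775 * Real.exp (-1) + 0.0238 * (u * Real.exp (-u / 2)) +
      3 * (u * Real.exp (-u)) := by
  have h1 := mul_le_mul_of_nonneg_left (abs_le.mp (abs_psiRem_sub_le hu)).2 hu.le
  have h2 := (abs_le.mp (abs_mul_tsum_xiOscTerm_le hu)).2
  linarith

lemma hasDerivAt_psiRemInt {u : ℝ} (hu : 0 < u) : HasDerivAt psiRemInt (psiRem u) u := by
  have hd : ∀ a : ℝ, HasDerivAt (fun u : ℝ => Real.exp (a * u)) (a * Real.exp (a * u)) u := fun a => by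
    have := ((hasDerivAt_id u).const_mul a).exp
    refine this.congr_deriv ?_
    simp; ring
  have h1 : HasDerivAt (fun u => ∑' n : ℕ, trivCoeff n / (2 * (n : ℝ) + 3) *
      Real.exp (-(2 * (n : ℝ) + 3) * u))
      (∑' n : ℕ, -(trivCoeff n * Real.exp (-(2 * (n : ℝ) + 3) * u))) u := by
    refine hasDerivAt_tsum_of_isPreconnected (t := Set.Ioi 0) (u := trivCoeff)
      (g := fun (n : ℕ) u => trivCoeff n / (2 * (n : ℝ) + 3) * Real.exp (-(2 * (n : ℝ) + 3) * u))
      (g' := fun (n : ℕ) u => -(trivCoeff n * Real.exp (-(2 * (n : ℝ) + 3) * u)))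
      summable_one_div_two_mul isOpen_Ioi isPreconnected_Ioi (fun n y _ => ?_) (fun n y hy => ?_)
      hu ?_ hu
    · have := ((((hasDerivAt_id y).const_mul (-(2 * (n : ℝ) + 3))).exp).const_mul
        (trivCoeff n / (2 * (n : ℝ) + 3)))
      refine this.congr_deriv ?_
      have : (2 * (n : ℝ) + 3) ≠ 0 := by positivity
      simp only [id]; field_simp
    · rw [norm_neg, norm_mul, Real.norm_of_nonneg (trivCoeff_nonneg n),
        Real.norm_of_nonneg (Real.exp_pos _).le]
      exact mul_le_of_le_one_right (trivCoeff_nonneg n) (exp_triv_le_one hy n)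
    · refine Summable.of_nonneg_of_le (fun n => mul_nonneg (div_nonneg (trivCoeff_nonneg n)
        (by positivity)) (Real.exp_pos _).le) (fun n => ?_) (summable_trivCoeff_mul hu)
      refine mul_le_mul_of_nonneg_right (div_le_self (trivCoeff_nonneg n) ?_) (Real.exp_pos _).le
      linarith [(Nat.cast_nonneg n : (0 : ℝ) ≤ n)]
  have h2 : HasDerivAt (fun u => -psiRemCoeff * Real.exp (-u)) (psiRemCoeff * Real.exp (-u)) u := by
    have := (hd (-1)).const_mul (-psiRemCoeff)
    simpa using this
  refine ((h2.add h1).add ((hasDerivAt_tsum_xiOscTermInt hu).div_const 2)).congr_deriv ?_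
  rw [tsum_neg, psiRem]
  ring

lemma abs_psiRemInt_le {u : ℝ} (hu : 0 < u) : |psiRemInt u| ≤ 0.00735 + 3 * Real.exp (-u) := by
  have h1 := abs_le.mp (abs_tsum_trivCoeff_mul_le hu
    (c := fun n => trivCoeff n / (2 * (n : ℝ) + 3))
    (fun n => div_nonneg (trivCoeff_nonneg n) (by positivity)) fun n =>
      div_le_self (trivCoeff_nonneg n) (by linarith [(Nat.cast_nonneg n : (0 : ℝ) ≤ n)]))
  have h2 := abs_le.mp abs_psiRemCoeff_le
  have h3 := exp_neg_three_mul_le hu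
  have h4 := Real.exp_pos (-u)
  have h5 := abs_le.mp (abs_tsum_xiOscTermInt_le hu)
  rw [psiRemInt, abs_le]
  constructor <;> nlinarith [h1.1, h1.2, h2.1, h2.2, h5.1, h5.2]

noncomputable def wInv (y : ℝ) : ℝ := 1 / (y * Real.log y)

/-- `∑_{n ≤ e^u} Λ(n) (1/(n log n) - 1/(u e^u))`. -/
noncomputable def mertensTail (u : ℝ) : ℝ :=
  ∑' n : ℕ, ArithmeticFunction.vonMangoldt n * max (wInv n - wInv (Real.exp u)) 0

lemma wInv_pos {a : ℝ} (ha : 1 < a) : 0 < wInv a := by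
  have := Real.log_pos ha
  rw [wInv]; positivity

lemma wInv_anti {a b : ℝ} (ha : 1 < a) (hab : a ≤ b) : wInv b ≤ wInv a := by
  have h0 : 0 < a := by linarith
  have := Real.log_pos ha
  have := Real.log_le_log h0 hab
  have hb : 0 ≤ b := by linarith
  rw [wInv, wInv]
  gcongr

lemma wInv_exp (u : ℝ) : wInv (Real.exp u) = Real.exp (-u) / u := by
  rw [wInv, Real.log_exp, Real.exp_neg, ← one_div, div_div]

lemma mertensTail_eq_sum {u : ℝ} (hu : 0 < u) {N : ℕ} (h : Real.exp u ≤ N) :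
    mertensTail u = ∑ n ∈ range N,
      ArithmeticFunction.vonMangoldt n * max (wInv n - wInv (Real.exp u)) 0 := by
  refine tsum_eq_sum fun n hn => ?_
  have hn : N ≤ n := by simpa using hn
  have hn' : Real.exp u ≤ n := h.trans (by exact_mod_cast hn)
  rw [max_eq_right, mul_zero]
  linarith [wInv_anti (Real.one_lt_exp_iff.mpr hu) hn']

lemma psiInt_eq_sum {u : ℝ} {N : ℕ} (h : Real.exp u ≤ N) :
    psiInt (Real.exp u) = ∑ n ∈ range N,
      ArithmeticFunction.vonMangoldt n * max (1 / (n : ℝ) - 1 / Real.exp u) 0 := by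
  refine tsum_eq_sum fun n hn => ?_
  have hn : N ≤ n := by simpa using hn
  have hn' : Real.exp u ≤ n := h.trans (by exact_mod_cast hn)
  rw [max_eq_right, mul_zero]
  linarith [one_div_le_one_div_of_le (Real.exp_pos u) hn']

lemma hasDerivAt_one_div_add {u : ℝ} (hu : 0 < u) :
    HasDerivAt (fun u : ℝ => 1 / u + 1 / u ^ 2) (-(1 / u ^ 2 + 2 / u ^ 3)) u := by
  have h1 := (hasDerivAt_id u).inv hu.ne'
  have h2 := ((hasDerivAt_id u).pow 2).inv (pow_ne_zero 2 hu.ne')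
  have := h1.add h2
  simp only [one_div]
  refine this.congr_deriv ?_
  simp; field_simp; ring

lemma hasDerivAt_one_div_sq_add {u : ℝ} (hu : 0 < u) :
    HasDerivAt (fun u : ℝ => 1 / u ^ 2 + 2 / u ^ 3) (-(2 / u ^ 3 + 6 / u ^ 4)) u := by
  have h1 := ((hasDerivAt_id u).pow 2).inv (pow_ne_zero 2 hu.ne')
  have h2 := (((hasDerivAt_id u).pow 3).inv (pow_ne_zero 3 hu.ne')).const_mul 2
  have := h1.add h2
  simp only [one_div, div_eq_mul_inv (2 : ℝ)]
  refine this.congr_deriv ?_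
  simp; field_simp; ring

lemma hasDerivAt_exp_neg_div {u : ℝ} (hu : 0 < u) :
    HasDerivAt (fun u : ℝ => Real.exp (-u) / u) (-Real.exp (-u) * (1 / u + 1 / u ^ 2)) u := by
  have := ((hasDerivAt_neg u).exp).div (hasDerivAt_id u) hu.ne'
  refine this.congr_deriv ?_
  simp; field_simp; ring

lemma hasDerivAt_max_sub {n : ℕ} (hn : 2 ≤ n) {u : ℝ} (hu : 0 < u) :
    HasDerivAt (fun u => max (wInv n - wInv (Real.exp u)) 0 -
        (1 / u + 1 / u ^ 2) * max (1 / (n : ℝ) - 1 / Real.exp u) 0)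
      ((1 / u ^ 2 + 2 / u ^ 3) * max (1 / (n : ℝ) - 1 / Real.exp u) 0) u := by
  have hn1 : (1 : ℝ) < n := by exact_mod_cast hn
  have hn0 : (0 : ℝ) < n := by linarith
  have hl : 0 < Real.log n := Real.log_pos hn1
  set g : ℝ → ℝ := fun u => (wInv n - Real.exp (-u) / u) -
    (1 / u + 1 / u ^ 2) * (1 / (n : ℝ) - Real.exp (-u)) with hg
  have hg' : ∀ u, 0 < u → HasDerivAt g ((1 / u ^ 2 + 2 / u ^ 3) * (1 / (n : ℝ) - Real.exp (-u))) u := by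
    intro u hu
    have h1 := (hasDerivAt_exp_neg_div hu).const_sub (wInv n)
    have h2 := ((hasDerivAt_neg u).exp).const_sub (1 / (n : ℝ))
    refine (h1.sub ((hasDerivAt_one_div_add hu).mul h2)).congr_deriv ?_
    ring
  have hge : ∀ u, Real.log n ≤ u → max (wInv n - wInv (Real.exp u)) 0 -
        (1 / u + 1 / u ^ 2) * max (1 / (n : ℝ) - 1 / Real.exp u) 0 = g u := by
    intro u hu
    have hu2 : (n : ℝ) ≤ Real.exp u := (Real.log_le_iff_le_exp hn0).mp hu
    rw [max_eq_left (by linarith [wInv_anti hn1 hu2]),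
      max_eq_left (by linarith [one_div_le_one_div_of_le hn0 hu2]), wInv_exp, one_div (Real.exp u),
      ← Real.exp_neg]
  have hle : ∀ u, 0 < u → u ≤ Real.log n → max (wInv n - wInv (Real.exp u)) 0 -
        (1 / u + 1 / u ^ 2) * max (1 / (n : ℝ) - 1 / Real.exp u) 0 = 0 := by
    intro u hu0 hu
    have hu2 : Real.exp u ≤ n := (Real.le_log_iff_exp_le hn0).mp hu
    rw [max_eq_right (by linarith [wInv_anti (Real.one_lt_exp_iff.mpr hu0) hu2]),
      max_eq_right (by linarith [one_div_le_one_div_of_le (Real.exp_pos u) hu2])]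
    simp
  rcases lt_trichotomy u (Real.log n) with h | h | h
  · have hu2 : Real.exp u ≤ n := (Real.le_log_iff_exp_le hn0).mp h.le
    rw [max_eq_right (a := 1 / (n : ℝ) - 1 / Real.exp u)
      (by linarith [one_div_le_one_div_of_le (Real.exp_pos u) hu2]), mul_zero]
    refine (hasDerivAt_const u (0 : ℝ)).congr_of_eventuallyEq ?_
    filter_upwards [Ioo_mem_nhds hu h] with y hy using hle y hy.1 hy.2.le
  · have e : Real.exp (-u) = 1 / n := by
      rw [h, Real.exp_neg, Real.exp_log hn0, one_div]
    have e0 : max (1 / (n : ℝ) - 1 / Real.exp u) 0 = 0 := by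
      rw [one_div (Real.exp u), ← Real.exp_neg, e, sub_self, max_self]
    rw [e0, mul_zero]
    have h1 := hg' u hu
    rw [e, sub_self, mul_zero] at h1
    have hR : HasDerivWithinAt (fun u => max (wInv n - wInv (Real.exp u)) 0 -
        (1 / u + 1 / u ^ 2) * max (1 / (n : ℝ) - 1 / Real.exp u) 0) 0 (Set.Ici u) u :=
      (h1.hasDerivWithinAt (s := Set.Ici u)).congr (fun y hy => hge y (h ▸ hy)) (hge u h.ge)
    have hL : HasDerivWithinAt (fun u => max (wInv n - wInv (Real.exp u)) 0 -
        (1 / u + 1 / u ^ 2) * max (1 / (n : ℝ) - 1 / Real.exp u) 0) 0 (Set.Ioc 0 u) u :=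
      (hasDerivWithinAt_const u _ (0 : ℝ)).congr (fun y hy => hle y hy.1 (hy.2.trans h.le))
        (hle u hu h.le)
    have hU := hL.union hR
    rw [Set.Ioc_union_Ici_eq_Ioi hu] at hU
    exact hU.hasDerivAt (Ioi_mem_nhds hu)
  · have hu2 : (n : ℝ) ≤ Real.exp u := (Real.log_le_iff_le_exp hn0).mp h.le
    rw [max_eq_left (a := 1 / (n : ℝ) - 1 / Real.exp u)
      (by linarith [one_div_le_one_div_of_le hn0 hu2]), one_div (Real.exp u), ← Real.exp_neg]
    refine (hg' u hu).congr_of_eventuallyEq ?_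
    filter_upwards [Ioi_mem_nhds h] with y hy using hge y (le_of_lt hy)

lemma hasDerivAt_mertensTail_sub {u : ℝ} (hu : 0 < u) :
    HasDerivAt (fun u => mertensTail u - (1 / u + 1 / u ^ 2) * psiInt (Real.exp u))
      ((1 / u ^ 2 + 2 / u ^ 3) * psiInt (Real.exp u)) u := by
  obtain ⟨N, hN⟩ := exists_nat_ge (Real.exp (u + 1))
  have h1 : HasDerivAt (fun u => ∑ n ∈ range N, ArithmeticFunction.vonMangoldt n *
      (max (wInv n - wInv (Real.exp u)) 0 -
        (1 / u + 1 / u ^ 2) * max (1 / (n : ℝ) - 1 / Real.exp u) 0))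
      (∑ n ∈ range N, ArithmeticFunction.vonMangoldt n *
        ((1 / u ^ 2 + 2 / u ^ 3) * max (1 / (n : ℝ) - 1 / Real.exp u) 0)) u := by
    refine HasDerivAt.fun_sum fun n _ => ?_
    by_cases hn : 2 ≤ n
    · exact (hasDerivAt_max_sub hn hu).const_mul _
    · have : ArithmeticFunction.vonMangoldt n = 0 := by
        interval_cases n <;> simp
      simp only [this, zero_mul]
      exact hasDerivAt_const _ _
  have hle : ∀ y, y < u + 1 → Real.exp y ≤ N := fun y hy =>
    (Real.exp_le_exp.mpr hy.le).trans hN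
  refine (h1.congr_of_eventuallyEq ?_).congr_deriv ?_
  · filter_upwards [Ioo_mem_nhds hu (by linarith : u < u + 1)] with y hy
    rw [mertensTail_eq_sum hy.1 (hle y hy.2), psiInt_eq_sum (hle y hy.2), mul_sum,
      ← sum_sub_distrib]
    exact sum_congr rfl fun n _ => by ring
  · rw [psiInt_eq_sum (hle u (by linarith)), mul_sum]
    exact sum_congr rfl fun n _ => by ring

/-- `∑_{n ≤ e^u} Λ(n)/(n log n) - log u + (1 - ψ(e^u)/e^u)/u`. -/
noncomputable def mertensDiff (u : ℝ) : ℝ := 1 / u - Real.log u + mertensTail u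

lemma hasDerivAt_mertensDiff {u : ℝ} (hu : 0 < u) :
    HasDerivAt (fun u => mertensDiff u - (1 / u + 1 / u ^ 2) * psiRem u)
      ((1 / u ^ 2 + 2 / u ^ 3) * psiRem u) u := by
  obtain ⟨c, hc⟩ := psiInt_exp_eq
  have h1 := hasDerivAt_mertensTail_sub hu
  have h2 := (hasDerivAt_one_div_add hu).mul ((hasDerivAt_id u).add_const c)
  have h3 := (((hasDerivAt_inv hu.ne').sub (Real.hasDerivAt_log hu.ne')).add h2).add h1
  refine (h3.congr_of_eventuallyEq ?_).congr_deriv ?_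
  · filter_upwards [Ioi_mem_nhds hu] with y hy
    simp [mertensDiff, hc y hy]
    ring
  · simp [hc u hu]
    field_simp
    ring

lemma hasDerivAt_mertensDiff_sub {u : ℝ} (hu : 0 < u) :
    HasDerivAt (fun u => mertensDiff u - (1 / u + 1 / u ^ 2) * psiRem u -
        (1 / u ^ 2 + 2 / u ^ 3) * psiRemInt u)
      ((2 / u ^ 3 + 6 / u ^ 4) * psiRemInt u) u := by
  refine ((hasDerivAt_mertensDiff hu).sub
    ((hasDerivAt_one_div_sq_add hu).mul (hasDerivAt_psiRemInt hu))).congr_deriv ?_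
  ring

lemma tendsto_one_div_add : Tendsto (fun u : ℝ => 1 / u + 1 / u ^ 2) atTop (nhds 0) := by
  have h1 : Tendsto (fun u : ℝ => 1 / u) atTop (nhds 0) := tendsto_const_nhds.div_atTop tendsto_id
  have h2 := h1.add (h1.pow 2)
  simpa using h2

lemma tendsto_one_div_sq_add : Tendsto (fun u : ℝ => 1 / u ^ 2 + 2 / u ^ 3) atTop (nhds 0) := by
  have h1 : Tendsto (fun u : ℝ => 1 / u) atTop (nhds 0) := tendsto_const_nhds.div_atTop tendsto_id
  have h2 := (h1.pow 2).add ((h1.pow 3).const_mul 2)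
  simpa [div_eq_mul_inv] using h2

lemma tendsto_mul_psiRem :
    Tendsto (fun u : ℝ => (1 / u + 1 / u ^ 2) * psiRem u) atTop (nhds 0) := by
  have ht := tendsto_one_div_add.mul_const 5
  rw [zero_mul] at ht
  refine squeeze_zero_norm' ?_ ht
  filter_upwards [eventually_gt_atTop 0] with u hu
  rw [norm_mul, Real.norm_of_nonneg (by positivity)]
  exact mul_le_mul_of_nonneg_left (abs_psiRem_le hu) (by positivity)

lemma monotoneOn_mertensDiff {u₀ p : ℝ} (h0 : 0 < u₀) (hp : 0.00735 + 3 * Real.exp (-u₀) ≤ p) :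
    MonotoneOn (fun u => mertensDiff u - (1 / u + 1 / u ^ 2) * psiRem u -
        (1 / u ^ 2 + 2 / u ^ 3) * psiRemInt u - p * (1 / u ^ 2 + 2 / u ^ 3)) (Set.Ici u₀) ∧
    AntitoneOn (fun u => mertensDiff u - (1 / u + 1 / u ^ 2) * psiRem u -
        (1 / u ^ 2 + 2 / u ^ 3) * psiRemInt u + p * (1 / u ^ 2 + 2 / u ^ 3)) (Set.Ici u₀) := by
  have hd : ∀ u ∈ Set.Ici u₀, 0 < u := fun u hu => h0.trans_le hu
  have hP : ∀ u ∈ Set.Ici u₀, |psiRemInt u| ≤ p := fun u hu => by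
    have h1 := abs_psiRemInt_le (hd u hu)
    have h2 : Real.exp (-u) ≤ Real.exp (-u₀) := Real.exp_le_exp.mpr (neg_le_neg hu)
    linarith
  constructor
  · have hder : ∀ u ∈ Set.Ici u₀, HasDerivAt (fun u => mertensDiff u -
        (1 / u + 1 / u ^ 2) * psiRem u - (1 / u ^ 2 + 2 / u ^ 3) * psiRemInt u -
        p * (1 / u ^ 2 + 2 / u ^ 3)) ((2 / u ^ 3 + 6 / u ^ 4) * (psiRemInt u + p)) u :=
      fun u hu => ((hasDerivAt_mertensDiff_sub (hd u hu)).sub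
        ((hasDerivAt_one_div_sq_add (hd u hu)).const_mul p)).congr_deriv (by ring)
    refine monotoneOn_of_deriv_nonneg (convex_Ici _)
      (fun u hu => (hder u hu).continuousAt.continuousWithinAt)
      (fun u hu => (hder u (interior_subset hu)).differentiableAt.differentiableWithinAt)
      fun u hu => ?_
    have hu := interior_subset hu
    rw [(hder u hu).deriv]
    have := hd u hu
    exact mul_nonneg (by positivity) (by linarith [(abs_le.mp (hP u hu)).1])
  · have hder : ∀ u ∈ Set.Ici u₀, HasDerivAt (fun u => mertensDiff u -
        (1 / u + 1 / u ^ 2) * psiRem u - (1 / u ^ 2 + 2 / u ^ 3) * psiRemInt u +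
        p * (1 / u ^ 2 + 2 / u ^ 3)) ((2 / u ^ 3 + 6 / u ^ 4) * (psiRemInt u - p)) u :=
      fun u hu => ((hasDerivAt_mertensDiff_sub (hd u hu)).add
        ((hasDerivAt_one_div_sq_add (hd u hu)).const_mul p)).congr_deriv (by ring)
    refine antitoneOn_of_deriv_nonpos (convex_Ici _)
      (fun u hu => (hder u hu).continuousAt.continuousWithinAt)
      (fun u hu => (hder u (interior_subset hu)).differentiableAt.differentiableWithinAt)
      fun u hu => ?_
    have hu := interior_subset hu
    rw [(hder u hu).deriv]
    have := hd u hu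
    exact mul_nonpos_of_nonneg_of_nonpos (by positivity) (by linarith [(abs_le.mp (hP u hu)).2])

/-- `mertensDiff` converges, and is bounded by its limit up to an explicit error. -/
theorem exists_tendsto_mertensDiff : ∃ C : ℝ, Tendsto mertensDiff atTop (nhds C) ∧
    ∀ u, 0 < u → mertensDiff u ≤ C + (1 / u + 1 / u ^ 2) * psiRem u +
      2 * (0.00735 + 3 * Real.exp (-u)) * (1 / u ^ 2 + 2 / u ^ 3) := by
  set F := fun u => mertensDiff u - (1 / u + 1 / u ^ 2) * psiRem u -
        (1 / u ^ 2 + 2 / u ^ 3) * psiRemInt u with hF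
  have hpos : ∀ u : ℝ, 0 < u → 0 < 1 / u ^ 2 + 2 / u ^ 3 := fun u hu => by positivity
  obtain ⟨hm, ha⟩ := monotoneOn_mertensDiff (u₀ := 1) one_pos (p := 4) (by
    have : Real.exp (-1) ≤ 1 := Real.exp_le_one_iff.mpr (by norm_num)
    linarith)
  -- extend to a monotone function on the whole line
  have hm' : Monotone fun u => F (max 1 u) - 4 * (1 / (max 1 u) ^ 2 + 2 / (max 1 u) ^ 3) :=
    fun a b hab => hm (le_max_left 1 a) (le_max_left 1 b) (max_le_max le_rfl hab)
  have hbdd : BddAbove (Set.range fun u =>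
      F (max 1 u) - 4 * (1 / (max 1 u) ^ 2 + 2 / (max 1 u) ^ 3)) := by
    refine ⟨F 1 + 4 * (1 / 1 ^ 2 + 2 / 1 ^ 3), ?_⟩
    rintro _ ⟨u, rfl⟩
    have h1 := ha Set.self_mem_Ici (le_max_left 1 u) (le_max_left 1 u)
    have h2 := hpos (max 1 u) (by positivity)
    simp only [hF] at h1 ⊢
    linarith
  set C := ⨆ u, (F (max 1 u) - 4 * (1 / (max 1 u) ^ 2 + 2 / (max 1 u) ^ 3))
  have ht := tendsto_atTop_ciSup hm' hbdd
  have hFt : Tendsto F atTop (nhds C) := by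
    have h2 := ht.add (tendsto_one_div_sq_add.const_mul 4)
    rw [mul_zero, add_zero] at h2
    refine h2.congr' ?_
    filter_upwards [eventually_ge_atTop 1] with u hu
    simp only [max_eq_right hu]
    ring
  have hPt : Tendsto (fun u : ℝ => (1 / u ^ 2 + 2 / u ^ 3) * psiRemInt u) atTop (nhds 0) := by
    have ht := tendsto_one_div_sq_add.mul_const 4
    rw [zero_mul] at ht
    refine squeeze_zero_norm' ?_ ht
    filter_upwards [eventually_gt_atTop 0] with u hu
    rw [norm_mul, Real.norm_of_nonneg (hpos u hu).le]
    refine mul_le_mul_of_nonneg_left ?_ (hpos u hu).le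
    have : Real.exp (-u) ≤ 1 := Real.exp_le_one_iff.mpr (by linarith)
    have := abs_psiRemInt_le hu
    rw [Real.norm_eq_abs]
    linarith
  refine ⟨C, ?_, fun u hu => ?_⟩
  · have h2 := (hFt.add tendsto_mul_psiRem).add hPt
    rw [add_zero, add_zero] at h2
    refine h2.congr fun u => ?_
    simp only [hF]; ring
  · set p := 0.00735 + 3 * Real.exp (-u)
    obtain ⟨hm, -⟩ := monotoneOn_mertensDiff hu (le_refl p)
    have hlim : Tendsto (fun u => F u - p * (1 / u ^ 2 + 2 / u ^ 3)) atTop (nhds C) := by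
      simpa using hFt.sub (tendsto_one_div_sq_add.const_mul p)
    have h1 : F u - p * (1 / u ^ 2 + 2 / u ^ 3) ≤ C := by
      refine ge_of_tendsto hlim ?_
      filter_upwards [eventually_ge_atTop u] with y hy
      exact hm Set.self_mem_Ici hy hy
    have h2 : (1 / u ^ 2 + 2 / u ^ 3) * psiRemInt u ≤ (1 / u ^ 2 + 2 / u ^ 3) * p :=
      mul_le_mul_of_nonneg_left (le_of_abs_le (abs_psiRemInt_le hu)) (hpos u hu).le
    simp only [hF] at h1
    nlinarith [h1, h2]

lemma integral_log_mul_exp_neg :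
    ∫ t in Set.Ioi (0 : ℝ), Real.log t * Real.exp (-t) = -Real.eulerMascheroniConstant := by
  have h1 := Complex.hasDerivAt_GammaIntegral (s := 1) (by simp)
  have h2 : HasDerivAt Complex.GammaIntegral (-(Real.eulerMascheroniConstant : ℂ)) 1 := by
    refine Complex.hasDerivAt_Gamma_one.congr_of_eventuallyEq ?_
    filter_upwards [(isOpen_lt continuous_const Complex.continuous_re).mem_nhds
      (show (0 : ℝ) < (1 : ℂ).re by simp)] with s hs
    exact (Complex.Gamma_eq_integral hs).symm
  have h3 := h1.unique h2
  have h4 : ∀ t : ℝ, (t : ℂ) ^ ((1 : ℂ) - 1) * (Real.log t * Real.exp (-t)) =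
      ((Real.log t * Real.exp (-t) : ℝ) : ℂ) := fun t => by
    rw [sub_self, Complex.cpow_zero, one_mul]; push_cast; rfl
  rw [MeasureTheory.setIntegral_congr_fun measurableSet_Ioi (fun t _ => h4 t),
    integral_complex_ofReal] at h3
  exact_mod_cast h3

lemma integrableOn_log_mul_exp_neg :
    MeasureTheory.IntegrableOn (fun t => Real.log t * Real.exp (-t)) (Set.Ioi 0) := by
  refine MeasureTheory.Integrable.of_integral_ne_zero ?_
  rw [integral_log_mul_exp_neg]
  linarith [Real.one_half_lt_eulerMascheroniConstant]

lemma integral_exp_neg_mul {ε : ℝ} (hε : 0 < ε) (c : ℝ) :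
    ∫ u in Set.Ioi c, Real.exp (-ε * u) = Real.exp (-ε * c) / ε := by
  rw [integral_exp_mul_Ioi (by linarith), div_neg, neg_div, neg_neg]

lemma integral_log_mul_exp_neg_mul {ε : ℝ} (hε : 0 < ε) :
    MeasureTheory.IntegrableOn (fun u => Real.log u * Real.exp (-ε * u)) (Set.Ioi 0) ∧
    ∫ u in Set.Ioi (0 : ℝ), Real.log u * Real.exp (-ε * u) =
      (-Real.eulerMascheroniConstant - Real.log ε) / ε := by
  have h1 : MeasureTheory.IntegrableOn (fun u => Real.log (ε * u) * Real.exp (-(ε * u)))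
      (Set.Ioi 0) := by
    rw [MeasureTheory.integrableOn_Ioi_comp_mul_left_iff
      (fun t => Real.log t * Real.exp (-t)) 0 hε, mul_zero]
    exact integrableOn_log_mul_exp_neg
  have h2 := MeasureTheory.integral_comp_mul_left_Ioi
    (fun t => Real.log t * Real.exp (-t)) 0 hε
  rw [mul_zero, integral_log_mul_exp_neg] at h2
  have h3 := (exp_neg_integrableOn_Ioi 0 hε).const_mul (Real.log ε)
  have h4 := integral_exp_neg_mul hε 0
  have e : Set.EqOn (fun u => Real.log (ε * u) * Real.exp (-(ε * u)) -
      Real.log ε * Real.exp (-ε * u)) (fun u => Real.log u * Real.exp (-ε * u))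
      (Set.Ioi 0) := fun u hu => by
    have hu : 0 < u := hu
    simp only
    rw [Real.log_mul hε.ne' hu.ne', neg_mul]; ring
  refine ⟨(h1.sub h3).congr_fun e measurableSet_Ioi, ?_⟩
  rw [← MeasureTheory.setIntegral_congr_fun measurableSet_Ioi e,
    MeasureTheory.integral_sub h1 h3, h2, MeasureTheory.integral_const_mul, h4]
  simp
  field_simp

/-- An Abelian theorem for the Laplace transform. -/
lemma tendsto_mul_integral_exp_neg_mul {h : ℝ → ℝ} (hh : Tendsto h atTop (nhds 0))
    (hi : ∀ ε, 0 < ε → MeasureTheory.IntegrableOn (fun u => h u * Real.exp (-ε * u)) (Set.Ioi 0)) :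
    Tendsto (fun ε => ε * ∫ u in Set.Ioi (0 : ℝ), h u * Real.exp (-ε * u))
      (nhdsWithin 0 (Set.Ioi 0)) (nhds 0) := by
  rw [Metric.tendsto_nhds]
  intro δ hδ
  obtain ⟨T, hT⟩ := eventually_atTop.mp ((Metric.tendsto_nhds.mp hh) (δ / 2) (by positivity))
  set M := ∫ u in Set.Ioi (0 : ℝ), ‖h u * Real.exp (-1 * u)‖
  have hM : 0 ≤ M := MeasureTheory.integral_nonneg fun _ => norm_nonneg _
  have hpos : 0 < δ / 2 / (Real.exp T * M + 1) := by positivity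
  filter_upwards [Ioo_mem_nhdsGT (show (0 : ℝ) < 1 by norm_num), Ioo_mem_nhdsGT hpos]
    with ε hε1 hε2
  have hε : 0 < ε := hε1.1
  have hb : ∀ u ∈ Set.Ioi (0 : ℝ), ‖h u * Real.exp (-ε * u)‖ ≤
      Real.exp T * ‖h u * Real.exp (-1 * u)‖ + δ / 2 * Real.exp (-ε * u) := fun u hu => by
    have hu : 0 < u := hu
    rw [norm_mul, norm_mul, Real.norm_of_nonneg (Real.exp_pos _).le,
      Real.norm_of_nonneg (Real.exp_pos _).le]
    rcases le_total T u with hTu | hTu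
    · have := hT u hTu
      rw [dist_zero_right] at this
      have h1 : ‖h u‖ * Real.exp (-ε * u) ≤ δ / 2 * Real.exp (-ε * u) := by gcongr
      have h2 : 0 ≤ Real.exp T * (‖h u‖ * Real.exp (-1 * u)) := by positivity
      linarith
    · have h1 : Real.exp (-ε * u) ≤ Real.exp T * Real.exp (-1 * u) := by
        rw [← Real.exp_add, Real.exp_le_exp]; nlinarith
      have h2 : ‖h u‖ * Real.exp (-ε * u) ≤ ‖h u‖ * (Real.exp T * Real.exp (-1 * u)) := by gcongr
      have h3 : 0 ≤ δ / 2 * Real.exp (-ε * u) := by positivity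
      linarith
  have hi1 := ((hi 1 one_pos).norm.const_mul (Real.exp T))
  have hi2 := (exp_neg_integrableOn_Ioi 0 hε).const_mul (δ / 2)
  have h1 : ‖∫ u in Set.Ioi (0 : ℝ), h u * Real.exp (-ε * u)‖ ≤ Real.exp T * M + δ / 2 / ε := by
    calc _ ≤ ∫ u in Set.Ioi (0 : ℝ), (Real.exp T * ‖h u * Real.exp (-1 * u)‖ +
          δ / 2 * Real.exp (-ε * u)) := by
          refine MeasureTheory.norm_integral_le_of_norm_le (hi1.add hi2) ?_
          exact (MeasureTheory.ae_restrict_iff' measurableSet_Ioi).mpr (.of_forall hb)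
      _ = _ := by
          rw [MeasureTheory.integral_add hi1 hi2, MeasureTheory.integral_const_mul,
            MeasureTheory.integral_const_mul, integral_exp_neg_mul hε]
          rw [mul_zero, Real.exp_zero, mul_one_div]
  rw [dist_zero_right, norm_mul, Real.norm_of_nonneg hε.le]
  have h2 : ε * (Real.exp T * M + 1) < δ / 2 := (lt_div_iff₀ (by positivity)).mp hε2.2
  calc _ ≤ ε * (Real.exp T * M + δ / 2 / ε) := by gcongr
    _ = ε * (Real.exp T * M) + δ / 2 := by field_simp
    _ < δ := by nlinarith

/-- `∑_{n ≤ x} Λ(n)/(n log n)`. -/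
noncomputable def mertensSum (x : ℝ) : ℝ :=
  ∑ n ∈ Ioc 0 ⌊x⌋₊, ArithmeticFunction.vonMangoldt n * wInv n

lemma mertensSum_sub_le (x : ℝ) {z : ℝ} (hz : 1 < z) :
    mertensSum x - Chebyshev.psi x * wInv z ≤ mertensTail (Real.log z) := by
  have hlz := Real.log_pos hz
  set N := max ⌊x⌋₊ ⌈z⌉₊ + 1 with hN
  have hNz : Real.exp (Real.log z) ≤ N := by
    rw [Real.exp_log (by linarith)]
    refine (Nat.le_ceil z).trans ?_
    exact_mod_cast (le_max_right _ _).trans (Nat.le_succ _)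
  rw [mertensTail_eq_sum hlz hNz, Real.exp_log (by linarith), mertensSum, Chebyshev.psi, sum_mul,
    ← sum_sub_distrib]
  calc _ ≤ ∑ n ∈ Ioc 0 ⌊x⌋₊, ArithmeticFunction.vonMangoldt n * max (wInv n - wInv z) 0 := by
        refine sum_le_sum fun n _ => ?_
        rw [← mul_sub]
        exact mul_le_mul_of_nonneg_left (le_max_left _ _) ArithmeticFunction.vonMangoldt_nonneg
    _ ≤ _ := by
        refine sum_le_sum_of_subset_of_nonneg (fun n hn => ?_) fun n _ _ =>
          mul_nonneg ArithmeticFunction.vonMangoldt_nonneg (le_max_right _ _)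
        have := (mem_Ioc.mp hn).2
        simp only [mem_range, hN]
        have := le_max_left ⌊x⌋₊ ⌈z⌉₊
        omega

lemma mertensTail_log {z : ℝ} (hz : 1 < z) :
    mertensTail (Real.log z) = mertensSum z - Chebyshev.psi z * wInv z := by
  have hlz := Real.log_pos hz
  have hNz : Real.exp (Real.log z) ≤ (⌊z⌋₊ + 1 : ℕ) := by
    rw [Real.exp_log (by linarith)]
    push_cast
    exact (Nat.lt_floor_add_one z).le
  rw [mertensTail_eq_sum hlz hNz, Real.exp_log (by linarith), mertensSum, Chebyshev.psi, sum_mul,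
    ← sum_sub_distrib]
  symm
  refine sum_subset_zero_on_sdiff (fun n hn => ?_) (fun n hn => ?_) (fun n hn => ?_)
  · have := (mem_Ioc.mp hn).2
    simp only [mem_range]; omega
  · have : n = 0 := by
      by_contra h0
      have h1 := mem_range.mp (Finset.mem_sdiff.mp hn).1
      exact (Finset.mem_sdiff.mp hn).2 (mem_Ioc.mpr ⟨Nat.pos_of_ne_zero h0, by omega⟩)
    simp [this]
  · rw [← mul_sub]
    rcases lt_or_ge n 2 with h2 | h2
    · have := (mem_Ioc.mp hn).1
      have : n = 1 := by omega
      simp [this]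
    · rw [max_eq_left]
      have h3 : (n : ℝ) ≤ z := (Nat.le_floor_iff (by linarith)).mp (mem_Ioc.mp hn).2
      have h4 : (1 : ℝ) < n := by exact_mod_cast h2
      linarith [wInv_anti h4 h3]

lemma tendsto_mertensSum_exp_sub_log {C : ℝ} (hC : Tendsto mertensDiff atTop (nhds C)) :
    Tendsto (fun u => mertensSum (Real.exp u) - Real.log u - C) atTop (nhds 0) := by
  have h1 : Tendsto (fun u : ℝ => 1 / u) atTop (nhds 0) := tendsto_const_nhds.div_atTop tendsto_id
  have h2 : Tendsto (fun u : ℝ => Chebyshev.psi (Real.exp u) * wInv (Real.exp u)) atTop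
      (nhds 0) := by
    have ht := h1.const_mul (Real.log 4 + 4)
    rw [mul_zero] at ht
    refine squeeze_zero' ?_ ?_ ht
    · filter_upwards [eventually_gt_atTop 0] with u hu
      exact mul_nonneg (Chebyshev.psi_nonneg _) (wInv_pos (Real.one_lt_exp_iff.mpr hu)).le
    · filter_upwards [eventually_gt_atTop 0] with u hu
      calc _ ≤ (Real.log 4 + 4) * Real.exp u * wInv (Real.exp u) :=
            mul_le_mul_of_nonneg_right (Chebyshev.psi_le_const_mul_self (Real.exp_pos u).le)
              (wInv_pos (Real.one_lt_exp_iff.mpr hu)).le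
        _ = _ := by
            rw [wInv, Real.log_exp]
            have := (Real.exp_pos u).ne'
            field_simp
  have h3 := ((hC.sub h1).add h2).sub_const C
  rw [sub_zero, add_zero, sub_self] at h3
  refine h3.congr' ?_
  filter_upwards [eventually_gt_atTop 0] with u hu
  have := mertensTail_log (Real.one_lt_exp_iff.mpr hu)
  rw [Real.log_exp] at this
  rw [mertensDiff, this]; ring

lemma mertensSum_exp_eq_tsum (u : ℝ) :
    mertensSum (Real.exp u) = ∑' n : ℕ, (Set.Ici (Real.log n)).indicator
      (fun _ => ArithmeticFunction.vonMangoldt n * wInv n) u := by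
  rw [tsum_eq_sum (s := Ioc 0 ⌊Real.exp u⌋₊), mertensSum]
  · refine sum_congr rfl fun n hn => ?_
    have hn := mem_Ioc.mp hn
    rw [Set.indicator_of_mem]
    rw [Set.mem_Ici, Real.log_le_iff_le_exp (by exact_mod_cast hn.1)]
    exact (Nat.le_floor_iff (Real.exp_pos u).le).mp hn.2
  · intro n hn
    rcases Nat.eq_zero_or_pos n with h0 | h0
    · simp [h0]
    · refine Set.indicator_of_notMem (fun hmem => hn ?_) _
      rw [Set.mem_Ici, Real.log_le_iff_le_exp (by exact_mod_cast h0)] at hmem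
      exact mem_Ioc.mpr ⟨h0, (Nat.le_floor_iff (Real.exp_pos u).le).mpr hmem⟩

lemma vonMangoldt_mul_wInv_nonneg (n : ℕ) : 0 ≤ ArithmeticFunction.vonMangoldt n * wInv n := by
  refine mul_nonneg ArithmeticFunction.vonMangoldt_nonneg ?_
  rw [wInv]
  have := Real.log_natCast_nonneg n
  positivity

lemma summable_vonMangoldt_div_rpow_mul_log {ε : ℝ} (hε : 0 < ε) : Summable fun n : ℕ =>
    ArithmeticFunction.vonMangoldt n / ((n : ℝ) ^ (1 + ε) * Real.log n) := by
  refine Summable.of_nonneg_of_le (fun n => ?_) (fun n => ?_)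
    (Real.summable_one_div_nat_rpow.mpr (show 1 < 1 + ε by linarith))
  · have := Real.log_natCast_nonneg n
    have := ArithmeticFunction.vonMangoldt_nonneg (n := n)
    positivity
  · rcases lt_or_ge n 2 with h2 | h2
    · have : ArithmeticFunction.vonMangoldt n = 0 := by interval_cases n <;> simp
      rw [this, zero_div]; positivity
    · have hn : (1 : ℝ) < n := by exact_mod_cast h2
      have hlog := Real.log_pos hn
      have := Real.rpow_pos_of_pos (show (0 : ℝ) < n by linarith) (1 + ε)
      rw [div_le_div_iff₀ (by positivity) this]
      nlinarith [ArithmeticFunction.vonMangoldt_le_log (n := n)]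

lemma integral_mertensSum_exp {ε : ℝ} (hε : 0 < ε)
    (h0 : Real.log (riemannZeta ((1 + ε : ℝ) : ℂ)).re ≠ 0) :
    MeasureTheory.IntegrableOn (fun u => mertensSum (Real.exp u) * Real.exp (-ε * u)) (Set.Ioi 0) ∧
    ∫ u in Set.Ioi (0 : ℝ), mertensSum (Real.exp u) * Real.exp (-ε * u) =
      Real.log (riemannZeta ((1 + ε : ℝ) : ℂ)).re / ε := by
  set a : ℕ → ℝ := fun n => ArithmeticFunction.vonMangoldt n * wInv n with ha
  have ha0 : ∀ n, 0 ≤ a n := vonMangoldt_mul_wInv_nonneg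
  set F : ℕ → ℝ → ℝ := fun n => (Set.Ici (Real.log n)).indicator
    (fun u => a n * Real.exp (-ε * u)) with hF
  have hF_int : ∀ n, MeasureTheory.IntegrableOn (F n) (Set.Ioi 0) := fun n =>
    MeasureTheory.Integrable.indicator ((exp_neg_integrableOn_Ioi 0 hε).const_mul (a n))
      measurableSet_Ici
  have hval : ∀ n, ∫ u in Set.Ioi (0 : ℝ), F n u =
      ArithmeticFunction.vonMangoldt n / ((n : ℝ) ^ (1 + ε) * Real.log n) / ε := fun n => by
    rw [hF, MeasureTheory.setIntegral_indicator measurableSet_Ici,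
      MeasureTheory.integral_const_mul]
    rcases lt_or_ge n 2 with h2 | h2
    · have : ArithmeticFunction.vonMangoldt n = 0 := by interval_cases n <;> simp
      simp [ha, this]
    · have hn : (1 : ℝ) < n := by exact_mod_cast h2
      have hlog := Real.log_pos hn
      have hs : Set.Ioi (0 : ℝ) ∩ Set.Ici (Real.log n) = Set.Ici (Real.log n) :=
        Set.inter_eq_right.mpr fun u hu => hlog.trans_le hu
      rw [hs, MeasureTheory.integral_Ici_eq_integral_Ioi, integral_exp_neg_mul hε]
      have e : Real.exp (-ε * Real.log n) = 1 / (n : ℝ) ^ ε := by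
        rw [Real.rpow_def_of_pos (by linarith), one_div, ← Real.exp_neg]; ring_nf
      rw [e, Real.rpow_add (by linarith), Real.rpow_one, ha]
      simp only [wInv]
      have := Real.rpow_pos_of_pos (show (0 : ℝ) < n by linarith) ε
      field_simp
  have hsum := summable_vonMangoldt_div_rpow_mul_log hε
  have hnorm : ∀ n u, ‖F n u‖ = F n u := fun n u => Real.norm_of_nonneg
    (Set.indicator_nonneg (fun u _ => mul_nonneg (ha0 n) (Real.exp_pos _).le) u)
  have hS := MeasureTheory.hasSum_integral_of_summable_integral_norm
    (μ := MeasureTheory.volume.restrict (Set.Ioi (0 : ℝ))) (F := F) hF_int (by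
      simp only [hnorm, hval]; exact hsum.div_const ε)
  simp only [hval] at hS
  have hT := hS.unique (hsum.hasSum.div_const ε)
  rw [← log_riemannZeta_eq (show 1 < 1 + ε by linarith)] at hT
  have e : ∀ u, ∑' n, F n u = mertensSum (Real.exp u) * Real.exp (-ε * u) := fun u => by
    rw [mertensSum_exp_eq_tsum, ← tsum_mul_right]
    refine tsum_congr fun n => ?_
    simp only [hF, Set.indicator_apply]
    split_ifs <;> simp [ha]
  simp only [e] at hT
  refine ⟨MeasureTheory.Integrable.of_integral_ne_zero ?_, hT⟩
  rw [hT]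
  exact div_ne_zero h0 hε.ne'

lemma log_riemannZeta_ne_zero {ε : ℝ} (hε : 0 < ε) :
    Real.log (riemannZeta ((1 + ε : ℝ) : ℂ)).re ≠ 0 := by
  rw [log_riemannZeta_eq (show 1 < 1 + ε by linarith)]
  refine ((summable_vonMangoldt_div_rpow_mul_log hε).tsum_pos (fun n => ?_) 2 ?_).ne'
  · have := Real.log_natCast_nonneg n
    have := ArithmeticFunction.vonMangoldt_nonneg (n := n)
    positivity
  · have h2 : 0 < Real.log 2 := Real.log_pos (by norm_num)
    rw [ArithmeticFunction.vonMangoldt_apply_prime Nat.prime_two]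
    push_cast
    positivity

/-- A form of Mertens' third theorem. -/
theorem tendsto_mertensDiff :
    Tendsto mertensDiff atTop (nhds Real.eulerMascheroniConstant) := by
  obtain ⟨C, hC, -⟩ := exists_tendsto_mertensDiff
  have hi : ∀ ε : ℝ, 0 < ε → _ := fun ε hε => integral_mertensSum_exp hε (log_riemannZeta_ne_zero hε)
  have hh := tendsto_mertensSum_exp_sub_log hC
  have hcomb : ∀ ε, 0 < ε → MeasureTheory.IntegrableOn (fun u =>
      (mertensSum (Real.exp u) - Real.log u - C) * Real.exp (-ε * u)) (Set.Ioi 0) ∧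
      ε * ∫ u in Set.Ioi (0 : ℝ), (mertensSum (Real.exp u) - Real.log u - C) * Real.exp (-ε * u) =
        Real.log (riemannZeta ((1 + ε : ℝ) : ℂ)).re + Real.log ε +
          Real.eulerMascheroniConstant - C := fun ε hε => by
    obtain ⟨h1, h2⟩ := hi ε hε
    obtain ⟨h3, h4⟩ := integral_log_mul_exp_neg_mul hε
    have h5 := (exp_neg_integrableOn_Ioi 0 hε).const_mul C
    simp only [sub_mul]
    have h6 : MeasureTheory.IntegrableOn (fun u => mertensSum (Real.exp u) * Real.exp (-ε * u) -
      Real.log u * Real.exp (-ε * u)) (Set.Ioi 0) := h1.sub h3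
    refine ⟨h6.sub h5, ?_⟩
    rw [MeasureTheory.integral_sub h6 h5, MeasureTheory.integral_sub h1 h3, h2, h4,
      MeasureTheory.integral_const_mul, integral_exp_neg_mul hε]
    field_simp
    simp
    ring
  have h1 := tendsto_mul_integral_exp_neg_mul hh fun ε hε => (hcomb ε hε).1
  have h2 : Tendsto (fun ε : ℝ => Real.log (riemannZeta ((1 + ε : ℝ) : ℂ)).re + Real.log ε +
      Real.eulerMascheroniConstant - C) (nhdsWithin 0 (Set.Ioi 0)) (nhds 0) :=
    h1.congr' (by filter_upwards [self_mem_nhdsWithin] with ε hε using (hcomb ε hε).2)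
  have h3 : Tendsto (fun s : ℝ => Real.log (riemannZeta s).re + Real.log (s - 1))
      (nhdsWithin 1 (Set.Ioi 1)) (nhds 0) :=
    (Asymptotics.isLittleO_one_iff ℝ).mp log_riemannZeta_add_log_sub_isLittleO_ofReal
  have h4 : Tendsto (fun ε : ℝ => 1 + ε) (nhdsWithin 0 (Set.Ioi 0)) (nhdsWithin 1 (Set.Ioi 1)) := by
    refine tendsto_nhdsWithin_iff.mpr ⟨?_, ?_⟩
    · have : Tendsto (fun ε : ℝ => 1 + ε) (nhds 0) (nhds (1 + 0)) :=
        tendsto_const_nhds.add tendsto_id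
      rw [add_zero] at this
      exact this.mono_left nhdsWithin_le_nhds
    · filter_upwards [self_mem_nhdsWithin] with ε hε
      have : 0 < ε := hε
      simpa using this
  have h5 := ((h3.comp h4).add_const Real.eulerMascheroniConstant).sub_const C
  have h6 := tendsto_nhds_unique h2 (h5.congr fun ε => by simp)
  have : C = Real.eulerMascheroniConstant := by linarith
  rwa [← this]

lemma mertensDiff_le {u : ℝ} (hu : 0 < u) :
    mertensDiff u ≤ Real.eulerMascheroniConstant + (1 / u + 1 / u ^ 2) * psiRem u +
      2 * (0.00735 + 3 * Real.exp (-u)) * (1 / u ^ 2 + 2 / u ^ 3) := by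
  obtain ⟨C, hC, h⟩ := exists_tendsto_mertensDiff
  rw [← tendsto_nhds_unique hC tendsto_mertensDiff]
  exact h u hu

/-- An explicit Mertens bound in terms of `ψ(x)`. -/
theorem mertensSum_le {x : ℝ} (hx : 1 < Chebyshev.psi x) :
    mertensSum x ≤ Real.log (Real.log (Chebyshev.psi x)) +
      mertensDiff (Real.log (Chebyshev.psi x)) := by
  have h := mertensSum_sub_le x hx
  have h2 : Chebyshev.psi x * wInv (Chebyshev.psi x) = 1 / Real.log (Chebyshev.psi x) := by
    have := Real.log_pos hx
    rw [wInv]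
    field_simp
  rw [mertensDiff]
  linarith

/-- The completely multiplicative function `n ↦ n⁻ᵗ`. -/
noncomputable def invPowHom (t : ℕ) : ℕ →* ℝ where
  toFun n := ((n : ℝ) ^ t)⁻¹
  map_one' := by simp
  map_mul' a b := by simp [mul_pow, mul_comm]

lemma invPowHom_apply (t n : ℕ) : invPowHom t n = ((n : ℝ) ^ t)⁻¹ := rfl

lemma invPowHom_prime_lt_one {t p : ℕ} (ht : t ≠ 0) (hp : p.Prime) : invPowHom t p < 1 := by
  have : (1 : ℝ) < p := by exact_mod_cast hp.one_lt
  exact inv_lt_one_of_one_lt₀ (one_lt_pow₀ this ht)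

lemma one_sub_invPow_inv_ge_one {t p : ℕ} (ht : t ≠ 0) (hp : p.Prime) :
    1 ≤ (1 - ((p : ℝ) ^ t)⁻¹)⁻¹ := by
  have h1 : 0 < 1 - ((p : ℝ) ^ t)⁻¹ := sub_pos.2 (invPowHom_prime_lt_one ht hp)
  have h2 : 0 ≤ ((p : ℝ) ^ t)⁻¹ := by positivity
  exact (one_le_inv₀ h1).2 (by linarith)

lemma sum_inv_pow_le_prod_primesLE {t : ℕ} (ht : t ≠ 0) (x : ℕ) :
    ∑ k ∈ range x, 1 / ((k : ℝ) + 1) ^ t ≤ ∏ p ∈ Nat.primesLE x, (1 - ((p : ℝ) ^ t)⁻¹)⁻¹ := by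
  have h := (EulerProduct.summable_and_hasSum_smoothNumbers_prod_primesBelow_geometric
    (f := invPowHom t) (fun {p} hp => by
      rw [Real.norm_of_nonneg (by rw [invPowHom_apply]; positivity)]
      exact invPowHom_prime_lt_one ht hp) (x + 1)).2
  have hmem (k : ℕ) (hk : k ∈ range x) : k + 1 ∈ Nat.smoothNumbers (x + 1) := by
    refine Nat.mem_smoothNumbers_of_lt (by omega) ?_
    have := Finset.mem_range.1 hk
    omega
  have h2 := sum_le_hasSum ((range x).attach.map
    ⟨fun k => (⟨k.1 + 1, hmem k.1 k.2⟩ : Nat.smoothNumbers (x + 1)), fun a b hab => by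
      have := congrArg Subtype.val hab
      exact Subtype.ext (Nat.add_right_cancel this)⟩) (fun i _ => by
      rw [invPowHom_apply]; positivity) h
  rw [Finset.sum_map] at h2
  replace h2 : ∑ k ∈ (range x).attach, (((k.1 + 1 : ℕ) : ℝ) ^ t)⁻¹ ≤
      ∏ p ∈ Nat.primesLE x, (1 - ((p : ℝ) ^ t)⁻¹)⁻¹ := h2
  rw [Finset.sum_attach (range x) (fun k => (((k + 1 : ℕ) : ℝ) ^ t)⁻¹)] at h2
  simpa using h2

lemma tsum_inv_pow_tail_le {t x : ℕ} (ht : 2 ≤ t) (hx : 0 < x) :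
    ∑' k : ℕ, 1 / (((k + x : ℕ) : ℝ) + 1) ^ t ≤ 1 / x := by
  have hx' : (0 : ℝ) < x := by exact_mod_cast hx
  refine Real.tsum_le_of_sum_range_le (fun k => by positivity) fun n => ?_
  have : ∑ k ∈ range n, 1 / (((k + x : ℕ) : ℝ) + 1) ^ t ≤ 1 / x - 1 / ((n : ℝ) + x) := by
    induction n with
    | zero => simp
    | succ n ih =>
      rw [sum_range_succ]
      have h1 : 1 / (((n + x : ℕ) : ℝ) + 1) ^ t ≤ 1 / ((n : ℝ) + x) - 1 / ((n : ℝ) + x + 1) := by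
        have hy : (0 : ℝ) < (n : ℝ) + x := by positivity
        rw [Nat.cast_add]
        calc 1 / ((n : ℝ) + x + 1) ^ t ≤ 1 / ((n : ℝ) + x + 1) ^ 2 := by
              gcongr
              linarith
          _ ≤ 1 / (((n : ℝ) + x) * ((n : ℝ) + x + 1)) := by
              gcongr
              nlinarith
          _ = _ := by field_simp; ring
      rw [show ((n + 1 : ℕ) : ℝ) + x = n + x + 1 by push_cast; ring]
      linarith
  have h2 : 0 ≤ 1 / ((n : ℝ) + x) := by positivity
  linarith

/-- Truncating the Euler product of `ζ(t)` at `x` loses a factor of at most `exp (2 / x)`. -/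
lemma tsum_inv_pow_le_exp_mul_prod {t x : ℕ} (ht : 2 ≤ t) (hx : 0 < x) :
    ∑' k : ℕ, 1 / ((k : ℝ) + 1) ^ t ≤
      Real.exp (2 / x) * ∏ p ∈ Nat.primesLE x, (1 - ((p : ℝ) ^ t)⁻¹)⁻¹ := by
  have hx' : (0 : ℝ) < x := by exact_mod_cast hx
  have hs : Summable fun k : ℕ => 1 / ((k : ℝ) + 1) ^ t := by
    have := (summable_nat_add_iff 1).2 (Real.summable_one_div_nat_pow.2 ht)
    simpa using this
  rw [← hs.sum_add_tsum_nat_add x]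
  have h1 := sum_inv_pow_le_prod_primesLE (t := t) (by omega) x
  have h2 := tsum_inv_pow_tail_le ht hx
  set P := ∏ p ∈ Nat.primesLE x, (1 - ((p : ℝ) ^ t)⁻¹)⁻¹ with hP
  have hP1 : 1 ≤ P := Finset.prod_induction _ (1 ≤ ·) (fun a b => one_le_mul_of_one_le_of_one_le) le_rfl fun p hp =>
    one_sub_invPow_inv_ge_one (by omega) (Nat.mem_primesLE.1 hp).2
  have h3 : 2 / (x : ℝ) + 1 ≤ Real.exp (2 / x) := Real.add_one_le_exp _
  have h4 : 0 < 1 / (x : ℝ) := by positivity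
  have h5 : 2 / (x : ℝ) = 2 * (1 / x) := by ring
  nlinarith

lemma neg_log_one_sub_le {q : ℝ} (h0 : 0 ≤ q) (h1 : q < 1) (m : ℕ) :
    -Real.log (1 - q) ≤
      ∑ k ∈ range m, q ^ (k + 1) / (k + 1) + q ^ (m + 1) / ((m + 1) * (1 - q)) := by
  have h := Real.hasSum_pow_div_log_of_abs_lt_one (abs_lt.2 ⟨by linarith, h1⟩)
  rw [← h.tsum_eq, ← h.summable.sum_add_tsum_nat_add m]
  have hg := ((hasSum_geometric_of_lt_one h0 h1).mul_left (q ^ (m + 1) / (m + 1)))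
  have h3 : ∑' k : ℕ, q ^ (k + m + 1) / (((k + m : ℕ) : ℝ) + 1) ≤
      ∑' k : ℕ, q ^ (m + 1) / (m + 1) * q ^ k := by
    refine Summable.tsum_le_tsum (fun k => ?_) ((summable_nat_add_iff m).2 h.summable) hg.summable
    rw [show q ^ (k + m + 1) = q ^ (m + 1) * q ^ k by ring, div_mul_eq_mul_div]
    push_cast
    gcongr
    linarith [(Nat.cast_nonneg k : (0 : ℝ) ≤ k)]
  rw [hg.tsum_eq] at h3
  have h4 : q ^ (m + 1) / ((m : ℝ) + 1) * (1 - q)⁻¹ = q ^ (m + 1) / ((m + 1) * (1 - q)) := by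
    rw [div_eq_mul_inv, div_eq_mul_inv, mul_inv, mul_assoc]
  linarith

lemma vonMangoldt_mul_wInv_prime_pow {p k : ℕ} (hp : p.Prime) :
    ArithmeticFunction.vonMangoldt (p ^ (k + 1)) * wInv ((p ^ (k + 1) : ℕ) : ℝ) =
      ((p : ℝ)⁻¹) ^ (k + 1) / (k + 1) := by
  have hp1 : (1 : ℝ) < p := by exact_mod_cast hp.one_lt
  have hl := Real.log_pos hp1
  rw [ArithmeticFunction.vonMangoldt_apply_pow (by omega),
    ArithmeticFunction.vonMangoldt_apply_prime hp, wInv]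
  push_cast
  rw [Real.log_pow, inv_pow]
  push_cast
  have : (p : ℝ) ^ (k + 1) ≠ 0 := by positivity
  field_simp

lemma sum_prime_pow_le_mertensSum (x : ℕ) :
    ∑ p ∈ Nat.primesLE x, ∑ k ∈ range (Nat.log p x), ((p : ℝ)⁻¹) ^ (k + 1) / (k + 1) ≤
      mertensSum x := by
  rw [Finset.sum_sigma', mertensSum, Nat.floor_natCast]
  set S := (Nat.primesLE x).sigma fun p => range (Nat.log p x) with hS
  have hS' : ∀ a ∈ S, a.1.Prime ∧ a.1 ≤ x ∧ a.2 < Nat.log a.1 x := fun a ha => by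
    rw [hS, Finset.mem_sigma, Nat.mem_primesLE, Finset.mem_range] at ha
    exact ⟨ha.1.2, ha.1.1, ha.2⟩
  have hinj : Set.InjOn (fun a : Σ _ : ℕ, ℕ => a.1 ^ (a.2 + 1)) (S : Set (Σ _ : ℕ, ℕ)) := by
    intro a ha b hb hab
    have := (hS' a ha).1.pow_inj' (hS' b hb).1 (Nat.succ_ne_zero _) (Nat.succ_ne_zero _) hab
    exact Sigma.ext this.1 (heq_of_eq (Nat.succ.inj this.2))
  calc _ = ∑ a ∈ S, ArithmeticFunction.vonMangoldt (a.1 ^ (a.2 + 1)) *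
          wInv ((a.1 ^ (a.2 + 1) : ℕ) : ℝ) :=
        Finset.sum_congr rfl fun a ha => (vonMangoldt_mul_wInv_prime_pow (hS' a ha).1).symm
    _ = ∑ n ∈ S.image (fun a => a.1 ^ (a.2 + 1)), ArithmeticFunction.vonMangoldt n * wInv n :=
        (Finset.sum_image (f := fun n : ℕ => ArithmeticFunction.vonMangoldt n * wInv n) hinj).symm
    _ ≤ _ := by
        refine Finset.sum_le_sum_of_subset_of_nonneg (fun n hn => ?_)
          fun n _ _ => vonMangoldt_mul_wInv_nonneg n
        obtain ⟨a, ha, rfl⟩ := Finset.mem_image.1 hn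
        obtain ⟨h1, h2, h3⟩ := hS' a ha
        refine Finset.mem_Ioc.2 ⟨pow_pos h1.pos _, ?_⟩
        have hx : x ≠ 0 := by have := h1.pos; omega
        exact Nat.pow_le_of_le_log hx (by omega)

/-- The remainder `1 / ((m + 1) p ^ m (p - 1))`, `m = ⌊log_p x⌋`. -/
noncomputable def primeRem (x p : ℕ) : ℝ :=
  1 / (((Nat.log p x : ℕ) + 1 : ℝ) * ((p : ℝ) ^ (Nat.log p x) * (p - 1)))

lemma sum_neg_log_le_mertensSum_add (x : ℕ) :
    ∑ p ∈ Nat.primesLE x, -Real.log (1 - (p : ℝ)⁻¹) ≤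
      mertensSum x + ∑ p ∈ Nat.primesLE x, primeRem x p := by
  refine le_trans ?_ (add_le_add_left (sum_prime_pow_le_mertensSum x) _)
  rw [← Finset.sum_add_distrib]
  refine Finset.sum_le_sum fun p hp => ?_
  have hp1 : (1 : ℝ) < p := by exact_mod_cast (Nat.mem_primesLE.1 hp).2.one_lt
  refine (neg_log_one_sub_le (by positivity) (inv_lt_one_of_one_lt₀ hp1) (Nat.log p x)).trans
    (le_of_eq ?_)
  congr 1
  rw [primeRem, inv_pow, pow_succ]
  have h1 : (p : ℝ) - 1 ≠ 0 := by linarith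
  have h2 : (p : ℝ) ≠ 0 := by linarith
  field_simp

lemma primeRem_le {x p m : ℕ} {c : ℝ} (hp : p.Prime) (hx : 0 < x) (hm : m ≤ Nat.log p x)
    (hc : 0 < c) (hpc : c * p ≤ (m + 1) * (p - 1)) : primeRem x p ≤ 1 / (c * x) := by
  have hp1 : (1 : ℝ) < p := by exact_mod_cast hp.one_lt
  have hx' : (0 : ℝ) < x := by exact_mod_cast hx
  have h1 : (x : ℝ) ≤ (p : ℝ) ^ (Nat.log p x) * p := by
    have := (Nat.lt_pow_succ_log_self hp.one_lt x).le
    rw [pow_succ] at this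
    exact_mod_cast this
  rw [primeRem]
  refine one_div_le_one_div_of_le (by positivity) ?_
  have hm' : (m : ℝ) ≤ (Nat.log p x : ℕ) := by exact_mod_cast hm
  have hpow : 0 < (p : ℝ) ^ (Nat.log p x) := by positivity
  calc c * x ≤ c * ((p : ℝ) ^ (Nat.log p x) * p) := by gcongr
    _ = (p : ℝ) ^ (Nat.log p x) * (c * p) := by ring
    _ ≤ (p : ℝ) ^ (Nat.log p x) * ((m + 1) * (p - 1)) := by gcongr
    _ = (m + 1) * ((p : ℝ) ^ (Nat.log p x) * (p - 1)) := by ring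
    _ ≤ _ := by
      have : 0 ≤ (p : ℝ) - 1 := by linarith
      gcongr

lemma primeRem_two_le {x : ℕ} (hx : 4 ≤ x) : primeRem x 2 ≤ 2 / (3 * x) := by
  have hx' : (0 : ℝ) < x := by positivity
  refine (primeRem_le (c := 3 / 2) Nat.prime_two (by omega)
    (Nat.le_log_of_pow_le (by norm_num) (by omega : 2 ^ 2 ≤ x)) (by norm_num)
    (by norm_num)).trans (le_of_eq ?_)
  field_simp

lemma primeRem_small_le {x p : ℕ} (hp : p.Prime) (hp2 : p ≠ 2) (hpx : p ^ 2 ≤ x) :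
    primeRem x p ≤ 1 / (2 * x) := by
  have h3 : (3 : ℝ) ≤ p := by exact_mod_cast (by have := hp.two_le; omega : 3 ≤ p)
  refine primeRem_le (c := 2) hp (lt_of_lt_of_le (pow_pos hp.pos 2) hpx)
    (Nat.le_log_of_pow_le hp.one_lt hpx) (by norm_num) ?_
  push_cast
  linarith

lemma primeRem_large_le {x p : ℕ} (hp : p.Prime) (hpx : p ≤ x) :
    primeRem x p ≤ 1 / (2 * (p * (p - 1))) := by
  have hp1 : (1 : ℝ) < p := by exact_mod_cast hp.one_lt
  have hl : 1 ≤ Nat.log p x := Nat.le_log_of_pow_le hp.one_lt (by simpa using hpx)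
  have hl' : (1 : ℝ) ≤ (Nat.log p x : ℕ) := by exact_mod_cast hl
  rw [primeRem]
  have h0 : 0 < (p : ℝ) - 1 := by linarith
  refine one_div_le_one_div_of_le (by positivity) ?_
  have : (p : ℝ) ≤ (p : ℝ) ^ (Nat.log p x) := le_self_pow₀ hp1.le (by omega)
  gcongr
  linarith

lemma sum_odd_tail_le {a b : ℕ} (ha : 0 < a) (hab : a ≤ b) :
    ∑ j ∈ Ico a b, 1 / (2 * (((2 * j + 1 : ℕ) : ℝ) * (((2 * j + 1 : ℕ) : ℝ) - 1))) ≤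
      1 / 4 * (1 / (2 * (a : ℝ) - 1 / 2)) - 1 / 4 * (1 / (2 * (b : ℝ) - 1 / 2)) := by
  induction b, hab using Nat.le_induction with
  | base => simp
  | succ b hab ih =>
    rw [Finset.sum_Ico_succ_top hab]
    have hb : (1 : ℝ) ≤ b := by exact_mod_cast (by omega : 1 ≤ b)
    have h1 : 0 < 2 * (b : ℝ) - 1 / 2 := by linarith
    have h2 : 0 < 2 * (b : ℝ) + 3 / 2 := by linarith
    have : 1 / (2 * (((2 * b + 1 : ℕ) : ℝ) * (((2 * b + 1 : ℕ) : ℝ) - 1))) ≤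
        1 / 4 * (1 / (2 * (b : ℝ) - 1 / 2)) - 1 / 4 * (1 / (2 * (b : ℝ) + 3 / 2)) := by
      have e : 1 / 4 * (1 / (2 * (b : ℝ) - 1 / 2)) - 1 / 4 * (1 / (2 * (b : ℝ) + 3 / 2)) =
          1 / (2 * ((2 * (b : ℝ) - 1 / 2) * (2 * (b : ℝ) + 3 / 2))) := by
        rw [← mul_sub, div_sub_div _ _ h1.ne' h2.ne', div_mul_div_comm,
          div_eq_div_iff (by positivity) (by positivity)]
        ring
      rw [e]
      refine one_div_le_one_div_of_le (by positivity) ?_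
      push_cast
      nlinarith
    rw [show 2 * ((b + 1 : ℕ) : ℝ) - 1 / 2 = 2 * (b : ℝ) + 3 / 2 by push_cast; ring]
    linarith

lemma sum_primeRem_le {x : ℕ} (hx : 20000 ≤ x) :
    ∑ p ∈ Nat.primesLE x, primeRem x p ≤ 0.51 / √x := by
  set s := Nat.sqrt x with hs
  have hs1 : 141 ≤ s := Nat.le_sqrt.2 (by omega)
  have hx0 : (0 : ℝ) < x := by positivity
  have hsx : (s : ℝ) ≤ √x := Real.nat_sqrt_le_real_sqrt
  have hxs : √x ≤ s + 1 := Real.real_sqrt_le_nat_sqrt_succ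
  have hss : √(x : ℝ) ^ 2 = x := Real.sq_sqrt hx0.le
  set P := Nat.primesLE x with hP
  have h2 : 2 ∈ P := Nat.mem_primesLE.2 ⟨by omega, Nat.prime_two⟩
  rw [← Finset.add_sum_erase _ _ h2, ← Finset.sum_filter_add_sum_filter_not (P.erase 2) (· ≤ s)]
  have hA := primeRem_two_le (x := x) (by omega)
  have hB : ∑ p ∈ (P.erase 2).filter (· ≤ s), primeRem x p ≤ (s / 2 : ℝ) * (1 / (2 * x)) := by
    have hcard : ((P.erase 2).filter (· ≤ s)).card ≤ s / 2 := by
      have hsub : (P.erase 2).filter (· ≤ s) ⊆ (Ico 1 (s / 2 + 1)).image (fun j => 2 * j + 1) := by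
        intro p hp
        rw [Finset.mem_filter, Finset.mem_erase, hP, Nat.mem_primesLE] at hp
        obtain ⟨⟨hp2, hpx, hpp⟩, hps⟩ := hp
        obtain ⟨k, hk⟩ := hpp.odd_of_ne_two hp2
        have := hpp.two_le
        exact Finset.mem_image.2 ⟨k, Finset.mem_Ico.2 ⟨by omega, by omega⟩, hk.symm⟩
      refine (Finset.card_le_card hsub).trans (Finset.card_image_le.trans ?_)
      simp
    have hcard' : (((P.erase 2).filter (· ≤ s)).card : ℝ) ≤ s / 2 :=
      (Nat.cast_le.2 hcard).trans Nat.cast_div_le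
    refine (Finset.sum_le_card_nsmul _ _ (1 / (2 * (x : ℝ))) fun p hp => ?_).trans ?_
    · rw [Finset.mem_filter, Finset.mem_erase, hP, Nat.mem_primesLE] at hp
      refine primeRem_small_le hp.1.2.2 hp.1.1 ?_
      rw [sq]
      exact Nat.le_sqrt.1 hp.2
    · rw [nsmul_eq_mul]
      gcongr
  have hC : ∑ p ∈ (P.erase 2).filter (¬ · ≤ s), primeRem x p ≤ 1 / 4 * (1 / ((s : ℝ) - 1 / 2)) := by
    have hsub : (P.erase 2).filter (¬ · ≤ s) ⊆
        (Ico ((s + 1) / 2) x).image (fun j => 2 * j + 1) := by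
      intro p hp
      rw [Finset.mem_filter, Finset.mem_erase, hP, Nat.mem_primesLE] at hp
      obtain ⟨⟨hp2, hpx, hpp⟩, hps⟩ := hp
      obtain ⟨k, hk⟩ := hpp.odd_of_ne_two hp2
      have := hpp.two_le
      exact Finset.mem_image.2 ⟨k, Finset.mem_Ico.2 ⟨by omega, by omega⟩, hk.symm⟩
    have hsx2 : s ≤ x := Nat.sqrt_le_self x
    have hc1 : (s : ℝ) ≤ 2 * (((s + 1) / 2 : ℕ) : ℝ) := by
      exact_mod_cast (by omega : s ≤ 2 * ((s + 1) / 2))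
    have hs2 : (141 : ℝ) ≤ s := by exact_mod_cast hs1
    calc ∑ p ∈ (P.erase 2).filter (¬ · ≤ s), primeRem x p
        ≤ ∑ p ∈ (P.erase 2).filter (¬ · ≤ s), 1 / (2 * ((p : ℝ) * (p - 1))) := by
          refine Finset.sum_le_sum fun p hp => ?_
          rw [Finset.mem_filter, Finset.mem_erase, hP, Nat.mem_primesLE] at hp
          exact primeRem_large_le hp.1.2.2 hp.1.2.1
      _ ≤ ∑ p ∈ (Ico ((s + 1) / 2) x).image (fun j : ℕ => 2 * j + 1),
            1 / (2 * ((p : ℝ) * (p - 1))) := by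
          refine Finset.sum_le_sum_of_subset_of_nonneg hsub fun p hp _ => ?_
          obtain ⟨j, _, rfl⟩ := Finset.mem_image.1 hp
          push_cast
          rw [add_sub_cancel_right]
          positivity
      _ = ∑ j ∈ Ico ((s + 1) / 2) x,
            1 / (2 * (((2 * j + 1 : ℕ) : ℝ) * (((2 * j + 1 : ℕ) : ℝ) - 1))) :=
          Finset.sum_image (f := fun p : ℕ => 1 / (2 * ((p : ℝ) * ((p : ℝ) - 1))))
            fun a _ b _ (hab : 2 * a + 1 = 2 * b + 1) => by omega
      _ ≤ _ := sum_odd_tail_le (by omega) (by omega)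
      _ ≤ 1 / 4 * (1 / (2 * (((s + 1) / 2 : ℕ) : ℝ) - 1 / 2)) := by
          have hx1 : (20000 : ℝ) ≤ x := by exact_mod_cast hx
          have : 0 < 1 / (2 * (x : ℝ) - 1 / 2) := one_div_pos.2 (by linarith)
          linarith
      _ ≤ _ := by
          gcongr
          linarith
  have hr : (141.4 : ℝ) ≤ √x := by
    refine Real.le_sqrt_of_sq_le ?_
    have hx1 : (20000 : ℝ) ≤ x := by exact_mod_cast hx
    norm_num
    linarith
  set r := √(x : ℝ) with hrdef
  have hA2 : 2 / (3 * (x : ℝ)) ≤ 0.005 / r := by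
    rw [← hss, div_le_div_iff₀ (by positivity) (by positivity)]
    nlinarith
  have hB2 : (s / 2 : ℝ) * (1 / (2 * x)) ≤ 0.25 / r := by
    rw [← hss, div_mul_div_comm, div_le_div_iff₀ (by positivity) (by positivity)]
    nlinarith
  have hC2 : 1 / 4 * (1 / ((s : ℝ) - 1 / 2)) ≤ 0.255 / r := by
    rw [div_mul_div_comm, div_le_div_iff₀ (by linarith) (by positivity)]
    nlinarith
  have : (0.51 : ℝ) / r = 0.005 / r + 0.25 / r + 0.255 / r := by ring
  linarith

lemma log_le_log_add_div_sub_one {a y : ℝ} (ha : 0 < a) (hy : 0 < y) :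
    Real.log y ≤ Real.log a + y / a - 1 := by
  have h := Real.log_le_sub_one_of_pos (div_pos hy ha)
  rw [Real.log_div hy.ne' ha.ne'] at h
  linarith

lemma log_two_pow_le (n : ℕ) : Real.log (2 ^ n) ≤ n * 0.6931471808 := by
  rw [Real.log_pow]
  have := Real.log_two_lt_d9
  gcongr

lemma log_ge_of_ge_20000 {x : ℝ} (hx : 20000 ≤ x) : 9.9 ≤ Real.log x := by
  have h1 : Real.log 20000 ≤ Real.log x := Real.log_le_log (by norm_num) hx
  have h2 : Real.log (20000 / 16384) = Real.log 20000 - Real.log (2 ^ 14) := by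
    rw [Real.log_div (by norm_num) (by norm_num)]
    norm_num
  have h3 := Real.le_log_one_add_of_nonneg (x := 20000 / 16384 - 1) (by norm_num)
  rw [add_sub_cancel, h2, Real.log_pow] at h3
  have := Real.log_two_gt_d9
  norm_num at h3
  linarith

lemma sqrt_sqrt_ge {x : ℝ} (hx : 20000 ≤ x) : 11.89 ≤ √√x := by
  refine Real.le_sqrt_of_sq_le (Real.le_sqrt_of_sq_le ?_)
  norm_num
  linarith

lemma log_eq_four_mul_log_sqrt_sqrt {x : ℝ} (hx : 0 ≤ x) : Real.log x = 4 * Real.log √√x := by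
  rw [Real.log_sqrt (Real.sqrt_nonneg _), Real.log_sqrt hx]
  ring

lemma log_le_sqrt_sqrt {x : ℝ} (hx : 20000 ≤ x) : Real.log x ≤ 0.84 * √√x := by
  have hz := sqrt_sqrt_ge hx
  rw [log_eq_four_mul_log_sqrt_sqrt (by linarith)]
  have h1 := log_le_log_add_div_sub_one (a := 12) (y := √√x) (by norm_num) (by linarith)
  have h2 : Real.log 12 = 2 * Real.log 2 + Real.log 3 := by
    rw [show (12 : ℝ) = 2 ^ 2 * 3 by norm_num, Real.log_mul (by norm_num) (by norm_num),
      Real.log_pow]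
    norm_num
  have := Real.log_two_lt_d9
  have := Real.log_three_lt_d9
  linarith

lemma theta_rpow_le {x : ℝ} (hx : 1 ≤ x) {k : ℕ} (hk : 4 ≤ k) :
    Chebyshev.theta (x ^ ((1 : ℝ) / k)) ≤ Real.log 4 * √√x := by
  have h0 : 0 ≤ x := by linarith
  refine (Chebyshev.theta_le_log4_mul_x (by positivity)).trans ?_
  have : x ^ ((1 : ℝ) / k) ≤ √√x := by
    rw [Real.sqrt_eq_rpow, Real.sqrt_eq_rpow, ← Real.rpow_mul h0]
    refine Real.rpow_le_rpow_of_exponent_le hx ?_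
    rw [show (1 : ℝ) / 2 * (1 / 2) = 1 / 4 by norm_num]
    have : (4 : ℝ) ≤ k := by exact_mod_cast hk
    gcongr
  have h4 : 0 < Real.log 4 := Real.log_pos (by norm_num)
  gcongr

lemma log_four_le : Real.log 4 ≤ 1.386295 := by
  have := log_two_pow_le 2
  norm_num at this ⊢
  linarith

lemma psi_sub_theta_le_mul_sqrt {x : ℝ} (hx : 20000 ≤ x) :
    Chebyshev.psi x - Chebyshev.theta x ≤ 3.35 * √x := by
  have hx0 : 0 ≤ x := by linarith
  rw [Chebyshev.psi_eq_theta_add_sum_theta (by linarith), add_sub_cancel_left]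
  have hz := sqrt_sqrt_ge hx
  have hl := log_le_sqrt_sqrt hx
  have hr : √√x ^ 2 = √x := Real.sq_sqrt (Real.sqrt_nonneg _)
  have h4 := log_four_le
  have h40 : 0 < Real.log 4 := Real.log_pos (by norm_num)
  set N := ⌊Real.log x / Real.log 2⌋₊ with hN
  have hlog2 := Real.log_two_gt_d9
  have hlog2' := Real.log_two_lt_d9
  have hN3 : 4 ≤ N := by
    refine Nat.le_floor ?_
    rw [le_div_iff₀ (by linarith)]
    have := log_ge_of_ge_20000 hx
    push_cast
    linarith
  have hNle : (N : ℝ) ≤ 1.212 * √√x := by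
    refine (Nat.floor_le (div_nonneg (Real.log_nonneg (by linarith)) (by linarith))).trans ?_
    rw [div_le_iff₀ (by linarith)]
    nlinarith
  rw [← Finset.insert_Icc_add_one_left_eq_Icc (by omega : 2 ≤ N),
    Finset.sum_insert (by simp), ← Finset.insert_Icc_add_one_left_eq_Icc (by omega : 2 + 1 ≤ N),
    Finset.sum_insert (by simp)]
  have hA : Chebyshev.theta (x ^ ((1 : ℝ) / (2 : ℕ))) ≤ Real.log 4 * √x := by
    rw [show ((2 : ℕ) : ℝ) = 2 by norm_num, ← Real.sqrt_eq_rpow]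
    exact Chebyshev.theta_le_log4_mul_x (Real.sqrt_nonneg _)
  have hB : Chebyshev.theta (x ^ ((1 : ℝ) / (2 + 1 : ℕ))) ≤ Real.log 4 * (√x / 5) := by
    refine (Chebyshev.theta_le_log4_mul_x (by positivity)).trans ?_
    have h5 : 5 ≤ x ^ ((1 : ℝ) / 6) := by
      rw [show (5 : ℝ) = (5 ^ (6 : ℝ)) ^ ((1 : ℝ) / 6) by
        rw [← Real.rpow_mul (by norm_num)]; norm_num]
      refine Real.rpow_le_rpow (by positivity) ?_ (by norm_num)
      norm_num
      linarith
    have h6 : √x = x ^ ((1 : ℝ) / (2 + 1 : ℕ)) * x ^ ((1 : ℝ) / 6) := by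
      rw [← Real.rpow_add (by linarith), Real.sqrt_eq_rpow]
      norm_num
    have h7 : 0 ≤ x ^ ((1 : ℝ) / (2 + 1 : ℕ)) := by positivity
    gcongr
    rw [h6, le_div_iff₀ (by norm_num)]
    gcongr
  have hC : ∑ k ∈ Icc (2 + 1 + 1) N, Chebyshev.theta (x ^ ((1 : ℝ) / k)) ≤
      N * (Real.log 4 * √√x) := by
    refine (Finset.sum_le_card_nsmul _ _ (Real.log 4 * √√x) fun k hk =>
      theta_rpow_le (by linarith) (Finset.mem_Icc.1 hk).1).trans ?_
    rw [nsmul_eq_mul, Nat.card_Icc]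
    gcongr
    omega
  have hD : (N : ℝ) * (Real.log 4 * √√x) ≤ Real.log 4 * (1.212 * √x) := by
    have : 0 < Real.log 4 * √√x := by positivity
    calc (N : ℝ) * (Real.log 4 * √√x) ≤ 1.212 * √√x * (Real.log 4 * √√x) := by gcongr
      _ = Real.log 4 * (1.212 * √√x ^ 2) := by ring
      _ = _ := by rw [hr]
  have hE : Real.log 4 * (2.412 * √x) ≤ 1.386295 * (2.412 * √x) := by gcongr
  have := Real.sqrt_nonneg x
  linarith

lemma psi_ge_mul {x : ℕ} (hx : 20000 ≤ x) : 0.6926 * (x : ℝ) ≤ Chebyshev.psi x := by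
  have hx' : (20000 : ℝ) ≤ x := by exact_mod_cast hx
  have h := Chebyshev.psi_ge x
  have h1 := log_le_log_add_div_sub_one (a := 2 ^ 14) (y := (x : ℝ) + 1) (by norm_num) (by linarith)
  have h2 := log_two_pow_le 14
  have := Real.log_two_gt_d9
  norm_num at h1 h2
  nlinarith

lemma sqrt_le_mul {x : ℝ} (hx : 20000 ≤ x) : √x ≤ 0.00708 * x := by
  have h : (141.4 : ℝ) ≤ √x := by
    refine Real.le_sqrt_of_sq_le ?_
    norm_num
    linarith
  have : √x ^ 2 = x := Real.sq_sqrt (by linarith)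
  nlinarith

lemma theta_ge_mul {x : ℕ} (hx : 20000 ≤ x) : 0.668 * (x : ℝ) ≤ Chebyshev.theta x := by
  have hx' : (20000 : ℝ) ≤ x := by exact_mod_cast hx
  have h1 := psi_ge_mul hx
  have h2 := psi_sub_theta_le_mul_sqrt hx'
  have h3 := sqrt_le_mul hx'
  linarith

lemma psi_le_mul {x : ℝ} (hx : 20000 ≤ x) : Chebyshev.psi x ≤ 1.411 * x := by
  have h2 := psi_sub_theta_le_mul_sqrt hx
  have h3 := sqrt_le_mul hx
  have h4 := Chebyshev.theta_le_log4_mul_x (by linarith : 0 ≤ x)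
  have := log_four_le
  nlinarith

lemma log_psi_bounds {x : ℕ} (hx : 20000 ≤ x) :
    Real.log x - 0.3678 ≤ Real.log (Chebyshev.psi x) ∧
      Real.log (Chebyshev.psi x) ≤ Real.log x + 0.3466 := by
  have hx' : (20000 : ℝ) ≤ x := by exact_mod_cast hx
  have hl2 := Real.log_two_lt_d9
  constructor
  · have h1 := Real.log_le_log (by linarith) (psi_ge_mul hx)
    rw [Real.log_mul (by norm_num) (by linarith)] at h1
    have h2 := log_le_log_add_div_sub_one (a := 2) (y := (0.6926⁻¹) ^ 2) (by norm_num) (by norm_num)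
    rw [Real.log_pow, Real.log_inv] at h2
    norm_num at h2 h1 ⊢
    linarith
  · have h0 : 0 < Chebyshev.psi x := by have := psi_ge_mul hx; linarith
    have h1 := Real.log_le_log h0 (psi_le_mul hx')
    rw [Real.log_mul (by norm_num) (by linarith)] at h1
    have h2 := Real.log_le_log (by norm_num) (by norm_num : (1.411 : ℝ) ^ 2 ≤ 2)
    rw [Real.log_pow] at h2
    norm_num at h2 h1 ⊢
    linarith

lemma log_theta_ge {x : ℕ} (hx : 20000 ≤ x) :
    Real.log x - 0.404 ≤ Real.log (Chebyshev.theta x) := by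
  have hx' : (20000 : ℝ) ≤ x := by exact_mod_cast hx
  have hl2 := Real.log_two_lt_d9
  have h1 := Real.log_le_log (by linarith) (theta_ge_mul hx)
  rw [Real.log_mul (by norm_num) (by linarith)] at h1
  have h2 := log_le_log_add_div_sub_one (a := 2 ^ 3) (y := (0.668⁻¹) ^ 5) (by norm_num)
    (by norm_num)
  rw [Real.log_pow, Real.log_inv, Real.log_pow] at h2
  norm_num at h2 h1 ⊢
  linarith

lemma sqrt_terms_le {x : ℕ} (hx : 20000 ≤ x) {c z₀ : ℝ} (hc : 0 < c) (hz₀ : 0 < z₀)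
    (hz : z₀ ≤ √√(x : ℝ)) (hl : Real.log x ≤ c * √√(x : ℝ)) :
    0.51 / √(x : ℝ) * (Real.log x * Real.log (Chebyshev.theta x)) +
      (Chebyshev.psi x - Chebyshev.theta x) * Real.log x / Chebyshev.theta x ≤
      0.51 * (c ^ 2 + 0.3466 * (c / z₀)) + 5.02 * (c / z₀) := by
  have hx' : (20000 : ℝ) ≤ x := by exact_mod_cast hx
  have hth := theta_ge_mul hx
  have hlx := log_ge_of_ge_20000 hx'
  have hlt : Real.log (Chebyshev.theta x) ≤ Real.log x + 0.3466 :=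
    (Real.log_le_log (by linarith) (Chebyshev.theta_le_psi _)).trans (log_psi_bounds hx).2
  have hdiff := psi_sub_theta_le_mul_sqrt hx'
  have hr : √√(x : ℝ) ^ 2 = √(x : ℝ) := Real.sq_sqrt (Real.sqrt_nonneg _)
  have hr2 : √(x : ℝ) ^ 2 = x := Real.sq_sqrt (by linarith)
  have hcz : c / √√(x : ℝ) ≤ c / z₀ := by gcongr
  set z := √√(x : ℝ) with hzdef
  have hz0 : 0 < z := by linarith
  have h1 : 0.51 / √(x : ℝ) * (Real.log x * Real.log (Chebyshev.theta x)) ≤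
      0.51 * (c ^ 2 + 0.3466 * (c / z)) := by
    have : Real.log x * Real.log (Chebyshev.theta x) ≤ (c * z) * (c * z + 0.3466) := by
      refine mul_le_mul hl (by linarith) ?_ (by positivity)
      have := log_theta_ge hx
      linarith
    rw [← hr]
    calc _ ≤ 0.51 / z ^ 2 * ((c * z) * (c * z + 0.3466)) := by gcongr
      _ = _ := by field_simp
  have h2 : (Chebyshev.psi x - Chebyshev.theta x) * Real.log x / Chebyshev.theta x ≤
      5.02 * (c / z) := by
    have hxz : (x : ℝ) = z ^ 4 := by rw [← hr2, ← hr]; ring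
    calc _ ≤ (3.35 * z ^ 2) * (c * z) / (0.668 * z ^ 4) := by
          have hth' : 0.668 * z ^ 4 ≤ Chebyshev.theta x := hth.trans' (by rw [hxz])
          rw [hr]
          gcongr
      _ = 3.35 / 0.668 * (c / z) := by field_simp
      _ ≤ _ := by
        have : 0 < c / z := by positivity
        gcongr
        norm_num
  linarith

lemma exp_neg_le_of_nine_le {u : ℝ} (hu : 9 ≤ u) : Real.exp (-u) ≤ 0.000124 := by
  have h1 : Real.exp (-u) ≤ Real.exp (-9) := Real.exp_le_exp.2 (by linarith)
  have h2 : Real.exp 9 = Real.exp 1 ^ 9 := by rw [← Real.exp_nat_mul]; norm_num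
  have h3 : (2.718 : ℝ) ^ 9 ≤ Real.exp 1 ^ 9 := by
    have := Real.exp_one_gt_d9
    gcongr
    linarith
  refine h1.trans ?_
  rw [Real.exp_neg, h2]
  refine (inv_anti₀ (by positivity) h3).trans ?_
  norm_num

lemma log_mul_log_theta_le {x : ℕ} (hx : 20000 ≤ x) :
    Real.log x * Real.log (Chebyshev.theta x) ≤
      (Real.log (Chebyshev.psi x) + 0.3678) * Real.log (Chebyshev.psi x) := by
  have hx' : (20000 : ℝ) ≤ x := by exact_mod_cast hx
  have hth := theta_ge_mul hx
  have hlx := log_ge_of_ge_20000 hx'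
  have hL := (log_psi_bounds hx).1
  have := log_theta_ge hx
  exact mul_le_mul (by linarith)
    (Real.log_le_log (by linarith) (Chebyshev.theta_le_psi _)) (by linarith) (by linarith)

lemma secondary_term_le {L K : ℝ} (hL : 9.53 ≤ L) (hK0 : 0 ≤ K)
    (hK : K ≤ (L + 0.3678) * L) :
    2 * (0.00735 + 3 * Real.exp (-L)) * (1 / L ^ 2 + 2 / L ^ 3) * K ≤ 0.0197 := by
  have h0 : 0 < L := by linarith
  have he := exp_neg_le_of_nine_le (by linarith : 9 ≤ L)
  have hep := Real.exp_pos (-L)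
  have hi : 1 / L ≤ 0.10494 := by
    rw [div_le_iff₀ h0]
    linarith
  calc _ ≤ 2 * (0.00735 + 3 * 0.000124) * (1 / L ^ 2 + 2 / L ^ 3) * ((L + 0.3678) * L) := by gcongr
    _ = 2 * (0.00735 + 3 * 0.000124) * ((1 + 0.3678 * (1 / L)) * (1 + 2 * (1 / L))) := by
      field_simp
    _ ≤ 2 * (0.00735 + 3 * 0.000124) * ((1 + 0.3678 * 0.10494) * (1 + 2 * 0.10494)) := by gcongr
    _ ≤ _ := by norm_num

lemma main_term_le {L K R b : ℝ} (hL : 9.53 ≤ L) (hK0 : 0 ≤ K) (hK : K ≤ (L + 0.3678) * L)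
    (hb : 0 ≤ b) (hR : L * R ≤ b) :
    (1 / L + 1 / L ^ 2) * R * K ≤ (1 + 1.407 * (1 / L)) * b := by
  have h0 : 0 < L := by linarith
  have hi : 1 / L ≤ 0.105 := by
    rw [div_le_iff₀ h0]
    linarith
  calc (1 / L + 1 / L ^ 2) * R * K = (1 / L + 1 / L ^ 2) * (1 / L) * K * (L * R) := by field_simp
    _ ≤ (1 / L + 1 / L ^ 2) * (1 / L) * K * b := by gcongr
    _ ≤ (1 / L + 1 / L ^ 2) * (1 / L) * ((L + 0.3678) * L) * b := by gcongr
    _ = (1 + 1 / L) * (1 + 0.3678 * (1 / L)) * b := by field_simp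
    _ ≤ _ := by
      have : 0 < 1 / L := by positivity
      gcongr
      nlinarith

lemma mul_psiRem_le_of_twenty_le {u : ℝ} (hu : 20 ≤ u) : u * psiRem u ≤ 0.895 := by
  have h := mul_psiRem_le (by linarith : 0 < u)
  have h1 : u * Real.exp (-u / 2) ≤ 2 := by
    have h2 := Real.add_one_le_exp (u / 2)
    rw [show -u / 2 = -(u / 2) by ring, Real.exp_neg, ← div_eq_mul_inv,
      div_le_iff₀ (Real.exp_pos _)]
    linarith
  have h2 : u * Real.exp (-u) ≤ 2 * 0.000124 := by
    have h3 := exp_neg_le_of_nine_le (by linarith : 9 ≤ u / 2)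
    have e : u * Real.exp (-u) = u * Real.exp (-u / 2) * Real.exp (-(u / 2)) := by
      rw [mul_assoc, ← Real.exp_add]
      ring_nf
    rw [e]
    exact mul_le_mul h1 h3 (Real.exp_pos _).le (by norm_num)
  have h3 : Real.exp (-1) ≤ 0.3679 := by
    rw [Real.exp_neg]
    have := Real.exp_one_gt_d9
    refine (inv_anti₀ (by norm_num) (by linarith : (2.7182 : ℝ) ≤ Real.exp 1)).trans ?_
    norm_num
  linarith

lemma sqrt_sqrt_ge_of_log {x z₀ ℓ : ℝ} (hx : 0 < x) (hz₀ : 0 < z₀) (hz : 4 * Real.log z₀ ≤ ℓ)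
    (hl : ℓ ≤ Real.log x) : z₀ ≤ √√x := by
  rw [log_eq_four_mul_log_sqrt_sqrt hx.le] at hl
  have h0 : 0 < √√x := by positivity
  exact (Real.log_le_log_iff hz₀ h0).1 (by linarith)

lemma total_error_le {x : ℕ} (hx : 20000 ≤ x) {L K : ℝ} (hLdef : L = Real.log (Chebyshev.psi x))
    (hKdef : K = Real.log x * Real.log (Chebyshev.theta x)) :
    (1 / L + 1 / L ^ 2) * psiRem L * K +
      2 * (0.00735 + 3 * Real.exp (-L)) * (1 / L ^ 2 + 2 / L ^ 3) * K +
      (0.51 / √(x : ℝ) * K +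
        (Chebyshev.psi x - Chebyshev.theta x) * Real.log x / Chebyshev.theta x) ≤ 1.11 := by
  have hx' : (20000 : ℝ) ≤ x := by exact_mod_cast hx
  have hlx := log_ge_of_ge_20000 hx'
  obtain ⟨hL1, hL2⟩ := log_psi_bounds hx
  have hlt := log_theta_ge hx
  have hK := log_mul_log_theta_le hx
  have hK0 : 0 ≤ K := by
    rw [hKdef]
    exact mul_nonneg (by linarith) (by linarith)
  have hsq := @sqrt_terms_le x hx
  rw [← hLdef] at hK hL1 hL2
  rw [← hKdef] at hK hsq
  have hL : 9.53 ≤ L := by linarith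
  have hL0 : 0 < L := by linarith
  have h2 := secondary_term_le hL hK0 hK
  have hlog2 := Real.log_two_lt_d9
  rcases le_total L 20 with h20 | h20
  · have hR := psiRem_le hL0
    rcases le_total L 13 with h13 | h13
    · have he := exp_neg_le_of_nine_le (by linarith : 9 ≤ L)
      have h1 := main_term_le (R := psiRem L) (b := L * 0.0243) hL hK0 hK (by positivity)
        (by gcongr; linarith)
      have e : (1 + 1.407 * (1 / L)) * (L * 0.0243) = (L + 1.407) * 0.0243 := by field_simp
      have h3 := hsq (c := 0.84) (z₀ := 11.89) (by norm_num) (by norm_num)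
        (sqrt_sqrt_ge hx') (log_le_sqrt_sqrt hx')
      norm_num at h3
      linarith
    · have he := exp_neg_le_of_nine_le (by linarith : 9 ≤ L)
      have h1 := main_term_le (R := psiRem L) (b := L * 0.0243) hL hK0 hK (by positivity)
        (by gcongr; linarith)
      have e : (1 + 1.407 * (1 / L)) * (L * 0.0243) = (L + 1.407) * 0.0243 := by field_simp
      have hl16 := log_two_pow_le 4
      norm_num at hl16
      have hz : 20.3 ≤ √√(x : ℝ) := by
        refine sqrt_sqrt_ge_of_log (ℓ := 12.65) (by linarith) (by norm_num) ?_ (by linarith)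
        have := log_le_log_add_div_sub_one (a := 16) (y := 20.3) (by norm_num) (by norm_num)
        norm_num at this ⊢
        linarith
      have hl : Real.log x ≤ 0.6 * √√(x : ℝ) := by
        rw [log_eq_four_mul_log_sqrt_sqrt (by linarith)]
        have := log_le_log_add_div_sub_one (a := 16) (y := √√(x : ℝ)) (by norm_num) (by linarith)
        linarith
      have h3 := hsq (c := 0.6) (z₀ := 20.3) (by norm_num) (by norm_num) hz hl
      norm_num at h3
      linarith
  · have h1 := main_term_le (R := psiRem L) (b := 0.895) hL hK0 hK (by norm_num)
      (mul_psiRem_le_of_twenty_le h20)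
    have hi : 1 / L ≤ 0.05 := by
      rw [div_le_iff₀ hL0]
      linarith
    have hl64 := log_two_pow_le 6
    norm_num at hl64
    have hz : 100 ≤ √√(x : ℝ) := by
      refine sqrt_sqrt_ge_of_log (ℓ := 19.65) (by linarith) (by norm_num) ?_ (by linarith)
      have := log_le_log_add_div_sub_one (a := 64) (y := 100) (by norm_num) (by norm_num)
      norm_num at this ⊢
      linarith
    have hl : Real.log x ≤ 0.19 * √√(x : ℝ) := by
      rw [log_eq_four_mul_log_sqrt_sqrt (by linarith)]
      have := log_le_log_add_div_sub_one (a := 64) (y := √√(x : ℝ)) (by norm_num) (by linarith)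
      linarith
    have h3 := hsq (c := 0.19) (z₀ := 100) (by norm_num) (by norm_num) hz hl
    norm_num at h3
    linarith

lemma log_log_psi_sub_le {x : ℕ} (hx : 20000 ≤ x) :
    Real.log (Real.log (Chebyshev.psi x)) - Real.log (Real.log (Chebyshev.theta x)) ≤
      (Chebyshev.psi x - Chebyshev.theta x) /
        (Chebyshev.theta x * Real.log (Chebyshev.theta x)) := by
  have hx' : (20000 : ℝ) ≤ x := by exact_mod_cast hx
  have hth := theta_ge_mul hx
  have hlx := log_ge_of_ge_20000 hx'
  have hlt := log_theta_ge hx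
  have hle := Chebyshev.theta_le_psi x
  have h0 : 0 < Chebyshev.theta x := by linarith
  have h1 : 0 < Real.log (Chebyshev.theta x) := by linarith
  have h2 := Real.log_le_log h0 hle
  have h3 := log_le_log_add_div_sub_one h1 (by linarith : 0 < Real.log (Chebyshev.psi x))
  have h4 := log_le_log_add_div_sub_one h0 (by linarith : 0 < Chebyshev.psi x)
  calc _ ≤ (Real.log (Chebyshev.psi x) - Real.log (Chebyshev.theta x)) /
        Real.log (Chebyshev.theta x) := by
        rw [sub_div, div_self h1.ne']
        linarith
    _ ≤ ((Chebyshev.psi x - Chebyshev.theta x) / Chebyshev.theta x) /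
        Real.log (Chebyshev.theta x) := by
        rw [sub_div (Chebyshev.psi _), div_self h0.ne']
        exact div_le_div_of_nonneg_right (by linarith) h1.le
    _ = _ := by rw [div_div]

/-- An explicit form of Mertens' third theorem, in terms of `θ(x)`. -/
theorem sum_neg_log_one_sub_inv_prime_le {x : ℕ} (hx : 20000 ≤ x) :
    ∑ p ∈ Nat.primesLE x, -Real.log (1 - (p : ℝ)⁻¹) ≤
      Real.eulerMascheroniConstant + Real.log (Real.log (Chebyshev.theta x)) +
        Real.log (1 + 1.1253 / (Real.log x * Real.log (Chebyshev.theta x))) := by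
  have hx' : (20000 : ℝ) ≤ x := by exact_mod_cast hx
  have hlx := log_ge_of_ge_20000 hx'
  have hlt := log_theta_ge hx
  have hth := theta_ge_mul hx
  have hpsi := psi_ge_mul hx
  have h0 : 0 < Chebyshev.theta x := by linarith
  have h1 := sum_neg_log_le_mertensSum_add x
  have h2 := sum_primeRem_le hx
  have h3 := mertensSum_le (x := x) (by linarith)
  have hLpos : 0 < Real.log (Chebyshev.psi x) := by
    have := (log_psi_bounds hx).1
    linarith
  have h4 := mertensDiff_le hLpos
  have h5 := log_log_psi_sub_le hx
  have h6 := total_error_le hx rfl rfl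
  set L := Real.log (Chebyshev.psi x) with hL
  set M := Real.log (Chebyshev.theta x) with hM
  have hMpos : 0 < M := by linarith
  set K := Real.log x * M with hK
  have hK94 : 93.9 ≤ K := by
    have : 9.9 * 9.49 ≤ Real.log x * M := mul_le_mul (by linarith) (by linarith) (by norm_num)
      (by linarith)
    linarith
  have hK0 : 0 < K := by linarith
  set S := (1 / L + 1 / L ^ 2) * psiRem L +
      2 * (0.00735 + 3 * Real.exp (-L)) * (1 / L ^ 2 + 2 / L ^ 3) + 0.51 / √(x : ℝ) +
      (Chebyshev.psi x - Chebyshev.theta x) / (Chebyshev.theta x * M) with hS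
  have hSK : S * K ≤ 1.11 := by
    refine le_trans (le_of_eq ?_) h6
    have e : (Chebyshev.psi x - Chebyshev.theta x) / (Chebyshev.theta x * M) * K =
        (Chebyshev.psi x - Chebyshev.theta x) * Real.log x / Chebyshev.theta x := by
      rw [hK]
      field_simp
    rw [hS, add_mul, add_mul, add_mul, e]
    ring
  have hS2 : S ≤ Real.log (1 + 1.1253 / K) := by
    refine le_trans ?_ (Real.le_log_one_add_of_nonneg (by positivity))
    have e : 2 * (1.1253 / K) / (1.1253 / K + 2) = 2 * 1.1253 / (1.1253 + 2 * K) := by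
      field_simp
    rw [e, le_div_iff₀ (by linarith)]
    have hS3 : S ≤ 0.012 := by
      by_contra hcon
      push Not at hcon
      nlinarith
    nlinarith
  linarith

/-- The number of `n ∈ [a, a + 2 ^ k)` coprime to `Q`, computed by bisection. -/
def coprimeCount (Q : ℕ) : ℕ → ℕ → ℕ
  | 0, a => if Nat.gcd a Q = 1 then 1 else 0
  | k + 1, a => coprimeCount Q k a + coprimeCount Q k (a + 2 ^ k)

lemma coprimeCount_eq_count (Q k a : ℕ) :
    coprimeCount Q k a = Nat.count (fun i => Nat.gcd (a + i) Q = 1) (2 ^ k) := by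
  induction k generalizing a with
  | zero =>
    simp [coprimeCount, Nat.count_eq_card_filter_range, Finset.filter_singleton]
    split_ifs <;> simp
  | succ k ih =>
    rw [coprimeCount, ih, ih, pow_succ, mul_two, Nat.count_add]
    simp only [add_assoc]

lemma factorial_139_eq : Nat.factorial 139 =
    96157231969410890041971956135297253988256079629956908500367081914696145479218112119985149618783441690577636407442564169301886059792163365100096999581219760002673769583579570682891939608962934200435638009856000000000000000000000000000000000 := by
  decide +kernel

lemma count_gcd_factorial_eq :
    Nat.count (fun i => Nat.gcd i (Nat.factorial 139) = 1) 20000 = 2229 := by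
  rw [factorial_139_eq, show 20000 = 2 ^ 14 + 2 ^ 11 + 2 ^ 10 + 2 ^ 9 + 2 ^ 5 by norm_num,
    Nat.count_add, Nat.count_add, Nat.count_add, Nat.count_add, ← coprimeCount_eq_count,
    ← coprimeCount_eq_count, ← coprimeCount_eq_count, ← coprimeCount_eq_count]
  have h := coprimeCount_eq_count (Nat.factorial 139) 14 0
  rw [factorial_139_eq] at h
  simp only [zero_add] at h
  rw [← h]
  decide +kernel

lemma card_primes_lt_140 : ((range 140).filter Nat.Prime).card ≤ 34 := by
  decide +kernel

lemma count_prime_20000_le : Nat.count Nat.Prime 20000 ≤ 2262 := by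
  rw [Nat.count_eq_card_filter_range]
  have h := count_gcd_factorial_eq
  rw [Nat.count_eq_card_filter_range] at h
  set T := (range 20000).filter fun i => Nat.gcd i (Nat.factorial 139) = 1 with hT
  have h1 : 1 ∈ T := by simp [hT]
  have hsub : (range 20000).filter Nat.Prime ⊆ (range 140).filter Nat.Prime ∪ T.erase 1 := by
    intro p hp
    obtain ⟨hp1, hp2⟩ := Finset.mem_filter.1 hp
    by_cases hlt : p < 140
    · exact Finset.mem_union_left _ (Finset.mem_filter.2 ⟨Finset.mem_range.2 hlt, hp2⟩)
    · refine Finset.mem_union_right _ (Finset.mem_erase.2 ⟨hp2.one_lt.ne', ?_⟩)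
      refine Finset.mem_filter.2 ⟨hp1, (Nat.Prime.coprime_iff_not_dvd hp2).2 ?_⟩
      rw [hp2.dvd_factorial]
      omega
  refine (Finset.card_le_card hsub).trans ((Finset.card_union_le _ _).trans ?_)
  rw [Finset.card_erase_of_mem h1]
  have := card_primes_lt_140
  omega

lemma nthPrime_ge {m : ℕ} (hm : 2263 ≤ m) : 20000 ≤ nthPrime m := by
  by_contra hcon
  push Not at hcon
  have h1 : Nat.count Nat.Prime (nthPrime m + 1) ≤ Nat.count Nat.Prime 20000 :=
    Nat.count_monotone _ hcon
  rw [Nat.count_succ, nthPrime, Nat.count_nth_of_infinite Nat.infinite_setOfPred_prime,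
    if_pos (Nat.prime_nth_prime _)] at h1
  have := count_prime_20000_le
  omega

lemma primesLE_nthPrime {m : ℕ} (hm : 0 < m) :
    Nat.primesLE (nthPrime m) = (range m).image (Nat.nth Nat.Prime) := by
  have hmono := Nat.nth_strictMono Nat.infinite_setOfPred_prime
  ext p
  rw [Nat.mem_primesLE, Finset.mem_image, nthPrime]
  constructor
  · rintro ⟨h1, h2⟩
    refine ⟨Nat.count Nat.Prime p, ?_, Nat.nth_count h2⟩
    rw [← Nat.nth_count h2, hmono.le_iff_le] at h1
    exact Finset.mem_range.2 (by omega)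
  · rintro ⟨k, hk, rfl⟩
    refine ⟨hmono.monotone ?_, Nat.prime_nth_prime k⟩
    have := Finset.mem_range.1 hk
    omega

lemma prod_range_nth_prime {m : ℕ} (hm : 0 < m) (g : ℕ → ℝ) :
    ∏ k ∈ range m, g (Nat.nth Nat.Prime k) = ∏ p ∈ Nat.primesLE (nthPrime m), g p := by
  rw [primesLE_nthPrime hm, Finset.prod_image]
  exact fun a _ b _ h => Nat.nth_injective Nat.infinite_setOfPred_prime h

lemma log_primorialAt {m : ℕ} (hm : 0 < m) :
    Real.log (primorialAt m) = Chebyshev.theta (nthPrime m) := by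
  rw [Chebyshev.theta_eq_sum_primesLE_log, primorialAt, Nat.cast_prod,
    prod_range_nth_prime hm (fun p => (p : ℝ)), Real.log_prod]
  intro p hp
  have := (Nat.mem_primesLE.1 hp).2.pos
  positivity

/-- Among sets of `k` primes, the first `k` primes minimise the product of an increasing
function. -/
lemma prod_nth_prime_le_prod {f : ℕ → ℝ} (hpos : ∀ p, p.Prime → 0 < f p)
    (hmono : ∀ p q, p.Prime → p ≤ q → f p ≤ f q) (S : Finset ℕ) (hS : ∀ p ∈ S, p.Prime) :
    ∏ k ∈ range S.card, f (Nat.nth Nat.Prime k) ≤ ∏ p ∈ S, f p := by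
  induction S using Finset.induction_on_max with
  | empty => simp
  | insert a s ha ih =>
    have hna : a ∉ s := fun h => lt_irrefl _ (ha a h)
    have hpa : a.Prime := hS a (Finset.mem_insert_self _ _)
    rw [Finset.card_insert_of_notMem hna, Finset.prod_range_succ, Finset.prod_insert hna, mul_comm]
    have hcard : s.card ≤ Nat.count Nat.Prime a := by
      rw [Nat.count_eq_card_filter_range]
      exact Finset.card_le_card fun p hp => Finset.mem_filter.2
        ⟨Finset.mem_range.2 (ha p hp), hS p (Finset.mem_insert_of_mem hp)⟩
    have hnth : Nat.nth Nat.Prime s.card ≤ a := by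
      rw [← Nat.nth_count hpa]
      exact (Nat.nth_strictMono Nat.infinite_setOfPred_prime).monotone hcard
    exact mul_le_mul (hmono _ _ (Nat.prime_nth_prime _) hnth)
      (ih fun p hp => hS p (Finset.mem_insert_of_mem hp))
      (Finset.prod_nonneg fun k _ => (hpos _ (Nat.prime_nth_prime k)).le) (hpos a hpa).le

lemma card_primeFactors_le {N m : ℕ} (hN0 : N ≠ 0) (hN : N < primorialAt (m + 1)) :
    N.primeFactors.card ≤ m := by
  by_contra hcon
  push Not at hcon
  have h1 := prod_nth_prime_le_prod (f := fun p => (p : ℝ))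
    (fun p hp => by exact_mod_cast hp.pos) (fun p q _ h => by exact_mod_cast h)
    N.primeFactors fun p hp => Nat.prime_of_mem_primeFactors hp
  have h2 : ∏ p ∈ N.primeFactors, p ≤ N :=
    Nat.le_of_dvd (Nat.pos_of_ne_zero hN0) (Nat.prod_primeFactors_dvd N)
  have h3 : primorialAt (m + 1) ≤ ∏ k ∈ range N.primeFactors.card, Nat.nth Nat.Prime k :=
    Finset.prod_le_prod_of_subset_of_one_le' (Finset.range_subset_range.2 hcon)
      fun k _ _ => (Nat.prime_nth_prime k).pos
  have h4 : ∏ k ∈ range N.primeFactors.card, Nat.nth Nat.Prime k ≤ ∏ p ∈ N.primeFactors, p := by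
    have h5 : ((∏ k ∈ range N.primeFactors.card, Nat.nth Nat.Prime k : ℕ) : ℝ) ≤
        ((∏ p ∈ N.primeFactors, p : ℕ) : ℝ) := by
      rw [Nat.cast_prod, Nat.cast_prod]
      exact h1
    exact Nat.cast_le.1 h5
  omega

lemma prod_geomSum_primeFactors_le {t N m : ℕ} (ht : 0 < t) (hm : 0 < m)
    (hcard : N.primeFactors.card ≤ m) :
    ∏ p ∈ N.primeFactors, ∑ i ∈ range t, (1 : ℝ) / (p : ℝ) ^ i ≤
      ∏ p ∈ Nat.primesLE (nthPrime m), ∑ i ∈ range t, (1 : ℝ) / (p : ℝ) ^ i := by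
  set g : ℕ → ℝ := fun p => ∑ i ∈ range t, (1 : ℝ) / (p : ℝ) ^ i with hg
  have hg1 : ∀ p, 1 ≤ g p := fun p => by
    have := Finset.single_le_sum (f := fun i => (1 : ℝ) / (p : ℝ) ^ i)
      (fun i _ => by positivity) (Finset.mem_range.2 ht)
    simpa [hg] using this
  have hg0 : ∀ p, 0 < g p := fun p => by linarith [hg1 p]
  have h1 := prod_nth_prime_le_prod (f := fun p => (g p)⁻¹) (fun p _ => inv_pos.2 (hg0 p))
    (fun p q hp hpq => by
      refine inv_anti₀ (hg0 q) (Finset.sum_le_sum fun i _ => ?_)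
      have : (0 : ℝ) < p := by exact_mod_cast hp.pos
      gcongr) N.primeFactors fun p hp => Nat.prime_of_mem_primeFactors hp
  rw [Finset.prod_inv_distrib, Finset.prod_inv_distrib,
    inv_le_inv₀ (Finset.prod_pos fun k _ => hg0 _) (Finset.prod_pos fun k _ => hg0 _)] at h1
  rw [← prod_range_nth_prime hm]
  refine h1.trans ?_
  rw [← Finset.prod_range_mul_prod_Ico _ hcard]
  refine le_mul_of_one_le_right (Finset.prod_pos fun k _ => hg0 _).le ?_
  exact Finset.prod_induction _ (1 ≤ ·) (fun a b => one_le_mul_of_one_le_of_one_le) le_rfl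
    fun k _ => hg1 _

lemma prod_geomSum_eq (t x : ℕ) :
    ∏ p ∈ Nat.primesLE x, ∑ i ∈ range t, (1 : ℝ) / (p : ℝ) ^ i =
      (∏ p ∈ Nat.primesLE x, (1 - ((p : ℝ) ^ t)⁻¹)⁻¹)⁻¹ *
        Real.exp (∑ p ∈ Nat.primesLE x, -Real.log (1 - (p : ℝ)⁻¹)) := by
  rw [Real.exp_sum, ← Finset.prod_inv_distrib, ← Finset.prod_mul_distrib]
  refine Finset.prod_congr rfl fun p hp => ?_
  have hp1 : (1 : ℝ) < p := by exact_mod_cast (Nat.mem_primesLE.1 hp).2.one_lt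
  have hq : (p : ℝ)⁻¹ < 1 := inv_lt_one_of_one_lt₀ hp1
  rw [Real.exp_neg, Real.exp_log (by linarith), inv_inv, ← inv_pow, ← div_eq_mul_inv,
    eq_div_iff (by linarith)]
  simp only [one_div, ← inv_pow]
  exact geom_sum_mul_neg _ t

lemma exists_primorialAt_le_lt {n N : ℕ} (hN : primorialAt n ≤ N) :
    ∃ m, n ≤ m ∧ primorialAt m ≤ N ∧ N < primorialAt (m + 1) := by
  have hbig : ∃ k, N < primorialAt k := by
    refine ⟨N, lt_of_lt_of_le Nat.lt_two_pow_self ?_⟩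
    have := Finset.prod_le_prod' (s := range N) (f := fun _ => 2) (g := Nat.nth Nat.Prime)
      fun k _ => (Nat.prime_nth_prime k).two_le
    simpa [primorialAt] using this
  have hmono : Monotone primorialAt := fun a b hab =>
    Finset.prod_le_prod_of_subset_of_one_le' (Finset.range_subset_range.2 hab)
      fun k _ _ => (Nat.prime_nth_prime k).pos
  have hlt := Nat.find_spec hbig
  have hnk : n < Nat.find hbig := by
    by_contra hcon
    have := hmono (not_lt.1 hcon)
    omega
  obtain ⟨m, hm⟩ : ∃ m, Nat.find hbig = m + 1 := ⟨Nat.find hbig - 1, by omega⟩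
  exact ⟨m, by omega, not_lt.1 (Nat.find_min hbig (by omega)), hm ▸ hlt⟩

theorem Rt_lt_exp_gamma_of_ge_primorial (t n : ℕ) (ht : 2 ≤ t) (hn : 2263 ≤ n)
    (h : ∀ m : ℕ, n ≤ m →
      Real.exp (2 / (nthPrime m : ℝ)) *
          (1 + 1.1253 / (Real.log (nthPrime m) * Real.log (Real.log (primorialAt m)))) <
        zetaNat t) :
    ∀ N : ℕ, primorialAt n ≤ N → Rt t N < Real.exp Real.eulerMascheroniConstant := by
  intro N hN
  obtain ⟨m, hnm, hmN, hNm⟩ := exists_primorialAt_le_lt hN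
  have hm0 : 0 < m := by omega
  have hx := nthPrime_ge (hn.trans hnm)
  have hm := h m hnm
  have hx' : (20000 : ℝ) ≤ nthPrime m := by exact_mod_cast hx
  have hpos : 0 < primorialAt m := Finset.prod_pos fun k _ => (Nat.prime_nth_prime k).pos
  have hNpos : 0 < N := by omega
  have hlogle : Chebyshev.theta (nthPrime m) ≤ Real.log N := by
    rw [← log_primorialAt hm0]
    exact Real.log_le_log (by exact_mod_cast hpos) (by exact_mod_cast hmN)
  rw [log_primorialAt hm0] at hm
  have hB := sum_neg_log_one_sub_inv_prime_le hx
  have hlt := log_theta_ge hx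
  have hlx := log_ge_of_ge_20000 hx'
  have hth := theta_ge_mul hx
  have hZ := tsum_inv_pow_le_exp_mul_prod ht (by omega : 0 < nthPrime m)
  have hG := (prod_geomSum_primeFactors_le (t := t) (by omega) hm0
    (card_primeFactors_le hNpos.ne' hNm)).trans_eq (prod_geomSum_eq t (nthPrime m))
  set M := Real.log (Chebyshev.theta (nthPrime m)) with hM
  have hM0 : 0 < M := by linarith
  set P := ∏ p ∈ Nat.primesLE (nthPrime m), (1 - ((p : ℝ) ^ t)⁻¹)⁻¹ with hP
  set F := 1 + 1.1253 / (Real.log (nthPrime m) * M) with hF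
  have hF0 : 0 < F := by positivity
  have hFP : F < P := lt_of_mul_lt_mul_left (hm.trans_le hZ) (Real.exp_pos _).le
  have hP0 : 0 < P := hF0.trans hFP
  have hlog : M ≤ Real.log (Real.log N) := Real.log_le_log (by linarith) hlogle
  have hexp : Real.exp (∑ p ∈ Nat.primesLE (nthPrime m), -Real.log (1 - (p : ℝ)⁻¹)) ≤
      Real.exp Real.eulerMascheroniConstant * M * F := by
    refine (Real.exp_le_exp.2 hB).trans_eq ?_
    rw [Real.exp_add, Real.exp_add, Real.exp_log hM0, Real.exp_log hF0]
  have hN' : (0 : ℝ) < N := by exact_mod_cast hNpos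
  have hE := Real.exp_pos Real.eulerMascheroniConstant
  rw [Rt, Psi, mul_div_mul_left _ _ hN'.ne', div_lt_iff₀ (by linarith)]
  calc _ ≤ P⁻¹ * (Real.exp Real.eulerMascheroniConstant * M * F) := hG.trans (by gcongr)
    _ = Real.exp Real.eulerMascheroniConstant * M * (F / P) := by ring
    _ < Real.exp Real.eulerMascheroniConstant * M * 1 := by
      gcongr
      rwa [div_lt_one hP0]
    _ ≤ _ := by
      rw [mul_one]
      gcongr
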